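/- Let z ∈ (1/2, 1), set α = 1/z, let μ be the unique absolutely continuous f_z-invariant Borel probability measure on [0,1], and let φ : [0,1] → ℝ be Hölder continuous with ∫ φ dμ = 0 and φ(0) ≠ 0. Set Φ_n = ∑_{j=0}^{n-1} φ ∘ f_z^j. Then for every q with 0 < q < α there exists a constant c > 0 such that ∫ |Φ_n|^q dμ / n^{q/α} → c as n → ∞. -/

import Mathlib

open MeasureTheory Set NNReal Filter

/-- The Liverani–Saussol–Vaienti (Pomeau–Manneville type) map with parameter `z`. -/
noncomputable def lsv (z : ℝ) (y : ℝ) : ℝ :=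
  if y < 1 / 2 then y * (1 + 2 ^ z * y ^ z) else 2 * y - 1

/-- The Birkhoff sum `Φ_n = ∑_{j=0}^{n-1} φ ∘ f_z^j`. -/
noncomputable def lsvBirkhoff (z : ℝ) (φ : ℝ → ℝ) (n : ℕ) (x : ℝ) : ℝ :=
  ∑ j ∈ Finset.range n, φ ((lsv z)^[j] x)

open MeasureTheory Set NNReal Filter

namespace LSVproof

lemma lint_split (g : ℝ → ℝ) (A B a b : ℝ) (ha : -1 < a) (hb : b < -1)
    (h1 : ∀ t ∈ Ioc (0:ℝ) 1, g t ≤ A * t ^ a) (h2 : ∀ t ∈ Ioi (1:ℝ), g t ≤ B * t ^ b) :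
    ∫⁻ t in Ioi (0:ℝ), ENNReal.ofReal (g t) < ⊤ := by
  rw [← Ioc_union_Ioi_eq_Ioi (zero_le_one' ℝ)]
  refine lt_of_le_of_lt (lintegral_union_le _ _ _) ?_
  have e1 : IntegrableOn (fun t : ℝ => A * t ^ a) (Ioc 0 1) :=
    ((intervalIntegral.intervalIntegrable_rpow' (a := 0) (b := 1) ha).1).const_mul A
  have e2 : IntegrableOn (fun t : ℝ => B * t ^ b) (Ioi 1) :=
    (integrableOn_Ioi_rpow_of_lt hb one_pos).const_mul B
  refine ENNReal.add_lt_top.2 ⟨?_, ?_⟩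
  · refine lt_of_le_of_lt ?_ e1.lintegral_lt_top
    exact setLIntegral_mono' measurableSet_Ioc (fun t ht => ENNReal.ofReal_le_ofReal (h1 t ht))
  · refine lt_of_le_of_lt ?_ e2.lintegral_lt_top
    exact setLIntegral_mono' measurableSet_Ioi (fun t ht => ENNReal.ofReal_le_ofReal (h2 t ht))

lemma one_sub_cos_le_rpow (p : ℝ) (hp0 : 0 ≤ p) (hp2 : p ≤ 2) (u : ℝ) :
    1 - Real.cos u ≤ 2 * |u| ^ p := by
  rcases le_or_gt |u| 1 with h | h
  · have h1 := Real.one_sub_sq_div_two_le_cos (x := u)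
    have h2 : u ^ 2 ≤ |u| ^ p := by
      rw [← sq_abs, ← Real.rpow_natCast]
      rcases eq_or_lt_of_le (abs_nonneg u) with h0 | h0
      · rw [← h0]
        rw [Real.zero_rpow (by norm_num)]
        positivity
      · exact Real.rpow_le_rpow_of_exponent_ge h0 h (by simpa using hp2)
    nlinarith [sq_nonneg u]
  · have := Real.one_le_rpow h.le hp0
    nlinarith [Real.neg_one_le_cos u]

lemma lint_cos_finite (q : ℝ) (hq : 0 < q) (hq2 : q < 2) :
    ∫⁻ t in Ioi (0:ℝ), ENNReal.ofReal ((1 - Real.cos t) * t ^ (-1 - q)) < ⊤ := by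
  refine lint_split _ 2 2 (1 - q) (-1 - q) (by linarith) (by linarith) ?_ ?_
  · intro t ht
    have := one_sub_cos_le_rpow 2 (by norm_num) le_rfl t
    rw [abs_of_pos ht.1] at this
    have h2 : (0:ℝ) ≤ t ^ (-1 - q) := Real.rpow_nonneg ht.1.le _
    calc _ ≤ (2 * t ^ (2:ℝ)) * t ^ (-1 - q) := by gcongr
      _ = 2 * t ^ (1 - q) := by rw [mul_assoc, ← Real.rpow_add ht.1]; congr 2; ring
  · intro t ht
    have h2 : (0:ℝ) ≤ t ^ (-1 - q) := Real.rpow_nonneg (zero_le_one.trans (le_of_lt ht)) _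
    gcongr
    linarith [Real.neg_one_le_cos t]

lemma integral_cos_scale (q x : ℝ) (hq : 0 < q) :
    ∫⁻ t in Ioi (0:ℝ), ENNReal.ofReal ((1 - Real.cos (t * x)) * t ^ (-1 - q))
      = ENNReal.ofReal (|x| ^ q) *
        ∫⁻ t in Ioi (0:ℝ), ENNReal.ofReal ((1 - Real.cos t) * t ^ (-1 - q)) := by
  rcases eq_or_ne x 0 with rfl | hx
  · simp [hq.ne']
  have hb : 0 < |x| := abs_pos.2 hx
  have him : (fun t : ℝ => |x| * t) '' (Ioi 0) = Ioi 0 := by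
    ext y
    simp only [mem_image, mem_Ioi]
    constructor
    · rintro ⟨t, ht, rfl⟩
      positivity
    · intro hy
      exact ⟨y / |x|, by positivity, by field_simp⟩
  have key := lintegral_image_eq_lintegral_abs_deriv_mul (s := Ioi (0:ℝ)) (f := fun t => |x| * t)
    (f' := fun _ => |x|) measurableSet_Ioi
    (fun t _ => by simpa using ((hasDerivAt_id t).const_mul |x|).hasDerivWithinAt)
    (fun a _ b _ h => mul_left_cancel₀ hb.ne' h)
    (fun t => ENNReal.ofReal ((1 - Real.cos t) * t ^ (-1 - q)))
  rw [him] at key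
  rw [key, ← lintegral_const_mul' _ _ ENNReal.ofReal_ne_top]
  refine setLIntegral_congr_fun measurableSet_Ioi (fun t ht => ?_)
  have ht' : (0:ℝ) < t := ht
  rw [← ENNReal.ofReal_mul (by positivity), ← ENNReal.ofReal_mul (by positivity)]
  congr 1
  have hc : Real.cos (|x| * t) = Real.cos (t * x) := by
    rw [← Real.cos_abs (t * x), abs_mul, abs_of_pos ht', mul_comm]
  rw [hc, abs_abs, Real.mul_rpow hb.le ht'.le]
  have : |x| ^ q * |x| * |x| ^ (-1 - q) = 1 := by
    nth_rewrite 2 [← Real.rpow_one |x|]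
    rw [← Real.rpow_add hb, ← Real.rpow_add hb, ← Real.rpow_zero |x|]
    congr 1
    ring
  calc _ = (1 - Real.cos (t * x)) * t ^ (-1 - q) * 1 := by ring
    _ = (1 - Real.cos (t * x)) * t ^ (-1 - q) * (|x| ^ q * |x| * |x| ^ (-1 - q)) := by rw [this]
    _ = _ := by ring

lemma lint_cos_pos (q : ℝ) :
    0 < ∫⁻ t in Ioi (0:ℝ), ENNReal.ofReal ((1 - Real.cos t) * t ^ (-1 - q)) := by
  rw [setLIntegral_pos_iff (by fun_prop)]
  refine lt_of_lt_of_le ?_ (measure_mono (s := Ioo (0:ℝ) 1) ?_)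
  · simp
  · intro t ht
    refine ⟨?_, ht.1⟩
    rw [Function.mem_support]
    have h1 : Real.cos t < 1 := by
      rw [← Real.cos_zero]
      exact Real.cos_lt_cos_of_nonneg_of_le_pi le_rfl (by linarith [ht.2, Real.pi_gt_three]) ht.1
    have : 0 < (1 - Real.cos t) * t ^ (-1 - q) :=
      mul_pos (by linarith) (Real.rpow_pos_of_pos ht.1 _)
    simpa using this

theorem moment_limit {Ω : Type*} [MeasurableSpace Ω] (μ : Measure Ω) [IsProbabilityMeasure μ]
    (X : ℕ → Ω → ℝ) (hX : ∀ n, AEMeasurable (X n) μ) (α q C : ℝ) (hq : 0 < q) (hqα : q < α)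
    (hα : α < 2)
    (tail : ∀ᶠ n in atTop, ∀ x : ℝ, 0 < x → μ {ω | x < |X n ω|} ≤ ENNReal.ofReal (C * x ^ (-α)))
    (χ : ℝ → ℝ)
    (hχ : ∀ t : ℝ, 0 < t → Tendsto (fun n => ∫ ω, Real.cos (t * X n ω) ∂μ) atTop (nhds (χ t)))
    (hpos : ∃ s : ℝ, 0 < s ∧ ∀ t, 0 < t → t < s → χ t < 1) :
    ∃ c : ℝ, 0 < c ∧ Tendsto (fun n => ∫ ω, |X n ω| ^ q ∂μ) atTop (nhds c) := by
  obtain ⟨p, hqp, hpα⟩ := exists_between hqα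
  have hp : 0 < p := hq.trans hqp
  -- uniform moment bound
  obtain ⟨K, hK0, hK⟩ : ∃ K : ℝ, 0 ≤ K ∧ ∀ᶠ n in atTop,
      ∫⁻ ω, ENNReal.ofReal (|X n ω| ^ p) ∂μ ≤ ENNReal.ofReal K := by
    have hfin : ∫⁻ t in Ioi (0:ℝ), ENNReal.ofReal (min 1 (C * t ^ (-α)) * t ^ (p - 1)) < ⊤ := by
      refine lint_split _ 1 C (p - 1) (p - 1 - α) (by linarith) (by linarith) ?_ ?_
      · intro t ht
        have h2 : (0:ℝ) ≤ t ^ (p - 1) := Real.rpow_nonneg ht.1.le _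
        gcongr
        exact min_le_left _ _
      · intro t ht
        have ht0 : (0:ℝ) < t := zero_lt_one.trans ht
        have h2 : (0:ℝ) ≤ t ^ (p - 1) := Real.rpow_nonneg ht0.le _
        calc _ ≤ (C * t ^ (-α)) * t ^ (p - 1) := by gcongr; exact min_le_right _ _
          _ = _ := by rw [mul_assoc, ← Real.rpow_add ht0]; congr 2; ring
    refine ⟨(ENNReal.ofReal p * ∫⁻ t in Ioi (0:ℝ),
      ENNReal.ofReal (min 1 (C * t ^ (-α)) * t ^ (p - 1))).toReal, ENNReal.toReal_nonneg, ?_⟩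
    filter_upwards [tail] with n hn
    rw [ENNReal.ofReal_toReal (ENNReal.mul_ne_top ENNReal.ofReal_ne_top hfin.ne)]
    rw [lintegral_rpow_eq_lintegral_meas_lt_mul _ (ae_of_all _ fun ω => abs_nonneg _)
      (continuous_abs.measurable.comp_aemeasurable (hX n) :
        AEMeasurable (fun ω => |X n ω|) μ) hp]
    refine mul_le_mul' le_rfl (setLIntegral_mono' measurableSet_Ioi (fun t ht => ?_))
    have ht0 : (0:ℝ) < t := ht
    have h2 : (0:ℝ) ≤ t ^ (p - 1) := Real.rpow_nonneg ht0.le _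
    rw [ENNReal.ofReal_mul' h2]
    gcongr
    rw [ENNReal.ofReal_min]
    refine le_min ?_ (hn t ht0)
    simpa using prob_le_one
  set I := ∫⁻ t in Ioi (0:ℝ), ENNReal.ofReal ((1 - Real.cos t) * t ^ (-1 - q)) with hI
  have hIfin : I < ⊤ := lint_cos_finite q hq (by linarith)
  have hIpos : 0 < I := lint_cos_pos q
  have hcosint : ∀ n (t : ℝ), Integrable (fun ω => Real.cos (t * X n ω)) μ := by
    intro n t
    refine Integrable.of_bound (C := 1) ?_ (ae_of_all _ fun ω => ?_)
    · exact (Real.continuous_cos.measurable.comp_aemeasurable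
        ((hX n).const_mul t)).aestronglyMeasurable
    · simpa using Real.abs_cos_le_one _
  -- Tonelli
  have hT : ∀ n, (∫⁻ ω, ENNReal.ofReal (|X n ω| ^ q) ∂μ) * I =
      ∫⁻ t in Ioi (0:ℝ), ENNReal.ofReal ((1 - ∫ ω, Real.cos (t * X n ω) ∂μ) * t ^ (-1 - q)) := by
    intro n
    rw [← lintegral_mul_const' _ _ hIfin.ne]
    have : ∀ ω, ENNReal.ofReal (|X n ω| ^ q) * I = ∫⁻ t in Ioi (0:ℝ),
        ENNReal.ofReal ((1 - Real.cos (t * X n ω)) * t ^ (-1 - q)) := fun ω =>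
      (integral_cos_scale q (X n ω) hq).symm
    simp_rw [this]
    rw [lintegral_lintegral_swap]
    · refine setLIntegral_congr_fun measurableSet_Ioi (fun t ht => ?_)
      have ht0 : (0:ℝ) < t := ht
      have h2 : (0:ℝ) ≤ t ^ (-1 - q) := Real.rpow_nonneg ht0.le _
      rw [← ofReal_integral_eq_lintegral_ofReal]
      · rw [integral_mul_const, integral_sub (integrable_const _) (hcosint n t)]
        simp
      · exact (((integrable_const _).sub (hcosint n t))).mul_const _
      · refine ae_of_all _ fun ω => ?_
        exact mul_nonneg (by simpa using Real.cos_le_one _) h2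
    · refine Measurable.comp_aemeasurable ENNReal.measurable_ofReal ?_
      have hx : AEMeasurable (fun a : Ω × ℝ => X n a.1) (μ.prod (volume.restrict (Ioi 0))) :=
        (hX n).comp_fst
      refine AEMeasurable.mul ?_ (by fun_prop)
      refine aemeasurable_const.sub (Real.continuous_cos.measurable.comp_aemeasurable ?_)
      exact measurable_snd.aemeasurable.mul hx
  have hmeas : ∀ n, Measurable (fun t : ℝ => (1 - ∫ ω, Real.cos (t * X n ω) ∂μ) * t ^ (-1 - q)) := by
    intro n
    have hcont : Continuous (fun t : ℝ => ∫ ω, Real.cos (t * X n ω) ∂μ) := by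
      refine continuous_of_dominated (bound := fun _ => 1) (fun t => (hcosint n t).1)
        (fun t => ae_of_all _ fun ω => by simpa using Real.abs_cos_le_one _)
        (integrable_const _) (ae_of_all _ fun ω => by fun_prop)
    have := hcont.measurable
    fun_prop
  set L := ∫⁻ t in Ioi (0:ℝ), ENNReal.ofReal ((1 - χ t) * t ^ (-1 - q)) with hL
  have hbound : ∀ᶠ n in atTop, ∀ t : ℝ, 0 < t → 1 - ∫ ω, Real.cos (t * X n ω) ∂μ ≤
      min 2 (2 * K * t ^ p) := by
    filter_upwards [hK] with n hn t ht
    have e1 : 1 - ∫ ω, Real.cos (t * X n ω) ∂μ = ∫ ω, (1 - Real.cos (t * X n ω)) ∂μ := by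
      rw [integral_sub (integrable_const _) (hcosint n t)]; simp
    refine le_min ?_ ?_
    · rw [e1]
      calc _ ≤ ∫ ω, (2:ℝ) ∂μ := by
            refine integral_mono ((integrable_const _).sub (hcosint n t)) (integrable_const _) ?_
            intro ω
            linarith [Real.neg_one_le_cos (t * X n ω)]
        _ = 2 := by simp
    · rw [e1, integral_eq_lintegral_of_nonneg_ae (ae_of_all _ fun ω => by
        simpa using Real.cos_le_one _) (show AEStronglyMeasurable (fun ω => 1 - Real.cos (t * X n ω)) μ from
        (aestronglyMeasurable_const).sub (hcosint n t).1)]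
      refine ENNReal.toReal_le_of_le_ofReal (by positivity) ?_
      calc _ ≤ ∫⁻ ω, ENNReal.ofReal (2 * t ^ p) * ENNReal.ofReal (|X n ω| ^ p) ∂μ := by
            refine lintegral_mono fun ω => ?_
            rw [← ENNReal.ofReal_mul (by positivity)]
            refine ENNReal.ofReal_le_ofReal ?_
            have := one_sub_cos_le_rpow p hp.le (by linarith) (t * X n ω)
            rw [abs_mul, abs_of_pos ht, Real.mul_rpow ht.le (abs_nonneg _)] at this
            linarith
        _ ≤ ENNReal.ofReal (2 * t ^ p) * ENNReal.ofReal K := by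
            rw [lintegral_const_mul' _ _ ENNReal.ofReal_ne_top]
            gcongr
        _ = _ := by
            rw [← ENNReal.ofReal_mul (by positivity)]; congr 1; ring
  have hbfin : ∫⁻ t in Ioi (0:ℝ), ENNReal.ofReal (min 2 (2 * K * t ^ p) * t ^ (-1 - q)) < ⊤ := by
    refine lint_split _ (2 * K) 2 (p - 1 - q) (-1 - q) (by linarith) (by linarith) ?_ ?_
    · intro t ht
      have h2 : (0:ℝ) ≤ t ^ (-1 - q) := Real.rpow_nonneg ht.1.le _
      calc _ ≤ (2 * K * t ^ p) * t ^ (-1 - q) := by gcongr; exact min_le_right _ _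
          _ = _ := by rw [mul_assoc, ← Real.rpow_add ht.1]; congr 2; ring
    · intro t ht
      have h2 : (0:ℝ) ≤ t ^ (-1 - q) := Real.rpow_nonneg (zero_le_one.trans (le_of_lt ht)) _
      gcongr
      exact min_le_left _ _
  have hlim : Tendsto (fun n => (∫⁻ ω, ENNReal.ofReal (|X n ω| ^ q) ∂μ) * I) atTop (nhds L) := by
    simp_rw [hT]
    refine tendsto_lintegral_filter_of_dominated_convergence
      (fun t => ENNReal.ofReal (min 2 (2 * K * t ^ p) * t ^ (-1 - q))) ?_ ?_ hbfin.ne ?_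
    · exact Eventually.of_forall fun n => (hmeas n).ennreal_ofReal
    · filter_upwards [hbound] with n hn
      refine (ae_restrict_iff' measurableSet_Ioi).2 (ae_of_all _ fun t ht => ?_)
      refine ENNReal.ofReal_le_ofReal ?_
      have h2 : (0:ℝ) ≤ t ^ (-1 - q) := Real.rpow_nonneg (le_of_lt ht) _
      gcongr
      exact hn t ht
    · refine (ae_restrict_iff' measurableSet_Ioi).2 (ae_of_all _ fun t ht => ?_)
      exact ENNReal.tendsto_ofReal (((hχ t ht).const_sub 1).mul_const _)
  have hLfin : L < ⊤ := by
    refine lt_of_le_of_lt (setLIntegral_mono' measurableSet_Ioi (fun t ht => ?_)) hbfin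
    have h2 : (0:ℝ) ≤ t ^ (-1 - q) := Real.rpow_nonneg (le_of_lt ht) _
    refine ENNReal.ofReal_le_ofReal ?_
    gcongr
    refine le_of_tendsto ((hχ t ht).const_sub 1) ?_
    filter_upwards [hbound] with n hn using hn t ht
  have hLpos : 0 < L := by
    obtain ⟨s, hs, hs1⟩ := hpos
    rw [pos_iff_ne_zero]
    intro h0
    have hm : AEMeasurable (fun t : ℝ => ENNReal.ofReal ((1 - χ t) * t ^ (-1 - q)))
        (volume.restrict (Ioi 0)) := by
      refine (aemeasurable_of_tendsto_metrizable_ae' (fun n => (hmeas n).aemeasurable)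
        ((ae_restrict_iff' measurableSet_Ioi).2 (ae_of_all _ fun t ht => ?_))).ennreal_ofReal
      exact ((hχ t ht).const_sub 1).mul_const _
    rw [hL, lintegral_eq_zero_iff' hm, Filter.EventuallyEq, ae_restrict_iff' measurableSet_Ioi] at h0
    have : volume (Ioo (0:ℝ) s) = 0 := by
      refine measure_mono_null ?_ h0
      intro t ht hh
      have := hh ht.1
      simp only [Pi.zero_apply, ENNReal.ofReal_eq_zero] at this
      have h5 : 0 < (1 - χ t) * t ^ (-1 - q) :=
        mul_pos (by linarith [hs1 t ht.1 ht.2]) (Real.rpow_pos_of_pos ht.1 _)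
      linarith
    simp at this
    linarith
  refine ⟨(L / I).toReal, ENNReal.toReal_pos (ENNReal.div_pos hLpos.ne' hIfin.ne).ne'
    (ENNReal.div_ne_top hLfin.ne hIpos.ne'), ?_⟩
  have h3 : Tendsto (fun n => ∫⁻ ω, ENNReal.ofReal (|X n ω| ^ q) ∂μ) atTop (nhds (L / I)) := by
    have := ENNReal.Tendsto.div_const hlim (Or.inr hIpos.ne') (b := I)
    refine this.congr fun n => ?_
    rw [ENNReal.mul_div_cancel_right hIpos.ne' hIfin.ne]
  have h4 := (ENNReal.tendsto_toReal (ENNReal.div_ne_top hLfin.ne hIpos.ne')).comp h3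
  refine h4.congr fun n => ?_
  simp only [Function.comp]
  rw [integral_eq_lintegral_of_nonneg_ae (ae_of_all _ fun ω => by positivity)]
  exact ((continuous_abs.measurable.comp_aemeasurable (hX n)).pow_const q).aestronglyMeasurable

end LSVproof

open MeasureTheory Set NNReal Filter

namespace LSVproof

set_option linter.unusedSectionVars false
set_option linter.unusedVariables false

section stable
variable {Ω : Type*} [MeasurableSpace Ω] (P : Measure Ω) [IsProbabilityMeasure P] (R : Ω → ℕ)

lemma tail_bound (α c : ℝ) (hα : 0 < α)
    (htail : Tendsto (fun n : ℕ => P.real {ω | n < R ω} * (n:ℝ) ^ α) atTop (nhds c)) :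
    ∃ C : ℝ, 0 < C ∧ ∀ y : ℝ, 0 < y → P.real {ω | y < R ω} ≤ C * y ^ (-α) := by
  obtain ⟨C0, hC0⟩ := htail.bddAbove_range
  refine ⟨max 1 (C0 * 2 ^ α), by positivity, fun y hy => ?_⟩
  rcases lt_or_ge y 1 with h | h
  · calc P.real {ω | y < R ω} ≤ 1 := measureReal_le_one
      _ ≤ 1 * y ^ (-α) := by
        rw [one_mul]
        exact Real.one_le_rpow_of_pos_of_le_one_of_nonpos hy h.le (by linarith)
      _ ≤ _ := by gcongr; exact le_max_left _ _
  · have hn : 1 ≤ ⌊y⌋₊ := Nat.one_le_floor_iff _ |>.2 h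
    have h1 : P.real {ω | y < R ω} ≤ P.real {ω | ⌊y⌋₊ < R ω} := by
      refine measureReal_mono (fun ω hω => ?_)
      have hω' : y < R ω := hω
      have : ((⌊y⌋₊ : ℕ) : ℝ) < R ω := (Nat.floor_le hy.le).trans_lt hω'
      exact_mod_cast this
    have h2 : P.real {ω | ⌊y⌋₊ < R ω} * (⌊y⌋₊:ℝ) ^ α ≤ C0 := hC0 ⟨⌊y⌋₊, rfl⟩
    have hn' : (1:ℝ) ≤ ⌊y⌋₊ := by exact_mod_cast hn
    have h3 : y / 2 ≤ ⌊y⌋₊ := by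
      have := Nat.lt_floor_add_one y
      linarith
    have h4 : (y / 2) ^ α ≤ (⌊y⌋₊:ℝ) ^ α := Real.rpow_le_rpow (by positivity) h3 hα.le
    have h5 : P.real {ω | y < R ω} * (y / 2) ^ α ≤ C0 := by
      refine le_trans ?_ h2
      gcongr
    rw [Real.div_rpow hy.le (by norm_num)] at h5
    have hyα : 0 < y ^ α := Real.rpow_pos_of_pos hy _
    have h2α : (0:ℝ) < 2 ^ α := by positivity
    calc P.real {ω | y < R ω} ≤ (C0 * 2 ^ α) * y ^ (-α) := by
          rw [Real.rpow_neg hy.le, ← div_eq_mul_inv, le_div_iff₀ hyα]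
          rw [mul_div_assoc', div_le_iff₀ h2α] at h5
          exact h5
      _ ≤ _ := by gcongr; exact le_max_right _ _

lemma tail_real (α c : ℝ) (hα : 0 < α)
    (htail : Tendsto (fun n : ℕ => P.real {ω | n < R ω} * (n:ℝ) ^ α) atTop (nhds c)) :
    Tendsto (fun y : ℝ => P.real {ω | y < R ω} * y ^ α) atTop (nhds c) := by
  have h1 := htail.comp (tendsto_nat_floor_atTop (α := ℝ))
  have h2 : Tendsto (fun y : ℝ => (⌊y⌋₊ / y : ℝ)) atTop (nhds 1) := tendsto_nat_floor_div_atTop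
  have h3 : Tendsto (fun y : ℝ => (⌊y⌋₊ / y : ℝ) ^ α) atTop (nhds 1) := by
    simpa using h2.rpow_const (p := α) (Or.inl one_ne_zero)
  have h4 := h1.div h3 one_ne_zero
  rw [div_one] at h4
  refine h4.congr' ?_
  filter_upwards [eventually_ge_atTop 1] with y hy
  have hy0 : 0 < y := by linarith
  have hn : 1 ≤ ⌊y⌋₊ := Nat.one_le_floor_iff _ |>.2 hy
  have hn' : (0:ℝ) < ⌊y⌋₊ := by exact_mod_cast hn
  have e : {ω | y < R ω} = {ω | ⌊y⌋₊ < R ω} := by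
    ext ω
    simp only [mem_ofPred_eq]
    rw [Nat.floor_lt hy0.le]
  simp only [Function.comp, Pi.div_apply]
  rw [e, Real.div_rpow hn'.le hy0.le]
  have := Real.rpow_pos_of_pos hn' α
  have := Real.rpow_pos_of_pos hy0 α
  field_simp

lemma exp_sub_one_norm (w : ℝ) : ‖Complex.exp (Complex.I * w) - 1‖ ≤ min 2 |w| := by
  refine le_min ?_ ?_
  · calc _ ≤ ‖Complex.exp (Complex.I * w)‖ + ‖(1:ℂ)‖ := norm_sub_le _ _
      _ = 2 := by rw [mul_comm, Complex.norm_exp_ofReal_mul_I]; norm_num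
  · have := Real.norm_exp_I_mul_ofReal_sub_one_le (x := w)
    simpa using this

lemma integral_G_eq (hR : Measurable R) (hRintg : Integrable (fun ω => (R ω : ℝ)) P) (u : ℝ) :
    ∫ ω, (Complex.exp (Complex.I * (u * R ω : ℝ)) - 1 - Complex.I * (u * R ω : ℝ)) ∂P =
      ∫ y in Ioi (0:ℝ), (Complex.I * u * (Complex.exp (Complex.I * (u * y : ℝ)) - 1)) *
        (P.real {ω | y < R ω} : ℂ) := by
  have h1 : ∀ n : ℕ, Complex.exp (Complex.I * (u * n : ℝ)) - 1 - Complex.I * (u * n : ℝ) =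
      ∫ y in Ioi (0:ℝ), (Ioo (0:ℝ) n).indicator
        (fun y => (Complex.I * u * (Complex.exp (Complex.I * (u * y : ℝ)) - 1))) y := by
    intro n
    rw [setIntegral_indicator measurableSet_Ioo, inter_eq_self_of_subset_right
      (fun y hy => hy.1), ← integral_Ioc_eq_integral_Ioo,
      ← intervalIntegral.integral_of_le (Nat.cast_nonneg n)]
    have hd : ∀ y ∈ uIcc (0:ℝ) n, HasDerivAt (fun y : ℝ => Complex.exp (Complex.I * (u * y : ℝ)) - 1
        - Complex.I * (u * y : ℝ)) (Complex.I * u * (Complex.exp (Complex.I * (u * y : ℝ)) - 1)) y := by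
      intro y _
      have h0 : HasDerivAt (fun y : ℝ => Complex.I * ((u * y : ℝ) : ℂ)) (Complex.I * u) y := by
        have := ((hasDerivAt_id y).const_mul u).ofReal_comp.const_mul Complex.I
        simpa using this
      have h := (h0.cexp.sub_const 1).sub h0
      have e : Complex.exp (Complex.I * ((u * y : ℝ):ℂ)) * (Complex.I * u) - Complex.I * u =
        (Complex.I * u * (Complex.exp (Complex.I * (u * y : ℝ)) - 1)) := by ring
      rw [← e]
      exact h
    rw [intervalIntegral.integral_eq_sub_of_hasDerivAt hd]
    · simp
    · apply Continuous.intervalIntegrable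
      fun_prop
  simp_rw [h1]
  rw [integral_integral_swap]
  · refine setIntegral_congr_fun measurableSet_Ioi (fun y hy => ?_)
    have hy' : (0:ℝ) < y := hy
    have : ∀ ω, (Ioo (0:ℝ) (R ω)).indicator
        (fun y => (Complex.I * u * (Complex.exp (Complex.I * (u * y : ℝ)) - 1))) y =
        {ω | y < (R ω:ℝ)}.indicator (fun _ => (Complex.I * u * (Complex.exp (Complex.I * (u * y : ℝ)) - 1))) ω := by
      intro ω
      simp [indicator_apply, hy']
    simp_rw [this]
    have hm : MeasurableSet {ω | y < (R ω:ℝ)} := measurableSet_lt measurable_const (by fun_prop)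
    rw [integral_indicator_const _ hm, Complex.real_smul, mul_comm]
  · have hR' : Measurable (fun ω => (R ω : ℝ)) := by fun_prop
    set S : Set (Ω × ℝ) := {p | p.2 ∈ Ioo (0:ℝ) (R p.1)} with hS
    have hSm : MeasurableSet S := by
      refine (measurableSet_lt measurable_const measurable_snd).inter
        (measurableSet_lt measurable_snd (hR'.comp measurable_fst))
    have e : (Function.uncurry fun (ω : Ω) (y : ℝ) => (Ioo (0:ℝ) (R ω)).indicator
        (fun y => (Complex.I * u * (Complex.exp (Complex.I * (u * y : ℝ)) - 1))) y) =
        S.indicator (fun p => (Complex.I * u * (Complex.exp (Complex.I * (u * p.2 : ℝ)) - 1))) := by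
      ext p
      simp only [Function.uncurry, indicator_apply, hS, mem_ofPred_eq]
    rw [e, integrable_indicator_iff hSm]
    have hfin : (P.prod (volume.restrict (Ioi (0:ℝ)))) S < ⊤ := by
      rw [Measure.prod_apply hSm]
      have : ∀ ω, (volume.restrict (Ioi (0:ℝ))) (Prod.mk ω ⁻¹' S) ≤ ENNReal.ofReal (R ω) := by
        intro ω
        refine (Measure.restrict_apply_le _ _).trans ?_
        have : Prod.mk ω ⁻¹' S = Ioo (0:ℝ) (R ω) := by ext; simp [hS]
        rw [this, Real.volume_Ioo, sub_zero]
      exact (lintegral_mono this).trans_lt hRintg.lintegral_lt_top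
    have hgc : Continuous (fun y : ℝ => (Complex.I * u * (Complex.exp (Complex.I * (u * y : ℝ)) - 1))) := by
      fun_prop
    refine Measure.integrableOn_of_bounded (M := |u| * 2) hfin.ne
      ((hgc.measurable.comp measurable_snd).aestronglyMeasurable) (ae_of_all _ fun p => ?_)
    rw [norm_mul, norm_mul]
    have := (exp_sub_one_norm (u * p.2)).trans (min_le_left _ _)
    simp only [Complex.norm_I, one_mul, Complex.norm_real, Real.norm_eq_abs]
    gcongr

lemma bound_int (α : ℝ) (h1 : 1 < α) (h2 : α < 2) :
    IntegrableOn (fun w : ℝ => min 2 |w| * w ^ (-α)) (Ioi 0) := by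
  have hm : Measurable (fun w : ℝ => min 2 |w| * w ^ (-α)) := by fun_prop
  rw [← Ioc_union_Ioi_eq_Ioi (zero_le_one (α := ℝ))]
  refine IntegrableOn.union ?_ ?_
  · have : IntegrableOn (fun w : ℝ => w ^ (1-α)) (Ioc 0 1) := by
      rw [← intervalIntegrable_iff_integrableOn_Ioc_of_le zero_le_one]
      exact intervalIntegral.intervalIntegrable_rpow' (by linarith)
    refine this.mono' hm.aestronglyMeasurable ((ae_restrict_mem measurableSet_Ioc).mono fun w hw => ?_)
    have hw0 : 0 < w := hw.1
    rw [Real.norm_of_nonneg (by positivity), sub_eq_add_neg, Real.rpow_add hw0, Real.rpow_one]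
    gcongr
    rw [abs_of_pos hw0]; exact min_le_right _ _
  · have : IntegrableOn (fun w : ℝ => 2 * w ^ (-α)) (Ioi 1) :=
      (integrableOn_Ioi_rpow_of_lt (by linarith) one_pos).const_mul 2
    refine this.mono' hm.aestronglyMeasurable ((ae_restrict_mem measurableSet_Ioi).mono fun w hw => ?_)
    have hw0 : (0:ℝ) < w := lt_trans one_pos hw
    rw [Real.norm_of_nonneg (by positivity)]
    gcongr
    exact min_le_left _ _

lemma char_G (hR : Measurable R) (hRintg : Integrable (fun ω => (R ω : ℝ)) P)
    (α c : ℝ) (h1 : 1 < α) (h2 : α < 2) (hc : 0 < c)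
    (htail : Tendsto (fun n : ℕ => P.real {ω | n < R ω} * (n:ℝ) ^ α) atTop (nhds c)) :
    ∃ ψ : ℂ, ψ ≠ 0 ∧ Tendsto (fun u : ℝ =>
      (∫ ω, (Complex.exp (Complex.I * (u * R ω : ℝ)) - 1 - Complex.I * (u * R ω : ℝ)) ∂P) / ((u ^ α : ℝ) : ℂ))
      (nhdsWithin 0 (Ioi 0)) (nhds ψ) := by
  obtain ⟨C, hC, hCb⟩ := tail_bound P R α c (by linarith) htail
  have htr := tail_real P R α c (by linarith) htail
  have hbi := bound_int α h1 h2
  set L : ℝ → ℂ := fun w => Complex.I * (Complex.exp (Complex.I * (w : ℝ)) - 1) * ((c * w ^ (-α) : ℝ) : ℂ) with hL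
  have hLc : Measurable L := by
    have : Continuous (fun w : ℝ => Complex.I * (Complex.exp (Complex.I * (w : ℝ)) - 1)) := by fun_prop
    refine this.measurable.mul ?_
    fun_prop
  have hLi : IntegrableOn L (Ioi 0) := by
    refine (hbi.const_mul c).mono' hLc.aestronglyMeasurable
      ((ae_restrict_mem measurableSet_Ioi).mono fun w hw => ?_)
    have hw0 : (0:ℝ) < w := hw
    rw [hL]
    simp only [norm_mul, Complex.norm_I, one_mul, Complex.norm_real]
    rw [Real.norm_of_nonneg hc.le, Real.norm_of_nonneg (by positivity)]
    have := exp_sub_one_norm w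
    calc _ ≤ min 2 |w| * (c * w ^ (-α)) := by gcongr
      _ = _ := by ring
  refine ⟨∫ w in Ioi 0, L w, ?_, ?_⟩
  · intro h0
    have him : ∫ w in Ioi 0, (L w).im = 0 := by
      have := integral_im (𝕜 := ℂ) hLi
      simp only [RCLike.im_to_complex] at this
      rw [this, h0]; rfl
    have e : ∀ w : ℝ, (L w).im = - (c * ((1 - Real.cos w) * w ^ (-1-(α-1)))) := by
      intro w
      have : L w = ((c * w ^ (-α) : ℝ) : ℂ) * (Complex.I * (Complex.exp (w * Complex.I) - 1)) := by
        rw [hL]; simp only; rw [mul_comm Complex.I (w:ℂ)]; ring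
      rw [this, Complex.im_ofReal_mul, Complex.I_mul_im, Complex.sub_re, Complex.exp_ofReal_mul_I_re]
      have : -1 - (α - 1) = -α := by ring
      rw [this]
      simp; ring
    simp_rw [e] at him
    rw [integral_neg, neg_eq_zero, integral_const_mul] at him
    have him' := (mul_eq_zero.1 him).resolve_left hc.ne'
    have hp := lint_cos_pos (α - 1)
    have hRintg' : IntegrableOn (fun w : ℝ => (1 - Real.cos w) * w ^ (-1-(α-1))) (Ioi 0) := by
      have h3 : IntegrableOn (fun w => (L w).im) (Ioi 0) := hLi.im
      simp_rw [e] at h3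
      have h4 := h3.neg.const_mul (c⁻¹)
      refine h4.congr (ae_of_all _ fun w => ?_)
      simp only [Pi.neg_apply, neg_neg]
      field_simp
    rw [← ofReal_integral_eq_lintegral_ofReal hRintg'] at hp
    · rw [him'] at hp; simp at hp
    · refine (ae_restrict_mem measurableSet_Ioi).mono fun w hw => ?_
      have hw0 : (0:ℝ) < w := hw
      have := Real.cos_le_one w
      simp only [Pi.zero_apply]
      have : 0 ≤ 1 - Real.cos w := by linarith
      positivity
  · have key : ∀ u : ℝ, 0 < u → (∫ ω, (Complex.exp (Complex.I * (u * R ω : ℝ)) - 1 - Complex.I * (u * R ω : ℝ)) ∂P) / ((u ^ α : ℝ) : ℂ)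
        = ∫ w in Ioi (0:ℝ), Complex.I * (Complex.exp (Complex.I * (w : ℝ)) - 1) *
          ((P.real {ω | w / u < R ω} * u ^ (-α) : ℝ) : ℂ) := by
      intro u hu
      rw [integral_G_eq P R hR hRintg u]
      have hs := integral_comp_mul_left_Ioi (fun w : ℝ => (Complex.I * u * (Complex.exp (Complex.I * (w : ℝ)) - 1)) *
        (P.real {ω | w / u < R ω} : ℂ)) 0 hu
      rw [mul_zero] at hs
      have e : ∀ y : ℝ, u * y / u = y := fun y => by field_simp
      simp only [e] at hs
      rw [hs, div_eq_mul_inv, ← Complex.ofReal_inv, ← Real.rpow_neg hu.le, Complex.real_smul, mul_assoc,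
        ← integral_mul_const, ← integral_const_mul]
      refine integral_congr_ae (ae_of_all _ fun w => ?_)
      simp only [Complex.ofReal_mul, Complex.ofReal_inv]
      have : (u:ℂ) ≠ 0 := by exact_mod_cast hu.ne'
      field_simp
    refine (tendsto_congr' ?_).2 (?_ : Tendsto (fun u : ℝ => ∫ w in Ioi (0:ℝ), Complex.I * (Complex.exp (Complex.I * (w : ℝ)) - 1) *
          ((P.real {ω | w / u < R ω} * u ^ (-α) : ℝ) : ℂ)) _ _)
    · filter_upwards [self_mem_nhdsWithin] with u hu using key u hu
    refine tendsto_integral_filter_of_dominated_convergence (fun w => C * (min 2 |w| * w ^ (-α))) ?_ ?_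
      (hbi.const_mul C) ?_
    · filter_upwards [self_mem_nhdsWithin] with u hu
      have hu0 : (0:ℝ) < u := hu
      have hanti : Antitone (fun w : ℝ => P.real {ω | w / u < R ω}) := by
        intro a b hab
        refine measureReal_mono (fun ω hω => ?_)
        have : b / u < R ω := hω
        have h3 : a / u ≤ b / u := by gcongr
        exact h3.trans_lt this
      have : Continuous (fun w : ℝ => Complex.I * (Complex.exp (Complex.I * (w : ℝ)) - 1)) := by fun_prop
      refine (this.measurable.mul ?_).aestronglyMeasurable
      exact Complex.measurable_ofReal.comp (hanti.measurable.mul_const _)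
    · filter_upwards [self_mem_nhdsWithin] with u hu
      refine (ae_restrict_mem measurableSet_Ioi).mono fun w hw => ?_
      have hw0 : (0:ℝ) < w := hw
      have hu0 : (0:ℝ) < u := hu
      rw [norm_mul, norm_mul, Complex.norm_I, one_mul, Complex.norm_real, Real.norm_of_nonneg (by positivity)]
      have h3 := hCb (w / u) (by positivity)
      have h4 : P.real {ω | w / u < R ω} * u ^ (-α) ≤ C * w ^ (-α) := by
        calc _ ≤ C * (w / u) ^ (-α) * u ^ (-α) := by gcongr
          _ = _ := by
            rw [Real.div_rpow hw0.le hu0.le]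
            have := Real.rpow_pos_of_pos hu0 (-α)
            field_simp
      calc _ ≤ min 2 |w| * (C * w ^ (-α)) := by
            have := exp_sub_one_norm w
            gcongr
        _ = _ := by ring
    · refine (ae_restrict_mem measurableSet_Ioi).mono fun w hw => ?_
      have hw0 : (0:ℝ) < w := hw
      refine Tendsto.mul tendsto_const_nhds ?_
      refine (Complex.continuous_ofReal.tendsto _).comp ?_
      have hdiv : Tendsto (fun u : ℝ => w / u) (nhdsWithin 0 (Ioi 0)) atTop := by
        simp_rw [div_eq_mul_inv]
        exact tendsto_inv_nhdsGT_zero.const_mul_atTop hw0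
      have h3 := (htr.comp hdiv).mul_const (w ^ (-α))
      refine h3.congr' ?_
      filter_upwards [self_mem_nhdsWithin] with u hu
      have hu0 : (0:ℝ) < u := hu
      simp only [Function.comp]
      rw [Real.div_rpow hw0.le hu0.le, Real.rpow_neg hw0.le, Real.rpow_neg hu0.le]
      have := Real.rpow_pos_of_pos hu0 α
      have := Real.rpow_pos_of_pos hw0 α
      field_simp

lemma char_R (hR : Measurable R) (hRintg : Integrable (fun ω => (R ω : ℝ)) P)
    (α c r : ℝ) (h1 : 1 < α) (h2 : α < 2) (hc : 0 < c) (hr : r = ∫ ω, (R ω : ℝ) ∂P)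
    (htail : Tendsto (fun n : ℕ => P.real {ω | n < R ω} * (n:ℝ) ^ α) atTop (nhds c)) :
    ∃ ψ : ℂ, ψ ≠ 0 ∧ Tendsto (fun u : ℝ =>
      ((∫ ω, Complex.exp (Complex.I * (u * (R ω - r) : ℝ)) ∂P) - 1) / ((u ^ α : ℝ) : ℂ))
      (nhdsWithin 0 (Ioi 0)) (nhds ψ) := by
  obtain ⟨ψ, hψ, hlim⟩ := char_G P R hR hRintg α c h1 h2 hc htail
  refine ⟨ψ, hψ, ?_⟩
  have hRm : Measurable (fun ω => (R ω : ℝ)) := by fun_prop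
  have key : ∀ u : ℝ, (∫ ω, Complex.exp (Complex.I * (u * (R ω - r) : ℝ)) ∂P) - 1 =
     Complex.exp (Complex.I * (-(u * r) : ℝ)) * (∫ ω, (Complex.exp (Complex.I * (u * R ω : ℝ)) - 1 - Complex.I * (u * R ω : ℝ)) ∂P)
      - Complex.exp (Complex.I * (-(u * r) : ℝ)) * (Complex.exp (Complex.I * (u * r : ℝ)) - 1 - Complex.I * (u * r : ℝ)) := by
    intro u
    have hci : Integrable (fun ω => Complex.exp (Complex.I * (u * R ω : ℝ))) P := by
      refine Integrable.of_bound (C := 1) ?_ (ae_of_all _ fun ω => ?_)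
      · have : Continuous (fun x : ℝ => Complex.exp (Complex.I * (u * x : ℝ))) := by fun_prop
        exact (this.measurable.comp hRm).aestronglyMeasurable
      · rw [mul_comm, Complex.norm_exp_ofReal_mul_I]
    have hRi : Integrable (fun ω => Complex.I * ((u * R ω : ℝ) : ℂ)) P :=
      ((hRintg.const_mul u).ofReal).const_mul _
    have h3 : ∫ ω, (Complex.exp (Complex.I * (u * R ω : ℝ)) - 1 - Complex.I * (u * R ω : ℝ)) ∂P
       = (∫ ω, Complex.exp (Complex.I * (u * R ω : ℝ)) ∂P) - 1 - Complex.I * (u * r : ℝ) := by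
      have hci1 : Integrable (fun ω => Complex.exp (Complex.I * (u * R ω : ℝ)) - 1) P :=
        hci.sub (integrable_const _)
      rw [integral_sub hci1 hRi, integral_sub hci (integrable_const _),
        integral_const_mul, integral_complex_ofReal, integral_const_mul, ← hr]
      simp
    have h4 : ∀ ω, Complex.exp (Complex.I * (u * (R ω - r) : ℝ)) =
        Complex.exp (Complex.I * (-(u * r) : ℝ)) * Complex.exp (Complex.I * (u * R ω : ℝ)) := by
      intro ω
      rw [← Complex.exp_add]; congr 1; push_cast; ring
    have h5 : Complex.exp (Complex.I * (-(u * r) : ℝ)) * Complex.exp (Complex.I * (u * r : ℝ)) = 1 := by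
      rw [← Complex.exp_add, Complex.exp_eq_one_iff.2 ⟨0, by push_cast; ring⟩]
    simp_rw [h4]
    rw [integral_const_mul, h3]
    linear_combination h5
  have he : Tendsto (fun u : ℝ => Complex.exp (Complex.I * (-(u * r) : ℝ))) (nhdsWithin 0 (Ioi 0)) (nhds 1) := by
    have : Continuous (fun u : ℝ => Complex.exp (Complex.I * (-(u * r) : ℝ))) := by fun_prop
    have h3 := this.tendsto 0
    simp only [zero_mul, neg_zero, Complex.ofReal_zero, mul_zero, Complex.exp_zero] at h3
    exact h3.mono_left nhdsWithin_le_nhds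
  have hsm : Tendsto (fun u : ℝ => (Complex.exp (Complex.I * (u * r : ℝ)) - 1 - Complex.I * (u * r : ℝ)) / ((u ^ α : ℝ) : ℂ))
      (nhdsWithin 0 (Ioi 0)) (nhds 0) := by
    have hz : Tendsto (fun u : ℝ => r ^ 2 * u ^ (2 - α)) (nhdsWithin 0 (Ioi 0)) (nhds 0) := by
      have : Tendsto (fun u : ℝ => r ^ 2 * u ^ (2 - α)) (nhds 0) (nhds (r ^ 2 * 0 ^ (2 - α))) :=
        (Real.continuousAt_rpow_const 0 (2 - α) (Or.inr (by linarith))).tendsto.const_mul _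
      rw [Real.zero_rpow (by linarith), mul_zero] at this
      exact this.mono_left nhdsWithin_le_nhds
    refine squeeze_zero_norm' ?_ hz
    have hev : ∀ᶠ u : ℝ in nhdsWithin 0 (Ioi 0), |u * r| ≤ 1 := by
      have : Continuous (fun u : ℝ => |u * r|) := by fun_prop
      have h3 := this.tendsto 0
      simp only [zero_mul, abs_zero] at h3
      exact (h3.mono_left nhdsWithin_le_nhds).eventually (eventually_le_nhds one_pos)
    filter_upwards [hev, self_mem_nhdsWithin] with u hu1 hu
    have hu0 : (0:ℝ) < u := hu
    have hn : ‖Complex.I * ((u * r : ℝ):ℂ)‖ = |u * r| := by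
      rw [norm_mul, Complex.norm_I, one_mul, Complex.norm_real, Real.norm_eq_abs]
    have h3 := Complex.norm_exp_sub_one_sub_id_le (x := Complex.I * ((u * r : ℝ):ℂ)) (by rw [hn]; exact hu1)
    rw [norm_div, Complex.norm_real, Real.norm_of_nonneg (by positivity), div_le_iff₀ (by positivity)]
    refine h3.trans (le_of_eq ?_)
    rw [hn, sq_abs, mul_assoc, ← Real.rpow_add hu0]
    norm_num
    ring
  have h3 := (he.mul hlim).sub (he.mul hsm)
  rw [one_mul, mul_zero, sub_zero] at h3
  refine h3.congr (fun u => ?_)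
  rw [key u]
  ring

lemma norm_pow_sub_pow_le' (a b : ℂ) (ha : ‖a‖ ≤ 1) (hb : ‖b‖ ≤ 1) (k : ℕ) :
    ‖a ^ k - b ^ k‖ ≤ k * ‖a - b‖ := by
  induction k with
  | zero => simp
  | succ k ih =>
    have : a ^ (k+1) - b ^ (k+1) = a * (a ^ k - b ^ k) + (a - b) * b ^ k := by ring
    rw [this]
    calc _ ≤ ‖a‖ * ‖a ^ k - b ^ k‖ + ‖a - b‖ * ‖b‖ ^ k := by
          refine (norm_add_le _ _).trans ?_
          rw [norm_mul, norm_mul, norm_pow]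
      _ ≤ 1 * (k * ‖a - b‖) + ‖a - b‖ * 1 := by
          gcongr
          exact pow_le_one₀ (norm_nonneg _) hb
      _ = _ := by push_cast; ring

lemma pow_limit (ρ : ℕ → ℂ) (k : ℕ → ℕ) (L : ℂ) (hρ : ∀ n, ‖ρ n‖ ≤ 1)
    (hk : Tendsto k atTop atTop)
    (hL : Tendsto (fun n => (k n : ℂ) * (ρ n - 1)) atTop (nhds L)) :
    Tendsto (fun n => ρ n ^ k n) atTop (nhds (Complex.exp L)) := by
  have h1 : Tendsto (fun n => Complex.exp ((k n : ℂ) * (ρ n - 1))) atTop (nhds (Complex.exp L)) :=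
    (Complex.continuous_exp.tendsto L).comp hL
  have hkc : Tendsto (fun n => ((k n : ℂ))⁻¹) atTop (nhds 0) :=
    (tendsto_inv_atTop_nhds_zero_nat (𝕜 := ℂ)).comp hk
  have hk1 : ∀ᶠ n in atTop, 1 ≤ k n := hk.eventually (eventually_ge_atTop 1)
  have ha : Tendsto (fun n => ρ n - 1) atTop (nhds 0) := by
    have := hkc.mul hL
    rw [zero_mul] at this
    refine this.congr' ?_
    filter_upwards [hk1] with n hn
    have : (k n : ℂ) ≠ 0 := by exact_mod_cast (by omega : k n ≠ 0)
    field_simp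
  have hd : Tendsto (fun n => ρ n ^ k n - Complex.exp ((k n : ℂ) * (ρ n - 1))) atTop (nhds 0) := by
    have h3 : Tendsto (fun n => ‖(k n : ℂ) * (ρ n - 1)‖ * ‖ρ n - 1‖) atTop (nhds 0) := by
      have := hL.norm.mul ha.norm
      simpa using this
    refine squeeze_zero_norm' ?_ h3
    have hsmall : ∀ᶠ n in atTop, ‖ρ n - 1‖ ≤ 1 := by
      have := ha.norm
      rw [norm_zero] at this
      exact this.eventually (eventually_le_nhds one_pos)
    filter_upwards [hsmall] with n hn
    have e1 : ‖Complex.exp (ρ n - 1)‖ ≤ 1 := by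
      rw [Complex.norm_exp, Real.exp_le_one_iff, Complex.sub_re, Complex.one_re]
      have := (Complex.re_le_norm (ρ n)).trans (hρ n)
      linarith
    rw [Complex.exp_nat_mul]
    refine (norm_pow_sub_pow_le' _ _ (hρ n) e1 _).trans ?_
    have h4 := Complex.norm_exp_sub_one_sub_id_le hn
    have e2 : ‖ρ n - Complex.exp (ρ n - 1)‖ = ‖Complex.exp (ρ n - 1) - 1 - (ρ n - 1)‖ := by
      rw [norm_sub_rev]; congr 1; ring
    rw [e2, norm_mul, Complex.norm_natCast]
    calc _ ≤ (k n : ℝ) * ‖ρ n - 1‖ ^ 2 := by gcongr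
      _ = _ := by ring
  have := hd.add h1
  rw [zero_add] at this
  refine this.congr (fun n => by ring)

/-- a limit law of characteristic function type is `< 1` near zero -/
lemma re_exp_lt_one (w : ℂ) (hw : w ≠ 0) (hw2 : ‖w‖ < 6) (hn : ‖Complex.exp w‖ ≤ 1) :
    (Complex.exp w).re < 1 := by
  by_contra h
  push Not at h
  have hre := Complex.re_le_norm (Complex.exp w)
  have e1 : (Complex.exp w).re = 1 := le_antisymm (hre.trans hn) h
  have e2 : ‖Complex.exp w‖ = 1 := le_antisymm hn (h.trans hre)
  have e3 : (Complex.exp w).im = 0 := by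
    have := Complex.sq_norm (Complex.exp w)
    rw [e2, Complex.normSq_apply, e1] at this
    nlinarith
  have e4 : Complex.exp w = 1 := Complex.ext e1 e3
  obtain ⟨n, hn⟩ := Complex.exp_eq_one_iff.1 e4
  rcases eq_or_ne n 0 with rfl | hn0
  · simp at hn; exact hw hn
  · have : ‖w‖ = |(n:ℝ)| * (2 * Real.pi) := by
      rw [hn]; simp [abs_of_pos Real.pi_pos]
    have h1 : (1:ℝ) ≤ |(n:ℝ)| := by exact_mod_cast Int.one_le_abs hn0
    have := Real.pi_gt_three
    nlinarith

end stable
end LSVproof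

open MeasureTheory Set NNReal Filter

namespace LSVproof
set_option linter.unusedSectionVars false
set_option linter.unusedVariables false

lemma ind_le_one {Ω : Type*} (s : Set Ω) (x : Ω) : s.indicator (1 : Ω → ENNReal) x ≤ 1 := by
  classical
  rw [indicator_apply]; split_ifs <;> simp

section induced
variable {Ω : Type*} (T : Ω → Ω) (Y : Set Ω)

/-- first return/hitting time -/
noncomputable def ret (x : Ω) : ℕ := sInf {n | 1 ≤ n ∧ T^[n] x ∈ Y}

/-- induced map -/
noncomputable def ind (x : Ω) : Ω := T^[ret T Y x] x

variable {T Y}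

lemma ret_spec {x : Ω} (h : ∃ n, 1 ≤ n ∧ T^[n] x ∈ Y) :
    1 ≤ ret T Y x ∧ T^[ret T Y x] x ∈ Y := Nat.sInf_mem (s := {n | 1 ≤ n ∧ T^[n] x ∈ Y}) h

lemma not_mem_of_lt_ret {x : Ω} {j : ℕ} (h1 : 1 ≤ j) (h : j < ret T Y x) : T^[j] x ∉ Y := by
  intro hj
  exact absurd (Nat.sInf_le (s := {n | 1 ≤ n ∧ T^[n] x ∈ Y}) ⟨h1, hj⟩) (not_le.2 h)

lemma ret_eq {x : Ω} {k : ℕ} (h1 : 1 ≤ k) (h2 : T^[k] x ∈ Y) (h3 : ∀ j, 1 ≤ j → j < k → T^[j] x ∉ Y) :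
    ret T Y x = k := by
  have h4 : ret T Y x ≤ k := Nat.sInf_le (s := {n | 1 ≤ n ∧ T^[n] x ∈ Y}) ⟨h1, h2⟩
  obtain ⟨h5, h6⟩ := ret_spec (T := T) (Y := Y) ⟨k, h1, h2⟩
  by_contra hne
  exact h3 _ h5 (lt_of_le_of_ne h4 hne) h6

lemma lt_ret_iff {x : Ω} (h : ∃ n, 1 ≤ n ∧ T^[n] x ∈ Y) (n : ℕ) :
    n < ret T Y x ↔ ∀ j, 1 ≤ j → j ≤ n → T^[j] x ∉ Y := by
  constructor
  · intro h1 j hj hjn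
    exact not_mem_of_lt_ret hj (by omega)
  · intro h1
    by_contra hlt
    exact h1 _ (ret_spec h).1 (by omega) (ret_spec h).2

/-- along the excursion the hitting time decreases -/
lemma ret_iter {x : Ω} (h : ∃ n, 1 ≤ n ∧ T^[n] x ∈ Y) {j : ℕ} (hj : j < ret T Y x) :
    ret T Y (T^[j] x) = ret T Y x - j := by
  apply ret_eq
  · omega
  · rw [← Function.iterate_add_apply]
    have : ret T Y x - j + j = ret T Y x := by omega
    rw [this]; exact (ret_spec h).2
  · intro i hi hi2
    rw [← Function.iterate_add_apply]
    exact not_mem_of_lt_ret (by omega) (by omega)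

lemma ind_iter {x : Ω} (h : ∃ n, 1 ≤ n ∧ T^[n] x ∈ Y) {j : ℕ} (hj : j < ret T Y x) :
    ind T Y (T^[j] x) = ind T Y x := by
  rw [ind, ret_iter h hj, ← Function.iterate_add_apply]
  have : ret T Y x - j + j = ret T Y x := by omega
  rw [this]; rfl

variable [MeasurableSpace Ω] (hT : Measurable T) (hY : MeasurableSet Y)
include hT hY

lemma measurable_ret : Measurable (ret T Y) := by
  have hk : ∀ k, MeasurableSet {x | 1 ≤ k ∧ T^[k] x ∈ Y ∧ ∀ j, 1 ≤ j → j < k → T^[j] x ∉ Y} := by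
    intro k
    have e : {x | 1 ≤ k ∧ T^[k] x ∈ Y ∧ ∀ j, 1 ≤ j → j < k → T^[j] x ∉ Y} =
      {x | 1 ≤ k} ∩ (T^[k] ⁻¹' Y ∩ ⋂ j, {x | 1 ≤ j → j < k → T^[j] x ∉ Y}) := by
      ext x; simp
    rw [e]
    refine (MeasurableSet.const _).inter (((hT.iterate k) hY).inter (MeasurableSet.iInter fun j => ?_))
    have e2 : {x | 1 ≤ j → j < k → T^[j] x ∉ Y} = {x | ¬ (1 ≤ j)} ∪ ({x | ¬ (j < k)} ∪ (T^[j] ⁻¹' Y)ᶜ) := by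
      ext x; simp only [mem_ofPred_eq, mem_union, mem_compl_iff, mem_preimage]; tauto
    rw [e2]
    exact (MeasurableSet.const _).union ((MeasurableSet.const _).union ((hT.iterate j) hY).compl)
  have hpos : ∀ k, 1 ≤ k → MeasurableSet (ret T Y ⁻¹' {k}) := by
    intro k hk1
    convert hk k using 1
    ext x
    simp only [mem_preimage, mem_singleton_iff, mem_ofPred_eq]
    constructor
    · intro h
      have hne : {n | 1 ≤ n ∧ T^[n] x ∈ Y}.Nonempty := by
        by_contra hne
        rw [not_nonempty_iff_eq_empty] at hne
        rw [ret, hne, Nat.sInf_empty] at h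
        omega
      have := ret_spec (T := T) (Y := Y) (x := x) hne
      rw [h] at this
      exact ⟨hk1, this.2, fun j hj hjk => not_mem_of_lt_ret hj (by omega)⟩
    · rintro ⟨h1, h2, h3⟩
      exact ret_eq h1 h2 h3
  refine measurable_to_countable' fun k => ?_
  rcases Nat.eq_zero_or_pos k with rfl | hk0
  · have : ret T Y ⁻¹' {0} = (⋃ k : ℕ, ret T Y ⁻¹' {k + 1})ᶜ := by
      ext x
      simp only [mem_preimage, mem_singleton_iff, mem_compl_iff, mem_iUnion, not_exists]
      constructor
      · intro h k; omega
      · intro h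
        by_contra hne
        exact h (ret T Y x - 1) (by omega)
    rw [this]
    exact (MeasurableSet.iUnion fun k => hpos _ (by omega)).compl
  · exact hpos k hk0

lemma measurable_iter_ret (G : ℕ → Ω → Ω) (hG : ∀ n, Measurable (G n)) (N : Ω → ℕ) (hN : Measurable N) :
    Measurable (fun x => G (N x) x) := by
  exact (measurable_from_prod_countable_right hG : Measurable (fun p : ℕ × Ω => G p.1 p.2)).comp (hN.prodMk measurable_id)

lemma measurable_ind : Measurable (ind T Y) :=
  measurable_iter_ret hT hY (fun n => T^[n]) (fun n => hT.iterate n) _ (measurable_ret hT hY)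

lemma measurable_sum_ret {β : Type*} [AddCommMonoid β] [MeasurableSpace β] [MeasurableAdd₂ β] (G : Ω → β) (hG : Measurable G) :
    Measurable (fun x => ∑ j ∈ Finset.range (ret T Y x), G (T^[j] x)) := by
  have : ∀ n, Measurable (fun x => ∑ j ∈ Finset.range n, G (T^[j] x)) := fun n =>
    Finset.measurable_sum _ fun j _ => hG.comp (hT.iterate j)
  exact (measurable_from_prod_countable_right this : Measurable (fun p : ℕ × Ω => ∑ j ∈ Finset.range p.1, G (T^[j] p.2))).comp
    ((measurable_ret hT hY).prodMk measurable_id)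

variable {μ : Measure Ω} [IsProbabilityMeasure μ] (hmp : MeasurePreserving T μ μ)
  (hrec : ∀ᵐ x ∂μ, ∃ n, 1 ≤ n ∧ T^[n] x ∈ Y)

include hmp hrec
open scoped ENNReal

lemma kac_step (G : Ω → ℝ≥0∞) (hG : Measurable G) (n : ℕ) :
    ∫⁻ x, G x ∂μ = ∑ j ∈ Finset.range (n+1), ∫⁻ x in Y, (if j < ret T Y x then G (T^[j] x) else 0) ∂μ
      + ∫⁻ x in {x | ∀ i, i ≤ n → T^[i] x ∉ Y}, G (T^[n] x) ∂μ := by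
  have hEm : ∀ n, MeasurableSet {x | ∀ i, i ≤ n → T^[i] x ∉ Y} := by
    intro n
    have : {x | ∀ i, i ≤ n → T^[i] x ∉ Y} = ⋂ i, ⋂ (_ : i ≤ n), (T^[i] ⁻¹' Y)ᶜ := by
      ext x; simp
    rw [this]
    exact MeasurableSet.iInter fun i => MeasurableSet.iInter fun _ => ((hT.iterate i) hY).compl
  induction n with
  | zero =>
    have h1 : ∫⁻ x in Y, (if 0 < ret T Y x then G (T^[0] x) else 0) ∂μ = ∫⁻ x in Y, G x ∂μ := by
      refine lintegral_congr_ae ?_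
      filter_upwards [ae_restrict_of_ae hrec] with x hx
      have := (ret_spec hx).1
      rw [if_pos (by omega)]; rfl
    have h2 : {x | ∀ i, i ≤ 0 → T^[i] x ∉ Y} = Yᶜ := by
      ext x; simp
    simp only [zero_add, Finset.range_one, Finset.sum_singleton]
    rw [h1, h2]
    simp only [Function.iterate_zero, id_eq]
    rw [lintegral_add_compl _ hY]
  | succ n ih =>
    rw [ih, Finset.sum_range_succ _ (n+1), add_assoc]
    congr 1
    have hpre : T ⁻¹' {x | ∀ i, i ≤ n → T^[i] x ∉ Y} = {x | ∀ i, 1 ≤ i → i ≤ n+1 → T^[i] x ∉ Y} := by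
      ext x
      simp only [mem_preimage, mem_ofPred_eq]
      constructor
      · intro h i hi hin
        obtain ⟨k, rfl⟩ : ∃ k, i = k + 1 := ⟨i - 1, by omega⟩
        rw [Function.iterate_succ_apply]
        exact h k (by omega)
      · intro h i hi
        rw [← Function.iterate_succ_apply]
        exact h (i+1) (by omega) (by omega)
    have h1 : ∫⁻ x in {x | ∀ i, i ≤ n → T^[i] x ∉ Y}, G (T^[n] x) ∂μ =
        ∫⁻ x in {x | ∀ i, 1 ≤ i → i ≤ n+1 → T^[i] x ∉ Y}, G (T^[n+1] x) ∂μ := by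
      have := hmp.setLIntegral_comp_preimage (hEm n) (hG.comp (hT.iterate n))
      rw [hpre] at this
      exact this.symm
    rw [h1, ← lintegral_inter_add_sdiff _ _ hY]
    have hDm : MeasurableSet {x | ∀ i, 1 ≤ i → i ≤ n+1 → T^[i] x ∉ Y} := hpre ▸ hT (hEm n)
    congr 1
    · rw [← setLIntegral_indicator hDm]
      refine lintegral_congr_ae ?_
      filter_upwards [ae_restrict_of_ae hrec] with x hx
      have h3 := lt_ret_iff hx (n+1)
      by_cases h4 : n + 1 < ret T Y x
      · rw [if_pos h4, indicator_of_mem]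
        exact h3.1 h4
      · rw [if_neg h4, indicator_of_notMem]
        intro h5
        exact h4 (h3.2 h5)
    · congr 2
      ext x
      simp only [Set.mem_sdiff, mem_ofPred_eq]
      constructor
      · rintro ⟨h1, h2⟩ i hi
        rcases Nat.eq_zero_or_pos i with rfl | h0
        · exact h2
        · exact h1 i h0 hi
      · intro h
        exact ⟨fun i _ hi => h i hi, h 0 (by omega)⟩

lemma kac (G : Ω → ℝ≥0∞) (hG : Measurable G) (c : ℝ≥0∞) (hc : c ≠ ⊤) (hGc : ∀ x, G x ≤ c) :
    ∫⁻ x, G x ∂μ = ∫⁻ x in Y, ∑ j ∈ Finset.range (ret T Y x), G (T^[j] x) ∂μ := by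
  have hEm : ∀ n, MeasurableSet {x | ∀ i, i ≤ n → T^[i] x ∉ Y} := by
    intro n
    have : {x | ∀ i, i ≤ n → T^[i] x ∉ Y} = ⋂ i, ⋂ (_ : i ≤ n), (T^[i] ⁻¹' Y)ᶜ := by
      ext x; simp
    rw [this]
    exact MeasurableSet.iInter fun i => MeasurableSet.iInter fun _ => ((hT.iterate i) hY).compl
  have hE0 : Tendsto (fun n : ℕ => μ {x | ∀ i, i ≤ n → T^[i] x ∉ Y}) atTop (nhds 0) := by
    have h1 := tendsto_measure_iInter_atTop (μ := μ) (s := fun n : ℕ => {x | ∀ i, i ≤ n → T^[i] x ∉ Y})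
      (fun n => (hEm n).nullMeasurableSet) (fun a b hab x hx i hi => hx i (hi.trans hab)) ⟨0, measure_ne_top _ _⟩
    have h2 : μ (⋂ n : ℕ, {x | ∀ i, i ≤ n → T^[i] x ∉ Y}) = 0 := by
      refine measure_mono_null ?_ hrec
      intro x hx
      simp only [mem_iInter, mem_ofPred_eq] at hx
      simp only [mem_compl_iff, mem_ofPred_eq, not_exists, not_and]
      intro n _
      exact hx n n le_rfl
    rw [h2] at h1
    exact h1
  have hrest : Tendsto (fun n : ℕ => ∫⁻ x in {x | ∀ i, i ≤ n → T^[i] x ∉ Y}, G (T^[n] x) ∂μ) atTop (nhds 0) := by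
    have h3 : Tendsto (fun n : ℕ => c * μ {x | ∀ i, i ≤ n → T^[i] x ∉ Y}) atTop (nhds 0) := by
      have := ENNReal.Tendsto.const_mul (a := c) hE0 (Or.inr hc)
      rwa [mul_zero] at this
    refine tendsto_of_tendsto_of_tendsto_of_le_of_le tendsto_const_nhds h3 (fun _ => zero_le) (fun n => ?_)
    calc _ ≤ ∫⁻ x in {x | ∀ i, i ≤ n → T^[i] x ∉ Y}, c ∂μ := lintegral_mono fun x => hGc _
      _ = _ := by rw [setLIntegral_const]
  have hRm := measurable_ret hT hY
  have hsum : ∫⁻ x in Y, ∑ j ∈ Finset.range (ret T Y x), G (T^[j] x) ∂μ =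
      ∑' j : ℕ, ∫⁻ x in Y, (if j < ret T Y x then G (T^[j] x) else 0) ∂μ := by
    rw [← lintegral_tsum]
    · refine lintegral_congr fun x => ?_
      rw [tsum_eq_sum (s := Finset.range (ret T Y x))]
      · refine Finset.sum_congr rfl fun j hj => ?_
        rw [if_pos (Finset.mem_range.1 hj)]
      · intro j hj
        rw [if_neg (fun h => hj (Finset.mem_range.2 h))]
    · intro j
      refine (Measurable.ite ?_ (hG.comp (hT.iterate j)) measurable_const).aemeasurable
      exact measurableSet_lt measurable_const hRm
  rw [hsum]
  have h5 := ((ENNReal.summable (f := fun j : ℕ => ∫⁻ x in Y, (if j < ret T Y x then G (T^[j] x) else 0) ∂μ)).hasSum.tendsto_sum_nat.comp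
    (tendsto_add_atTop_nat 1)).add hrest
  rw [add_zero] at h5
  refine tendsto_nhds_unique (tendsto_const_nhds.congr fun n => ?_) h5
  exact kac_step hT hY hmp hrec G hG n

lemma lint_ret : ∫⁻ x in Y, (ret T Y x : ℝ≥0∞) ∂μ = 1 := by
  have := kac hT hY hmp hrec (fun _ => 1) measurable_const 1 (by simp) (fun _ => le_rfl)
  simp at this
  exact this.symm

lemma ind_mp : MeasurePreserving (ind T Y) (μ.restrict Y) (μ.restrict Y) := by
  refine ⟨measurable_ind hT hY, ?_⟩
  ext B hB
  rw [Measure.map_apply (measurable_ind hT hY) hB, Measure.restrict_apply hB]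
  have h := kac hT hY hmp hrec ((B ∩ Y).indicator 1 ∘ T)
    ((measurable_one.indicator (hB.inter hY)).comp hT) 1 (by simp) (fun x => ind_le_one _ _)
  have h1 : ∫⁻ x, ((B ∩ Y).indicator 1 ∘ T) x ∂μ = μ (B ∩ Y) := by
    have h2 := hmp.lintegral_comp (f := (B ∩ Y).indicator 1) (measurable_one.indicator (hB.inter hY))
    rw [lintegral_indicator_one (hB.inter hY)] at h2
    exact h2
  rw [← h1, h, ← lintegral_indicator_one ((measurable_ind hT hY) hB)]
  refine lintegral_congr_ae ?_
  filter_upwards [ae_restrict_of_ae hrec] with x hx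
  obtain ⟨h3, h4⟩ := ret_spec hx
  obtain ⟨k, hk⟩ : ∃ k, ret T Y x = k + 1 := ⟨ret T Y x - 1, by omega⟩
  rw [hk, Finset.sum_range_succ, Finset.sum_eq_zero, zero_add]
  · simp only [Function.comp]
    rw [← Function.iterate_succ_apply' T k x, Nat.succ_eq_add_one, ← hk]
    classical
    simp only [indicator_apply, mem_preimage, mem_inter_iff, ind, h4, and_true, Pi.one_apply]
  · intro j hj
    simp only [Function.comp]
    rw [← Function.iterate_succ_apply' T j x, indicator_of_notMem]
    intro h5
    have hj' := Finset.mem_range.1 hj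
    exact not_mem_of_lt_ret (T := T) (Y := Y) (x := x) (j := j + 1) (by omega) (by omega) h5.2

lemma map_ind (B : Set Ω) (hB : MeasurableSet B) :
    μ (ind T Y ⁻¹' B) = ∫⁻ x in Y, (ret T Y x : ℝ≥0∞) * B.indicator 1 (ind T Y x) ∂μ := by
  have hm := (measurable_ind hT hY) hB
  have h := kac hT hY hmp hrec ((ind T Y ⁻¹' B).indicator 1)
    (measurable_one.indicator hm) 1 (by simp) (fun x => ind_le_one _ _)
  rw [lintegral_indicator_one hm] at h
  rw [h]
  refine lintegral_congr_ae ?_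
  filter_upwards [ae_restrict_of_ae hrec] with x hx
  have : ∀ j ∈ Finset.range (ret T Y x), (ind T Y ⁻¹' B).indicator (1 : Ω → ℝ≥0∞) (T^[j] x) = B.indicator 1 (ind T Y x) := by
    intro j hj
    classical
    simp only [indicator_apply, mem_preimage, ind_iter hx (Finset.mem_range.1 hj), Pi.one_apply]
  rw [Finset.sum_congr rfl this]
  simp

lemma tail_ret (n : ℕ) : μ {x | n < ret T Y x} ≤ ∫⁻ x in Y, (if n < ret T Y x then (ret T Y x : ℝ≥0∞) else 0) ∂μ := by
  have hm : MeasurableSet {x | n < ret T Y x} := measurableSet_lt measurable_const (measurable_ret hT hY)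
  have h := kac hT hY hmp hrec ({x | n < ret T Y x}.indicator 1)
    (measurable_one.indicator hm) 1 (by simp) (fun x => ind_le_one _ _)
  rw [lintegral_indicator_one hm] at h
  rw [h]
  refine lintegral_mono_ae ?_
  filter_upwards [ae_restrict_of_ae hrec] with x hx
  by_cases hn : n < ret T Y x
  · rw [if_pos hn]
    calc _ ≤ ∑ j ∈ Finset.range (ret T Y x), (1 : ℝ≥0∞) := by
          exact Finset.sum_le_sum fun j _ => ind_le_one _ _
      _ = _ := by simp
  · rw [if_neg hn, Finset.sum_eq_zero]
    intro j hj
    rw [indicator_of_notMem]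
    intro h5
    have h5' : n < ret T Y (T^[j] x) := h5
    rw [ret_iter hx (Finset.mem_range.1 hj)] at h5'
    omega

lemma int_ret : Integrable (fun x => (ret T Y x : ℝ)) (μ.restrict Y) ∧ ∫ x in Y, (ret T Y x : ℝ) ∂μ = 1 := by
  have h := lint_ret hT hY hmp hrec
  have hm : Measurable (fun x => (ret T Y x : ℝ)) := (measurable_from_top (f := fun n : ℕ => (n : ℝ))).comp (measurable_ret hT hY)
  have e : ∫⁻ x in Y, ENNReal.ofReal (ret T Y x : ℝ) ∂μ = 1 := by
    simp_rw [ENNReal.ofReal_natCast]; exact h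
  constructor
  · refine ⟨hm.aestronglyMeasurable, ?_⟩
    rw [hasFiniteIntegral_iff_ofReal (ae_of_all _ fun x => by positivity), e]
    simp
  · rw [integral_eq_lintegral_of_nonneg_ae (ae_of_all _ fun x => by positivity) hm.aestronglyMeasurable, e]
    simp

lemma mean_V (φ : Ω → ℝ) (hφ : Measurable φ) (c : ℝ) (hc : ∀ x, |φ x| ≤ c) :
    ∫ x in Y, (∑ j ∈ Finset.range (ret T Y x), φ (T^[j] x)) ∂μ = ∫ x, φ x ∂μ := by
  have hc0 : 0 ≤ c := by
    have : Nonempty Ω := by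
      by_contra hne
      rw [not_nonempty_iff] at hne
      have := measure_univ (μ := μ)
      rw [univ_eq_empty_iff.2 hne, measure_empty] at this
      exact zero_ne_one this
    exact (abs_nonneg _).trans (hc (Classical.arbitrary Ω))
  have h := kac hT hY hmp hrec (fun x => ENNReal.ofReal (φ x + c)) (by fun_prop) (ENNReal.ofReal (2 * c))
    ENNReal.ofReal_ne_top (fun x => ENNReal.ofReal_le_ofReal (by have := abs_le.1 (hc x); linarith))
  have hp : ∀ x, 0 ≤ φ x + c := fun x => by have := abs_le.1 (hc x); linarith
  have h1 : ∀ x, ∑ j ∈ Finset.range (ret T Y x), ENNReal.ofReal (φ (T^[j] x) + c) =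
      ENNReal.ofReal (∑ j ∈ Finset.range (ret T Y x), (φ (T^[j] x) + c)) := fun x => by
    rw [ENNReal.ofReal_sum_of_nonneg fun j _ => hp _]
  simp_rw [h1] at h
  have hVm := measurable_sum_ret hT hY φ hφ
  obtain ⟨hRi, hR1⟩ := int_ret hT hY hmp hrec
  have hVi : Integrable (fun x => ∑ j ∈ Finset.range (ret T Y x), φ (T^[j] x)) (μ.restrict Y) := by
    refine (hRi.const_mul c).mono' hVm.aestronglyMeasurable (ae_of_all _ fun x => ?_)
    calc _ ≤ ∑ j ∈ Finset.range (ret T Y x), |φ (T^[j] x)| := Finset.abs_sum_le_sum_abs _ _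
      _ ≤ ∑ j ∈ Finset.range (ret T Y x), c := Finset.sum_le_sum fun j _ => hc _
      _ = _ := by simp [mul_comm]
  have hφi : Integrable φ μ := Integrable.of_bound hφ.aestronglyMeasurable c (ae_of_all _ hc)
  have h2 : ∀ x, ∑ j ∈ Finset.range (ret T Y x), (φ (T^[j] x) + c) =
     (∑ j ∈ Finset.range (ret T Y x), φ (T^[j] x)) + (ret T Y x : ℝ) * c := fun x => by
    rw [Finset.sum_add_distrib]; simp
  have h3 : ∫ x, (φ x + c) ∂μ = ∫ x in Y, ∑ j ∈ Finset.range (ret T Y x), (φ (T^[j] x) + c) ∂μ := by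
    rw [integral_eq_lintegral_of_nonneg_ae (ae_of_all _ hp) (by fun_prop), h,
      integral_eq_lintegral_of_nonneg_ae (ae_of_all _ fun x => Finset.sum_nonneg fun j _ => hp _)]
    simp_rw [h2]
    exact (hVi.aestronglyMeasurable.add (hRi.aestronglyMeasurable.mul_const c))
  simp_rw [h2] at h3
  rw [integral_add hφi (integrable_const _), integral_add hVi (hRi.mul_const c), integral_mul_const, hR1] at h3
  simp at h3
  linarith

end induced
end LSVproof

open MeasureTheory Set NNReal Filter

namespace LSVproof
set_option linter.unusedSectionVars false
set_option linter.unusedVariables false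

section cone
open scoped ENNReal

/-- measures on `(l,1)` with density `g` antitone and `x^κ g` monotone -/
def Cone (l κ : ℝ) (ν : Measure ℝ) : Prop :=
  ∃ g : ℝ → ℝ≥0∞, Measurable g ∧ ν = (volume.restrict (Ioo l 1)).withDensity g ∧ AntitoneOn g (Ioo l 1) ∧
    ∀ x ∈ Ioo l 1, ∀ y ∈ Ioo l 1, x ≤ y → ENNReal.ofReal (x ^ κ) * g x ≤ ENNReal.ofReal (y ^ κ) * g y

lemma measurable_of_antitoneOn (l : ℝ) (g : ℝ → ℝ≥0∞) (hg : AntitoneOn g (Ioo l 1)) :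
    Measurable ((Ioo l 1).indicator g) := by
  refine measurable_of_restrict_of_restrict_compl (s := Ioo l 1) measurableSet_Ioo ?_ ?_
  · have e : (Ioo l 1).domRestrict ((Ioo l 1).indicator g) = (Ioo l 1).domRestrict g := by
      ext x; simp [domRestrict_apply, indicator_of_mem x.2]
    rw [e]
    have : Antitone ((Ioo l 1).domRestrict g) := fun x y hxy => hg x.2 y.2 hxy
    exact this.measurable
  · have e : (Ioo l 1)ᶜ.domRestrict ((Ioo l 1).indicator g) = fun _ => 0 := by
      ext x; rw [domRestrict_apply, indicator_of_notMem x.2]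
    rw [e]; exact measurable_const

lemma cone_mk (l κ : ℝ) (g : ℝ → ℝ≥0∞) (hg : AntitoneOn g (Ioo l 1))
    (hw : ∀ x ∈ Ioo l 1, ∀ y ∈ Ioo l 1, x ≤ y → ENNReal.ofReal (x ^ κ) * g x ≤ ENNReal.ofReal (y ^ κ) * g y) :
    Cone l κ ((volume.restrict (Ioo l 1)).withDensity g) := by
  refine ⟨(Ioo l 1).indicator g, measurable_of_antitoneOn l g hg, ?_, ?_, ?_⟩
  · refine withDensity_congr_ae ((ae_restrict_mem measurableSet_Ioo).mono fun x hx => ?_)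
    rw [indicator_of_mem hx]
  · intro x hx y hy hxy
    rw [indicator_of_mem hx, indicator_of_mem hy]; exact hg hx hy hxy
  · intro x hx y hy hxy
    rw [indicator_of_mem hx, indicator_of_mem hy]; exact hw x hx y hy hxy

lemma cone_zero (l κ : ℝ) : Cone l κ 0 :=
  ⟨0, measurable_zero, by simp, fun _ _ _ _ _ => le_rfl, fun _ _ _ _ _ => by simp⟩

lemma cone_smul {l κ : ℝ} {ν : Measure ℝ} (h : Cone l κ ν) (c : ℝ≥0∞) : Cone l κ (c • ν) := by
  obtain ⟨g, hm, rfl, ha, hw⟩ := h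
  refine ⟨c • g, hm.const_smul c, by rw [withDensity_smul c hm], ?_, ?_⟩
  · intro x hx y hy hxy
    simp only [Pi.smul_apply, smul_eq_mul]
    exact mul_le_mul' le_rfl (ha hx hy hxy)
  · intro x hx y hy hxy
    simp only [Pi.smul_apply, smul_eq_mul]
    rw [mul_left_comm, mul_left_comm _ c]
    exact mul_le_mul' le_rfl (hw x hx y hy hxy)

lemma cone_sum {l κ : ℝ} {ν : ℕ → Measure ℝ} (h : ∀ i, Cone l κ (ν i)) : Cone l κ (Measure.sum ν) := by
  choose g hm hν ha hw using h
  refine ⟨fun x => ∑' i, g i x, Measurable.tsum hm, ?_, ?_, ?_⟩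
  · have : (fun x => ∑' i, g i x) = ∑' i, g i := by
      ext x; rw [tsum_apply (Pi.summable.2 fun _ => ENNReal.summable)]
    rw [this, withDensity_tsum hm]
    congr 1; ext1 i; exact hν i
  · intro x hx y hy hxy
    exact ENNReal.tsum_le_tsum fun i => ha i hx hy hxy
  · intro x hx y hy hxy
    simp only
    rw [← ENNReal.tsum_mul_left, ← ENNReal.tsum_mul_left]
    exact ENNReal.tsum_le_tsum fun i => hw i x hx y hy hxy

lemma cone_mono {l κ κ' : ℝ} {ν : Measure ℝ} (hl : 0 ≤ l) (h : Cone l κ ν) (hκ : κ ≤ κ') : Cone l κ' ν := by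
  obtain ⟨g, hm, rfl, ha, hw⟩ := h
  refine ⟨g, hm, rfl, ha, ?_⟩
  intro x hx y hy hxy
  have hx0 : 0 < x := hl.trans_lt hx.1
  have hy0 : 0 < y := hl.trans_lt hy.1
  have e : ∀ x : ℝ, 0 < x → ENNReal.ofReal (x ^ κ') = ENNReal.ofReal (x ^ (κ' - κ)) * ENNReal.ofReal (x ^ κ) := by
    intro x hx
    rw [← ENNReal.ofReal_mul (by positivity), ← Real.rpow_add hx]; congr 2; ring
  rw [e x hx0, e y hy0, mul_assoc, mul_assoc]
  refine mul_le_mul' (ENNReal.ofReal_le_ofReal ?_) (hw x hx y hy hxy)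
  exact Real.rpow_le_rpow hx0.le hxy (by linarith)

lemma cone_restrict {κ : ℝ} {ν : Measure ℝ} (h : Cone 0 κ ν) : Cone (1/2) κ (ν.restrict (Ici (1/2))) := by
  obtain ⟨g, hm, rfl, ha, hw⟩ := h
  have hsub : Ioo (1/2:ℝ) 1 ⊆ Ioo 0 1 := Ioo_subset_Ioo_left (by norm_num)
  refine ⟨g, hm, ?_, ha.mono hsub, fun x hx y hy => hw x (hsub hx) y (hsub hy)⟩
  rw [restrict_withDensity measurableSet_Ici, Measure.restrict_restrict measurableSet_Ici]
  congr 1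
  refine Measure.restrict_congr_set ?_
  have : (Ici (1/2) ∩ Ioo 0 1 : Set ℝ) = Ico (1/2) 1 := by
    ext x; simp only [mem_inter_iff, mem_Ici, mem_Ioo, mem_Ico]
    constructor
    · rintro ⟨a, b, c⟩; exact ⟨a, c⟩
    · rintro ⟨a, c⟩; exact ⟨a, by linarith, c⟩
  rw [this]
  exact Ioo_ae_eq_Ico.symm

lemma push_branch {a b : ℝ} (ha : 0 ≤ a) (φ d T : ℝ → ℝ) (g : ℝ → ℝ≥0∞) (κ κ' : ℝ)
    (hder : ∀ x ∈ Ioo a b, HasDerivAt φ (d x) x) (hd : ∀ x ∈ Ioo a b, 0 < d x)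
    (hdm : MonotoneOn d (Ioo a b)) (hmono : StrictMonoOn φ (Ioo a b)) (himg : φ '' Ioo a b = Ioo 0 1)
    (hT : Measurable T) (hTφ : ∀ x ∈ Ioo a b, T x = φ x)
    (hga : AntitoneOn g (Ioo a b))
    (hgw : ∀ x ∈ Ioo a b, ∀ y ∈ Ioo a b, x ≤ y → ENNReal.ofReal (x ^ κ) * g x ≤ ENNReal.ofReal (y ^ κ) * g y)
    (hw : MonotoneOn (fun x => φ x ^ κ' / (x ^ κ * d x)) (Ioo a b)) :
    Cone 0 κ' (((volume.restrict (Ioo a b)).withDensity g).map T) := by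
  set u := Function.invFunOn φ (Ioo a b) with hu
  have hu1 : ∀ y ∈ Ioo (0:ℝ) 1, u y ∈ Ioo a b ∧ φ (u y) = y := fun y hy => by
    rw [← himg] at hy
    exact ⟨Function.invFunOn_mem hy, Function.invFunOn_eq hy⟩
  have hu2 : ∀ x ∈ Ioo a b, u (φ x) = x := fun x hx => hmono.injOn.leftInvOn_invFunOn hx
  have hum : ∀ x ∈ Ioo (0:ℝ) 1, ∀ y ∈ Ioo (0:ℝ) 1, x ≤ y → u x ≤ u y := fun x hx y hy hxy => by
    by_contra hlt
    push Not at hlt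
    have := hmono (hu1 y hy).1 (hu1 x hx).1 hlt
    rw [(hu1 y hy).2, (hu1 x hx).2] at this
    linarith
  set q : ℝ → ℝ≥0∞ := fun y => g (u y) / ENNReal.ofReal (d (u y)) with hq
  have hmap : ((volume.restrict (Ioo a b)).withDensity g).map T = (volume.restrict (Ioo 0 1)).withDensity q := by
    ext B hB
    rw [Measure.map_apply hT hB, withDensity_apply _ (hT hB), withDensity_apply _ hB,
      Measure.restrict_restrict (hT hB), Measure.restrict_restrict hB]
    have hS : MeasurableSet (T ⁻¹' B ∩ Ioo a b) := (hT hB).inter measurableSet_Ioo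
    have himS : φ '' (T ⁻¹' B ∩ Ioo a b) = B ∩ Ioo 0 1 := by
      ext y; constructor
      · rintro ⟨x, ⟨hx1, hx2⟩, rfl⟩
        refine ⟨?_, himg ▸ mem_image_of_mem φ hx2⟩
        rw [← hTφ x hx2]; exact hx1
      · rintro ⟨hy1, hy2⟩
        refine ⟨u y, ⟨?_, (hu1 y hy2).1⟩, (hu1 y hy2).2⟩
        rw [mem_preimage, hTφ _ (hu1 y hy2).1, (hu1 y hy2).2]; exact hy1
    rw [← himS, lintegral_image_eq_lintegral_abs_deriv_mul hS
      (fun x hx => (hder x hx.2).hasDerivWithinAt) (hmono.injOn.mono inter_subset_right)]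
    refine setLIntegral_congr_fun hS (fun x hx => ?_)
    simp only [hq]
    rw [hu2 x hx.2, abs_of_pos (hd x hx.2), ENNReal.mul_div_cancel]
    · simp [hd x hx.2]
    · exact ENNReal.ofReal_ne_top
  rw [hmap]
  refine cone_mk _ _ _ ?_ ?_
  · intro x hx y hy hxy
    have h1 := hum x hx y hy hxy
    simp only [hq]
    exact ENNReal.div_le_div (hga (hu1 x hx).1 (hu1 y hy).1 h1)
      (ENNReal.ofReal_le_ofReal (hdm (hu1 x hx).1 (hu1 y hy).1 h1))
  · intro x hx y hy hxy
    have h1 := hum x hx y hy hxy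
    have e : ∀ x ∈ Ioo (0:ℝ) 1, ENNReal.ofReal (x ^ κ') * q x =
        ENNReal.ofReal (φ (u x) ^ κ' / ((u x) ^ κ * d (u x))) * (ENNReal.ofReal ((u x) ^ κ) * g (u x)) := by
      intro x hx
      obtain ⟨hx1, hx2⟩ := hu1 x hx
      have hux : 0 < u x := ha.trans_lt hx1.1
      have hdx := hd _ hx1
      have hκ := Real.rpow_pos_of_pos hux κ
      rw [← mul_assoc, ← ENNReal.ofReal_mul (by have := hx.1; rw [hx2]; positivity), hx2]
      have : x ^ κ' / ((u x) ^ κ * d (u x)) * (u x) ^ κ = x ^ κ' / d (u x) := by field_simp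
      rw [this, ENNReal.ofReal_div_of_pos hdx]
      simp only [hq, div_eq_mul_inv]
      ring
    rw [e x hx, e y hy]
    exact mul_le_mul' (ENNReal.ofReal_le_ofReal (hw (hu1 x hx).1 (hu1 y hy).1 h1))
      (hgw _ (hu1 x hx).1 _ (hu1 y hy).1 h1)

/-! oscillation -/
lemma cone_osc {κ : ℝ} (hκ : 0 ≤ κ) (g : ℝ → ℝ≥0∞) (ha : AntitoneOn g (Ioo (1/2) 1))
    (hw : ∀ x ∈ Ioo (1/2:ℝ) 1, ∀ y ∈ Ioo (1/2:ℝ) 1, x ≤ y → ENNReal.ofReal (x ^ κ) * g x ≤ ENNReal.ofReal (y ^ κ) * g y)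
    (x y : ℝ) (hx : x ∈ Ioo (1/2:ℝ) 1) (hy : y ∈ Ioo (1/2:ℝ) 1) : g x ≤ ENNReal.ofReal (2 ^ κ) * g y := by
  have h1 : (1:ℝ) ≤ 2 ^ κ := Real.one_le_rpow (by norm_num) hκ
  have h1' : (1:ℝ≥0∞) ≤ ENNReal.ofReal (2 ^ κ) := by rw [ENNReal.one_le_ofReal]; exact h1
  rcases le_total x y with h | h
  · have h2 := hw x hx y hy h
    have hx0 : 0 < x := by linarith [hx.1]
    have hy0 : 0 < y := by linarith [hy.1]
    have h3 : ENNReal.ofReal ((1/2) ^ κ) * g x ≤ 1 * g y := by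
      calc _ ≤ ENNReal.ofReal (x ^ κ) * g x := by
            refine mul_le_mul' (ENNReal.ofReal_le_ofReal ?_) le_rfl
            exact Real.rpow_le_rpow (by norm_num) hx.1.le hκ
        _ ≤ ENNReal.ofReal (y ^ κ) * g y := h2
        _ ≤ 1 * g y := by
            refine mul_le_mul' ?_ le_rfl
            rw [ENNReal.ofReal_le_one]
            exact Real.rpow_le_one hy0.le hy.2.le hκ
    calc g x = ENNReal.ofReal (2 ^ κ) * (ENNReal.ofReal ((1/2) ^ κ) * g x) := by
          rw [← mul_assoc, ← ENNReal.ofReal_mul (by positivity), ← Real.mul_rpow (by norm_num) (by norm_num)]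
          norm_num
      _ ≤ _ := by rw [one_mul] at h3; exact mul_le_mul' le_rfl h3
  · calc g x ≤ g y := ha hy hx h
      _ = 1 * g y := (one_mul _).symm
      _ ≤ _ := mul_le_mul' h1' le_rfl

lemma vol_half : volume (Ioo (1/2:ℝ) 1) = ENNReal.ofReal (1/2) := by
  rw [Real.volume_Ioo]; norm_num

lemma cone_bounds {κ : ℝ} (hκ : 0 ≤ κ) (g : ℝ → ℝ≥0∞) (ha : AntitoneOn g (Ioo (1/2) 1))
    (hw : ∀ x ∈ Ioo (1/2:ℝ) 1, ∀ y ∈ Ioo (1/2:ℝ) 1, x ≤ y → ENNReal.ofReal (x ^ κ) * g x ≤ ENNReal.ofReal (y ^ κ) * g y)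
    (M : ℝ≥0∞) (hM : M = (volume.restrict (Ioo (1/2:ℝ) 1)).withDensity g univ)
    (x : ℝ) (hx : x ∈ Ioo (1/2:ℝ) 1) :
    g x ≤ ENNReal.ofReal (2 ^ (κ + 1)) * M ∧ ENNReal.ofReal (2 ^ (1 - κ)) * M ≤ g x := by
  rw [withDensity_apply _ MeasurableSet.univ, Measure.restrict_univ] at hM
  have hosc := cone_osc hκ g ha hw
  constructor
  · have h1 : ∫⁻ y in Ioo (1/2:ℝ) 1, g x ≤ ∫⁻ y in Ioo (1/2:ℝ) 1, ENNReal.ofReal (2 ^ κ) * g y :=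
      setLIntegral_mono' measurableSet_Ioo fun y hy => hosc x y hx hy
    rw [setLIntegral_const, lintegral_const_mul' _ _ ENNReal.ofReal_ne_top, ← hM, vol_half] at h1
    calc g x = ENNReal.ofReal 2 * (g x * ENNReal.ofReal (1/2)) := by
          rw [mul_left_comm, ← ENNReal.ofReal_mul (by norm_num)]; norm_num
      _ ≤ ENNReal.ofReal 2 * (ENNReal.ofReal (2 ^ κ) * M) := mul_le_mul' le_rfl h1
      _ = _ := by
        rw [← mul_assoc, ← ENNReal.ofReal_mul (by norm_num), Real.rpow_add (by norm_num), Real.rpow_one, mul_comm (2:ℝ)]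
  · have h1 : ∫⁻ y in Ioo (1/2:ℝ) 1, g y ≤ ∫⁻ y in Ioo (1/2:ℝ) 1, ENNReal.ofReal (2 ^ κ) * g x :=
      setLIntegral_mono' measurableSet_Ioo fun y hy => hosc y x hy hx
    rw [setLIntegral_const, ← hM, vol_half] at h1
    calc ENNReal.ofReal (2 ^ (1 - κ)) * M ≤ ENNReal.ofReal (2 ^ (1 - κ)) * (ENNReal.ofReal (2 ^ κ) * g x * ENNReal.ofReal (1/2)) :=
          mul_le_mul' le_rfl h1
      _ = (ENNReal.ofReal (2 ^ (1 - κ)) * ENNReal.ofReal (2 ^ κ) * ENNReal.ofReal (1/2)) * g x := by ring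
      _ = g x := by
        rw [← ENNReal.ofReal_mul (by positivity), ← ENNReal.ofReal_mul (by positivity), ← Real.rpow_add (by norm_num)]
        norm_num

/-- minorization -/
lemma cone_split {κ : ℝ} (hκ : 0 ≤ κ) {ν : Measure ℝ} (h : Cone (1/2) κ ν) (M : ℝ≥0) (hM : ν univ = M) :
    ∃ ν', Cone (1/2) (2 * κ) ν' ∧
      ν = ν' + ENNReal.ofReal (2 ^ (-2 * κ) * M) • volume.restrict (Ioo (1/2) 1) := by
  obtain ⟨g, hm, rfl, ha, hw⟩ := h
  have hb := cone_bounds hκ g ha hw M hM.symm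
  set c : ℝ := 2 ^ (-2 * κ) * M with hc
  have hc0 : 0 ≤ c := by positivity
  have hfin : ∀ x ∈ Ioo (1/2:ℝ) 1, g x ≠ ⊤ := fun x hx => by
    refine ne_top_of_le_ne_top ?_ (hb x hx).1
    exact ENNReal.mul_ne_top ENNReal.ofReal_ne_top ENNReal.coe_ne_top
  have hglow : ∀ x ∈ Ioo (1/2:ℝ) 1, 2 ^ (1 - κ) * M ≤ (g x).toReal := fun x hx => by
    have h1 := ENNReal.toReal_mono (hfin x hx) (hb x hx).2
    rw [ENNReal.toReal_mul, ENNReal.toReal_ofReal (by positivity)] at h1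
    exact h1
  have hgc : ∀ x ∈ Ioo (1/2:ℝ) 1, ENNReal.ofReal c ≤ g x := fun x hx => by
    rw [← ENNReal.ofReal_toReal (hfin x hx)]
    refine ENNReal.ofReal_le_ofReal (le_trans ?_ (hglow x hx))
    rw [hc]; gcongr
    · norm_num
    · linarith
  refine ⟨(volume.restrict (Ioo (1/2) 1)).withDensity (fun x => g x - ENNReal.ofReal c), ?_, ?_⟩
  · refine cone_mk _ _ _ (fun x hx y hy hxy => tsub_le_tsub_right (ha hx hy hxy) _) ?_
    intro x hx y hy hxy
    have hx0 : 0 < x := by linarith [hx.1]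
    have hy0 : 0 < y := by linarith [hy.1]
    have h1 := hw x hx y hy hxy
    have e : ∀ x ∈ Ioo (1/2:ℝ) 1, g x - ENNReal.ofReal c = ENNReal.ofReal ((g x).toReal - c) := fun x hx => by
      rw [ENNReal.ofReal_sub _ hc0, ENNReal.ofReal_toReal (hfin x hx)]
    rw [e x hx, e y hy, ← ENNReal.ofReal_mul (by positivity), ← ENNReal.ofReal_mul (by positivity)]
    refine ENNReal.ofReal_le_ofReal ?_
    rw [← ENNReal.ofReal_toReal (hfin x hx), ← ENNReal.ofReal_toReal (hfin y hy),
      ← ENNReal.ofReal_mul (by positivity), ← ENNReal.ofReal_mul (by positivity),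
      ENNReal.ofReal_le_ofReal_iff (by positivity)] at h1
    have hx2 : x ^ (2 * κ) = x ^ κ * x ^ κ := by rw [two_mul, Real.rpow_add hx0]
    have hy2 : y ^ (2 * κ) = y ^ κ * y ^ κ := by rw [two_mul, Real.rpow_add hy0]
    rw [hx2, hy2]
    have hxy' : x ^ κ ≤ y ^ κ := Real.rpow_le_rpow hx0.le hxy hκ
    have hxl : (1/2) ^ κ ≤ x ^ κ := Real.rpow_le_rpow (by norm_num) hx.1.le hκ
    have hy1 : y ^ κ ≤ 1 := Real.rpow_le_one hy0.le hy.2.le hκ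
    have hu : 2 * c ≤ x ^ κ * (g x).toReal := by
      calc 2 * c = (1/2) ^ κ * (2 ^ (1 - κ) * M) := by
            rw [hc, one_div, Real.inv_rpow (by norm_num), ← Real.rpow_neg (by norm_num), ← mul_assoc, ← mul_assoc,
              ← Real.rpow_add (by norm_num)]
            congr 1
            have : (2:ℝ) * 2 ^ (-2 * κ) = 2 ^ (1:ℝ) * 2 ^ (-2 * κ) := by rw [Real.rpow_one]
            rw [this, ← Real.rpow_add (by norm_num)]; congr 1; ring
        _ ≤ _ := by
            have := hglow x hx
            gcongr
    set X := x ^ κ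
    set Y := y ^ κ
    set G := (g x).toReal
    set H := (g y).toReal
    have hX0 : 0 < X := Real.rpow_pos_of_pos hx0 κ
    have hY0 : 0 < Y := Real.rpow_pos_of_pos hy0 κ
    nlinarith [mul_nonneg (sub_nonneg.2 hxy') (by nlinarith : 0 ≤ X * G - c * (X + Y)),
      mul_le_mul_of_nonneg_left h1 hY0.le]
  · rw [← withDensity_const, ← withDensity_add_left (hm.sub_const _)]
    refine withDensity_congr_ae ((ae_restrict_mem measurableSet_Ioo).mono fun x hx => ?_)
    simp only [Pi.add_apply]
    rw [tsub_add_cancel_of_le (hgc x hx)]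

lemma cone_le {κ : ℝ} (hκ : 0 ≤ κ) {ν : Measure ℝ} (h : Cone (1/2) κ ν) :
    ν ≤ (ENNReal.ofReal (2 ^ (κ + 1)) * ν univ) • volume.restrict (Ioo (1/2) 1) := by
  obtain ⟨g, hm, rfl, ha, hw⟩ := h
  rw [← withDensity_const]
  refine withDensity_mono ((ae_restrict_mem measurableSet_Ioo).mono fun x hx => ?_)
  exact (cone_bounds hκ g ha hw _ rfl x hx).1

lemma cone_ge {κ : ℝ} (hκ : 0 ≤ κ) {ν : Measure ℝ} (h : Cone (1/2) κ ν) :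
    (ENNReal.ofReal (2 ^ (1 - κ)) * ν univ) • volume.restrict (Ioo (1/2) 1) ≤ ν := by
  obtain ⟨g, hm, rfl, ha, hw⟩ := h
  rw [← withDensity_const]
  refine withDensity_mono ((ae_restrict_mem measurableSet_Ioo).mono fun x hx => ?_)
  exact (cone_bounds hκ g ha hw _ rfl x hx).2

end cone
end LSVproof

open MeasureTheory Set NNReal Filter
namespace LSVproof
set_option linter.unusedSectionVars false
set_option linter.unusedVariables false
open scoped ENNReal

/-- left branch -/
noncomputable def gl (z y : ℝ) : ℝ := y * (1 + 2 ^ z * y ^ z)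

lemma lsv_left {z y : ℝ} (h : y < 1/2) : lsv z y = gl z y := by simp only [lsv, if_pos h, gl]
lemma lsv_right {z y : ℝ} (h : 1/2 ≤ y) : lsv z y = 2 * y - 1 := by simp only [lsv, if_neg (not_lt.2 h)]

lemma measurable_lsv (z : ℝ) : Measurable (lsv z) := by
  unfold lsv
  refine Measurable.ite measurableSet_Iio ?_ ?_ <;> fun_prop

section
variable {z : ℝ} (hz : z ∈ Ioo (0:ℝ) 1)
include hz

lemma gl_strictMono : StrictMonoOn (gl z) (Ici 0) := by
  intro x hx y hy hxy
  unfold gl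
  have hx : 0 ≤ x := hx
  have h1 : x ^ z ≤ y ^ z := Real.rpow_le_rpow hx hxy.le hz.1.le
  have h2 : (0:ℝ) < 2 ^ z := by positivity
  have h3 : 0 ≤ x ^ z := by positivity
  have : 2 ^ z * x ^ z ≤ 2 ^ z * y ^ z := by gcongr
  have h4 : 0 ≤ 2 ^ z * x ^ z := by positivity
  nlinarith

lemma gl_cont : Continuous (gl z) := by
  unfold gl
  have : Continuous fun y : ℝ => y ^ z := Real.continuous_rpow_const hz.1.le
  fun_prop

lemma gl_zero : gl z 0 = 0 := by simp [gl]
lemma gl_half : gl z (1/2) = 1 := by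
  unfold gl
  rw [← Real.mul_rpow (by norm_num) (by norm_num)]; norm_num

lemma gl_ge {x : ℝ} (hx : 0 ≤ x) : x ≤ gl z x := by
  unfold gl
  have : 0 ≤ 2 ^ z * x ^ z := by positivity
  nlinarith

lemma gl_der {x : ℝ} (hx : 0 < x) : HasDerivAt (gl z) (1 + (1+z) * (2 ^ z * x ^ z)) x := by
  unfold gl
  have h1 := Real.hasDerivAt_rpow_const (x := x) (p := z) (Or.inl hx.ne')
  have h2 := (hasDerivAt_id x).mul ((h1.const_mul (2^z)).const_add 1)
  refine h2.congr_deriv ?_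
  rw [Real.rpow_sub_one hx.ne']
  simp only [id]
  field_simp
  ring

lemma gl_image : gl z '' Ioo 0 (1/2) = Ioo 0 1 := by
  apply subset_antisymm
  · rintro _ ⟨x, hx, rfl⟩
    refine ⟨hx.1.trans_le (gl_ge hz hx.1.le), ?_⟩
    rw [← gl_half hz]
    exact gl_strictMono hz hx.1.le (by norm_num : (0:ℝ) ≤ 1/2) hx.2
  · have := intermediate_value_Ioo (f := gl z) (by norm_num : (0:ℝ) ≤ 1/2) (gl_cont hz).continuousOn
    rwa [gl_zero hz, gl_half hz] at this

lemma lsv_mem {x : ℝ} (hx : x ∈ Icc (0:ℝ) 1) : lsv z x ∈ Icc (0:ℝ) 1 := by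
  rcases lt_or_ge x (1/2) with h | h
  · rw [lsv_left h]
    refine ⟨hx.1.trans (gl_ge hz hx.1), ?_⟩
    rw [← gl_half hz]
    exact (gl_strictMono hz hx.1 (by norm_num : (0:ℝ) ≤ 1/2) h).le
  · rw [lsv_right h]
    constructor <;> linarith [hx.2]

lemma lsv_iter_mem {x : ℝ} (hx : x ∈ Icc (0:ℝ) 1) (n : ℕ) : (lsv z)^[n] x ∈ Icc (0:ℝ) 1 := by
  induction n with
  | zero => exact hx
  | succ n ih => rw [Function.iterate_succ_apply']; exact lsv_mem hz ih

lemma push1 {ν : Measure ℝ} (h : Cone 0 (1+z) ν) : Cone 0 (1+z) ((ν.restrict (Iio (1/2))).map (lsv z)) := by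
  obtain ⟨g, hg, rfl, ha, hw⟩ := h
  rw [restrict_withDensity measurableSet_Iio, Measure.restrict_restrict measurableSet_Iio]
  have e : Iio (1/2:ℝ) ∩ Ioo 0 1 = Ioo 0 (1/2) := by
    ext x; simp only [mem_inter_iff, mem_Iio, mem_Ioo]; constructor
    · rintro ⟨a, b, c⟩; exact ⟨b, a⟩
    · rintro ⟨a, b⟩; exact ⟨b, a, by linarith⟩
  rw [e]
  have hs : Ioo (0:ℝ) (1/2) ⊆ Ioo 0 1 := Ioo_subset_Ioo_right (by norm_num)
  have hz0 := hz.1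
  have hmr : ∀ x ∈ Ioo (0:ℝ) (1/2), ∀ y ∈ Ioo (0:ℝ) (1/2), x ≤ y → 2^z * x ^ z ≤ 2^z * y^z := fun x hx y hy hxy => by
    have := Real.rpow_le_rpow hx.1.le hxy hz0.le
    gcongr
  refine push_branch le_rfl (gl z) (fun x => 1 + (1+z) * (2 ^ z * x ^ z)) (lsv z) g (1+z) (1+z)
    (fun x hx => gl_der hz hx.1) (fun x hx => ?_) ?_ ?_ (gl_image hz) (measurable_lsv z)
    (fun x hx => lsv_left hx.2) (ha.mono hs) (fun x hx y hy => hw x (hs hx) y (hs hy)) ?_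
  · have := hx.1; positivity
  · intro x hx y hy hxy
    have := hmr x hx y hy hxy
    have h2 : 0 < 1 + z := by linarith
    simp only
    gcongr
  · exact (gl_strictMono hz).mono fun x hx => hx.1.le
  · have key : ∀ x ∈ Ioo (0:ℝ) (1/2), gl z x ^ (1+z) / (x ^ (1+z) * (1 + (1+z) * (2 ^ z * x ^ z)))
        = (1 + 2^z*x^z)^(1+z) / (1 + (1+z) * (2 ^ z * x ^ z)) := fun x hx => by
      have := hx.1
      unfold gl
      rw [Real.mul_rpow hx.1.le (by positivity), mul_div_mul_left _ _ (by positivity)]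
    intro x hx y hy hxy
    simp only [key x hx, key y hy]
    have := hx.1
    have := hy.1
    have hxy' := hmr x hx y hy hxy
    set a := 2^z*x^z with haa
    set b := 2^z*y^z with hbb
    have ha0 : 0 < a := by positivity
    have hb0 : 0 < b := by positivity
    rw [div_le_div_iff₀ (by positivity) (by positivity)]
    have e1 : 1 + b = (1 + a) * (1 + (b-a)/(1+a)) := by field_simp; ring
    have hba : 0 ≤ (b-a)/(1+a) := div_nonneg (by linarith) (by positivity)
    have hB := one_add_mul_self_le_rpow_one_add (s := (b-a)/(1+a)) (by linarith) (p := 1+z) (by linarith)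
    rw [e1, Real.mul_rpow (by positivity) (by positivity), mul_assoc]
    have h3 : 1 + (1+z)*b ≤ (1 + (b-a)/(1+a))^(1+z) * (1+(1+z)*a) := by
      refine le_trans ?_ (mul_le_mul_of_nonneg_right hB (by positivity))
      have : (1 + (1+z) * ((b-a)/(1+a))) * (1+(1+z)*a) - (1 + (1+z)*b) = (b-a) * ((1+z)*z*a/(1+a)) := by
        field_simp; ring
      have : 0 ≤ (b-a) * ((1+z)*z*a/(1+a)) := mul_nonneg (by linarith) (by positivity)
      linarith
    refine le_trans (le_of_eq ?_) (mul_le_mul_of_nonneg_left h3 (by positivity))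
    rfl

lemma push2 {ν : Measure ℝ} (h : Cone (1/2) (2*(1+z)) ν) : Cone 0 (1+z) (ν.map (lsv z)) := by
  obtain ⟨g, hg, rfl, ha, hw⟩ := h
  have hz0 := hz.1
  refine push_branch (by norm_num) (fun x => 2*x-1) (fun x => 2) (lsv z) g (2*(1+z)) (1+z)
    (fun x hx => ?_) (fun x hx => by norm_num) ?_ ?_ ?_ (measurable_lsv z)
    (fun x hx => lsv_right hx.1.le) ha hw ?_
  · simpa using ((hasDerivAt_id x).const_mul 2).sub_const 1
  · intro x hx y hy hxy; simp
  · intro x hx y hy hxy; simp only; linarith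
  · ext y; simp only [mem_image, mem_Ioo]; constructor
    · rintro ⟨x, ⟨h1, h2⟩, rfl⟩; constructor <;> linarith
    · rintro ⟨h1, h2⟩; exact ⟨(y+1)/2, ⟨by linarith, by linarith⟩, by ring⟩
  · have key : ∀ x ∈ Ioo (1/2:ℝ) 1, (2*x-1) ^ (1+z) / (x ^ (2*(1+z)) * 2)
        = ((2*x-1)/x^2)^(1+z) / 2 := fun x hx => by
      have hx0 : 0 < x := by linarith [hx.1]
      rw [Real.div_rpow (by linarith [hx.1]) (by positivity), Real.rpow_mul hx0.le, div_div]
      norm_cast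
    intro x hx y hy hxy
    simp only [key x hx, key y hy]
    have hx0 : 0 < x := by linarith [hx.1]
    have hy0 : 0 < y := by linarith [hy.1]
    have hx1 := hx.1
    have : (2*x-1)/x^2 ≤ (2*y-1)/y^2 := by
      rw [div_le_div_iff₀ (by positivity) (by positivity)]
      have hx2 : x < 1 := hx.2
      have hy2 : y < 1 := hy.2
      have : 0 ≤ (y - x) * (x*(1-y) + y*(1-x)) := mul_nonneg (by linarith) (add_nonneg (mul_nonneg hx0.le (by linarith)) (mul_nonneg hy0.le (by linarith)))
      nlinarith
    have h5 : 0 ≤ (2*x-1)/x^2 := div_nonneg (by linarith) (by positivity)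
    have := Real.rpow_le_rpow h5 this (by linarith : 0 ≤ 1 + z)
    linarith
end
end LSVproof

open MeasureTheory Set NNReal Filter
namespace LSVproof
set_option linter.unusedSectionVars false
set_option linter.unusedVariables false
open scoped ENNReal

/-- return time of the LSV map to `[1/2, ∞)` -/
noncomputable abbrev RR (z : ℝ) : ℝ → ℕ := ret (lsv z) (Ici (1/2))
/-- induced LSV map -/
noncomputable abbrev FF (z : ℝ) : ℝ → ℝ := ind (lsv z) (Ici (1/2))

lemma meas_RR (z : ℝ) : Measurable (RR z) := measurable_ret (measurable_lsv z) measurableSet_Ici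
lemma meas_FF (z : ℝ) : Measurable (FF z) := measurable_ind (measurable_lsv z) measurableSet_Ici

section
variable {z : ℝ} (hz : z ∈ Ioo (0:ℝ) 1)
include hz

lemma exists_return {x : ℝ} (hx : x ∈ Ioc (0:ℝ) 1) : ∃ n, (lsv z)^[n] x ∈ Ici (1/2:ℝ) := by
  by_contra hcon
  push Not at hcon
  have hlt : ∀ n, (lsv z)^[n] x < 1/2 := fun n => by simpa using hcon n
  have hx0 := hx.1
  have h2 : 0 < 2^z * x^z := by positivity
  have key : ∀ n : ℕ, x ≤ (lsv z)^[n] x ∧ x * (1 + n * (2^z*x^z)) ≤ (lsv z)^[n] x := by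
    intro n
    induction n with
    | zero => simp
    | succ n ih =>
      rw [Function.iterate_succ_apply', lsv_left (hlt n)]
      set y := (lsv z)^[n] x
      refine ⟨ih.1.trans (gl_ge hz (hx0.le.trans ih.1)), ?_⟩
      unfold gl
      have h3 : 2^z*x^z ≤ 2^z*y^z := by
        have := Real.rpow_le_rpow hx0.le ih.1 hz.1.le
        gcongr
      push_cast
      have : x * (2^z*x^z) ≤ y * (2^z*y^z) := mul_le_mul ih.1 h3 h2.le (hx0.le.trans ih.1)
      nlinarith [ih.2]
  obtain ⟨n, hn⟩ := exists_nat_gt (1 / (x * (2^z*x^z)))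
  rw [div_lt_iff₀ (by positivity)] at hn
  nlinarith [(key n).2, hlt n]

lemma exists_return' {x : ℝ} (hx : x ∈ Ioo (1/2:ℝ) 1) : ∃ n, 1 ≤ n ∧ (lsv z)^[n] x ∈ Ici (1/2:ℝ) := by
  have : lsv z x ∈ Ioc (0:ℝ) 1 := by
    rw [lsv_right hx.1.le]; constructor <;> linarith [hx.1, hx.2]
  obtain ⟨n, hn⟩ := exists_return hz this
  exact ⟨n+1, by omega, by rwa [Function.iterate_succ_apply]⟩

lemma exists_return0 {x : ℝ} (hx : x ∈ Ioc (0:ℝ) 1) (hx2 : x ≠ 1/2) : ∃ n, 1 ≤ n ∧ (lsv z)^[n] x ∈ Ici (1/2:ℝ) := by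
  have : lsv z x ∈ Ioc (0:ℝ) 1 := by
    refine ⟨?_, (lsv_mem hz ⟨hx.1.le, hx.2⟩).2⟩
    rcases lt_or_ge x (1/2) with h | h
    · rw [lsv_left h]; exact hx.1.trans_le (gl_ge hz hx.1.le)
    · rw [lsv_right h]; have := lt_of_le_of_ne h hx2.symm; linarith
  obtain ⟨n, hn⟩ := exists_return hz this
  exact ⟨n+1, by omega, by rwa [Function.iterate_succ_apply]⟩

lemma RR_pos {x : ℝ} (hx : x ∈ Ioo (1/2:ℝ) 1) : 1 ≤ RR z x := (ret_spec (exists_return' hz hx)).1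

lemma cone_supp {l κ : ℝ} {ν : Measure ℝ} (h : Cone l κ ν) (s : Set ℝ) (hs : Disjoint s (Ioo l 1)) (hm : MeasurableSet s) : ν s = 0 := by
  obtain ⟨g, hg, rfl, -⟩ := h
  rw [withDensity_apply _ hm, Measure.restrict_restrict hm, hs.inter_eq]; simp

/-- measure of pieces still away from `Y` -/
noncomputable def pieceM (z : ℝ) (ν : Measure ℝ) : ℕ → Measure ℝ
  | 0 => ν.map (lsv z)
  | j+1 => ((pieceM z ν j).restrict (Iio (1/2))).map (lsv z)

omit hz in
lemma pieceM_eq (ν : Measure ℝ) (j : ℕ) : pieceM z ν j =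
    (ν.restrict {x | ∀ i, 1 ≤ i → i ≤ j → (lsv z)^[i] x ∈ Iio (1/2:ℝ)}).map ((lsv z)^[j+1]) := by
  have hm := measurable_lsv z
  induction j with
  | zero =>
    have : {x | ∀ i, 1 ≤ i → i ≤ 0 → (lsv z)^[i] x ∈ Iio (1/2:ℝ)} = univ := by
      ext x; simp only [mem_setOf_eq, mem_univ, iff_true]; intro i h1 h2; omega
    rw [this, Measure.restrict_univ]; rfl
  | succ j ih =>
    rw [pieceM, ih, Measure.restrict_map (hm.iterate _) measurableSet_Iio, Measure.map_map hm (hm.iterate _),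
      Measure.restrict_restrict ((hm.iterate _) measurableSet_Iio), ← Function.iterate_succ']
    congr 2
    ext x
    simp only [mem_inter_iff, mem_preimage, mem_setOf_eq]
    constructor
    · rintro ⟨h1, h2⟩ i hi hij
      rcases Nat.lt_or_ge j i with h | h
      · obtain rfl : i = j+1 := by omega
        exact h1
      · exact h2 i hi h
    · intro h
      exact ⟨h (j+1) (by omega) le_rfl, fun i hi hij => h i hi (by omega)⟩

lemma pieceM_cone {ν : Measure ℝ} (h : Cone (1/2) (2*(1+z)) ν) (j : ℕ) : Cone 0 (1+z) (pieceM z ν j) := by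
  induction j with
  | zero => exact push2 hz h
  | succ j ih => exact push1 hz ih

omit hz in
lemma meas_Req (a : ℕ) : MeasurableSet {x | RR z x = a} := (meas_RR z) (measurableSet_singleton a)

lemma push_piece {ν : Measure ℝ} (h : Cone (1/2) (2*(1+z)) ν) (a : ℕ) :
    Cone (1/2) (1+z) ((ν.restrict {x | RR z x = a}).map (FF z)) := by
  have hm := measurable_lsv z
  rcases Nat.eq_zero_or_pos a with rfl | ha
  · have : ν {x | RR z x = 0} = 0 := by
      refine cone_supp hz h _ ?_ (meas_Req 0)
      rw [Set.disjoint_left]; intro x hx hx2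
      have := RR_pos hz hx2
      have hx : RR z x = 0 := hx
      omega
    rw [Measure.restrict_eq_zero.2 this, Measure.map_zero]
    exact cone_zero _ _
  · obtain ⟨b, rfl⟩ : ∃ b, a = b+1 := ⟨a-1, by omega⟩
    have h1 := cone_restrict (pieceM_cone hz h b)
    rw [pieceM_eq, Measure.restrict_map (hm.iterate _) measurableSet_Ici, Measure.restrict_restrict ((hm.iterate _) measurableSet_Ici)] at h1
    have e : (lsv z)^[b+1] ⁻¹' Ici (1/2) ∩ {x | ∀ i, 1 ≤ i → i ≤ b → (lsv z)^[i] x ∈ Iio (1/2:ℝ)} = {x | RR z x = b+1} := by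
      ext x
      simp only [mem_inter_iff, mem_preimage, mem_setOf_eq]
      constructor
      · rintro ⟨h2, h3⟩
        exact ret_eq (by omega) h2 fun j hj1 hj2 => by
          have : (lsv z)^[j] x < 1/2 := h3 j hj1 (by omega)
          simpa using this
      · intro hr
        have hne : ∃ n, 1 ≤ n ∧ (lsv z)^[n] x ∈ Ici (1/2:ℝ) := by
          by_contra hc
          have : RR z x = 0 := by
            have : {n | 1 ≤ n ∧ (lsv z)^[n] x ∈ Ici (1/2:ℝ)} = ∅ := by
              ext n; simp only [mem_empty_iff_false, iff_false]; exact fun hn => hc ⟨n, hn⟩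
            simp only [RR, ret, this, Nat.sInf_empty]
          omega
        have h4 := (ret_spec hne).2
        rw [show ret (lsv z) (Ici (1/2)) x = b+1 from hr] at h4
        refine ⟨h4, fun i hi hib => ?_⟩
        have := not_mem_of_lt_ret (T := lsv z) (Y := Ici (1/2:ℝ)) (x := x) hi (by rw [show ret (lsv z) (Ici (1/2)) x = b+1 from hr]; omega)
        simpa using this
    rw [e] at h1
    convert h1 using 1
    refine Measure.map_congr ?_
    filter_upwards [ae_restrict_mem (meas_Req (b+1))] with x hx
    have hx : RR z x = b+1 := hx
    show (lsv z)^[RR z x] x = _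
    rw [hx]

omit hz in
lemma map_F_sum (ν : Measure ℝ) : ν.map (FF z) = Measure.sum fun a => (ν.restrict {x | RR z x = a}).map (FF z) := by
  ext B hB
  rw [Measure.sum_apply _ hB, Measure.map_apply (meas_FF z) hB]
  have : ∀ a, (Measure.map (FF z) (ν.restrict {x | RR z x = a})) B = ν (FF z ⁻¹' B ∩ {x | RR z x = a}) := fun a => by
    rw [Measure.map_apply (meas_FF z) hB, Measure.restrict_apply ((meas_FF z) hB)]
  simp only [this]
  rw [← measure_iUnion]
  · congr 1; ext x; simp
  · intro a b hab
    rw [Function.onFun, Set.disjoint_left]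
    rintro x ⟨_, h1⟩ ⟨_, h2⟩
    exact hab (by rw [← (show RR z x = a from h1), ← (show RR z x = b from h2)])
  · intro a; exact ((meas_FF z) hB).inter (meas_Req a)

lemma push_F {ν : Measure ℝ} (h : Cone (1/2) (2*(1+z)) ν) : Cone (1/2) (1+z) (ν.map (FF z)) := by
  rw [map_F_sum]; exact cone_sum fun a => push_piece hz h a

lemma cone_double {ν : Measure ℝ} (h : Cone (1/2) (1+z) ν) : Cone (1/2) (2*(1+z)) ν :=
  cone_mono (by norm_num) h (by linarith [hz.1])

lemma push_Fiter {ν : Measure ℝ} (h : Cone (1/2) (1+z) ν) (m : ℕ) : Cone (1/2) (1+z) (ν.map ((FF z)^[m])) := by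
  induction m with
  | zero => simpa using h
  | succ m ih =>
    rw [Function.iterate_succ', ← Measure.map_map (meas_FF z) ((meas_FF z).iterate m)]
    exact push_F hz (cone_double hz ih)

/-- cylinder set -/
def cylS (z : ℝ) (m : ℕ) (c : ℕ → ℕ) : Set ℝ := {x | ∀ i < m, RR z ((FF z)^[i] x) = c i}

omit hz in
lemma cylS_succ (m : ℕ) (c : ℕ → ℕ) : cylS z (m+1) c = (FF z)^[m] ⁻¹' {x | RR z x = c m} ∩ cylS z m c := by
  ext x
  simp only [cylS, mem_inter_iff, mem_preimage, mem_setOf_eq]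
  constructor
  · intro h; exact ⟨h m (by omega), fun i hi => h i (by omega)⟩
  · rintro ⟨h1, h2⟩ i hi
    rcases Nat.lt_or_ge i m with h | h
    · exact h2 i h
    · obtain rfl : i = m := by omega
      exact h1

omit hz in
lemma cylS_meas (m : ℕ) (c : ℕ → ℕ) : MeasurableSet (cylS z m c) := by
  induction m with
  | zero => simp [cylS]
  | succ m ih => rw [cylS_succ]; exact (((meas_FF z).iterate m) (meas_Req _)).inter ih

lemma push_cyl {ν : Measure ℝ} (h : Cone (1/2) (1+z) ν) (m : ℕ) (c : ℕ → ℕ) :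
    Cone (1/2) (1+z) ((ν.restrict (cylS z m c)).map ((FF z)^[m])) := by
  induction m with
  | zero => simpa [cylS] using h
  | succ m ih =>
    have h1 := push_piece hz (cone_double hz ih) (c m)
    rw [Measure.restrict_map ((meas_FF z).iterate m) (meas_Req _), Measure.restrict_restrict (((meas_FF z).iterate m) (meas_Req _)),
      ← cylS_succ, Measure.map_map (meas_FF z) ((meas_FF z).iterate m), ← Function.iterate_succ'] at h1
    exact h1
end
end LSVproof

open MeasureTheory Set NNReal Filter
namespace LSVproof
set_option linter.unusedSectionVars false
set_option linter.unusedVariables false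
open scoped ENNReal

/-- coupling rate -/
noncomputable def thz (z : ℝ) : ℝ := 1 - 2 ^ (-2 * (1+z)) / 2

section
variable {z : ℝ} (hz : z ∈ Ioo (0:ℝ) 1)
include hz

lemma thz_mem : thz z ∈ Ioo (0:ℝ) 1 := by
  have h1 : (0:ℝ) < 2 ^ (-2 * (1+z)) := by positivity
  have h2 : (2:ℝ) ^ (-2 * (1+z)) ≤ 1 := Real.rpow_le_one_of_one_le_of_nonpos (by norm_num) (by linarith [hz.1])
  unfold thz
  constructor <;> linarith

lemma split_mass {ν : Measure ℝ} (h : Cone (1/2) (1+z) ν) (M : ℝ≥0) (hM : ν univ = M) :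
    ∃ ν', Cone (1/2) (2 * (1+z)) ν' ∧ ν' univ = ENNReal.ofReal (thz z * M) ∧
      ν = ν' + ENNReal.ofReal (2 ^ (-2 * (1+z)) * M) • volume.restrict (Ioo (1/2) 1) := by
  obtain ⟨ν', h1, h2⟩ := cone_split (by linarith [hz.1]) h M hM
  refine ⟨ν', h1, ?_, h2⟩
  have h3 : (M:ℝ≥0∞) = ν' univ + ENNReal.ofReal (2 ^ (-2 * (1+z)) * M / 2) := by
    rw [← hM, h2]
    simp only [Measure.coe_add, Pi.add_apply, Measure.smul_apply, smul_eq_mul, Measure.restrict_apply MeasurableSet.univ, univ_inter]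
    rw [vol_half, ← ENNReal.ofReal_mul (by positivity)]
    congr 2; ring
  have h4 : (M:ℝ≥0∞) = ENNReal.ofReal (thz z * M) + ENNReal.ofReal (2 ^ (-2 * (1+z)) * M / 2) := by
    rw [← ENNReal.ofReal_add (mul_nonneg (thz_mem hz).1.le M.coe_nonneg) (by positivity), ← ENNReal.ofReal_coe_nnreal]
    congr 1; unfold thz; ring
  exact (ENNReal.add_left_inj ENNReal.ofReal_ne_top).1 (h3.symm.trans h4)

lemma couple {ν₁ ν₂ : Measure ℝ} (h₁ : Cone (1/2) (1+z) ν₁) (h₂ : Cone (1/2) (1+z) ν₂) (M : ℝ≥0)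
    (hM₁ : ν₁ univ = M) (hM₂ : ν₂ univ = M) (m : ℕ) :
    ∃ η ν₁' ν₂' : Measure ℝ, Cone (1/2) (1+z) ν₁' ∧ Cone (1/2) (1+z) ν₂' ∧
      ν₁' univ = ENNReal.ofReal (thz z ^ m * M) ∧ ν₂' univ = ENNReal.ofReal (thz z ^ m * M) ∧
      ν₁.map (FF z)^[m] = η + ν₁' ∧ ν₂.map (FF z)^[m] = η + ν₂' := by
  have hF := meas_FF z
  have hθ := (thz_mem hz).1
  induction m with
  | zero => exact ⟨0, ν₁, ν₂, h₁, h₂, by simp [hM₁], by simp [hM₂], by simp, by simp⟩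
  | succ m ih =>
    obtain ⟨η, ν₁', ν₂', c1, c2, m1, m2, e1, e2⟩ := ih
    set M' : ℝ≥0 := (thz z ^ m * M).toNNReal with hM'
    have hM'r : (M':ℝ) = thz z ^ m * M := Real.coe_toNNReal _ (by positivity)
    obtain ⟨k1, d1, n1, f1⟩ := split_mass hz c1 M' m1
    obtain ⟨k2, d2, n2, f2⟩ := split_mass hz c2 M' m2
    have hun : ∀ k : Measure ℝ, (k.map (FF z)) univ = k univ := fun k => by
      rw [Measure.map_apply hF MeasurableSet.univ, preimage_univ]
    refine ⟨η.map (FF z) + (ENNReal.ofReal (2 ^ (-2 * (1+z)) * M') • volume.restrict (Ioo (1/2) 1)).map (FF z),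
      k1.map (FF z), k2.map (FF z), push_F hz d1, push_F hz d2, ?_, ?_, ?_, ?_⟩
    · rw [hun, n1, hM'r]; congr 1; ring
    · rw [hun, n2, hM'r]; congr 1; ring
    · rw [Function.iterate_succ', ← Measure.map_map hF (hF.iterate m), e1]
      conv_lhs => rw [f1]
      rw [Measure.map_add _ _ hF, Measure.map_add _ _ hF, add_assoc, add_comm (k1.map _)]
    · rw [Function.iterate_succ', ← Measure.map_map hF (hF.iterate m), e2]
      conv_lhs => rw [f2]
      rw [Measure.map_add _ _ hF, Measure.map_add _ _ hF, add_assoc, add_comm (k2.map _)]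

lemma couple_le {ν₁ ν₂ : Measure ℝ} (h₁ : Cone (1/2) (1+z) ν₁) (h₂ : Cone (1/2) (1+z) ν₂) (M : ℝ≥0)
    (hM₁ : ν₁ univ = M) (hM₂ : ν₂ univ = M) (m : ℕ) (B : Set ℝ) (hB : MeasurableSet B) :
    ν₁.map (FF z)^[m] B ≤ ν₂.map (FF z)^[m] B + ENNReal.ofReal (2 ^ (1+z+1) * (thz z ^ m * M)) * volume.restrict (Ioo (1/2) 1) B := by
  obtain ⟨η, ν₁', ν₂', c1, c2, m1, m2, e1, e2⟩ := couple hz h₁ h₂ M hM₁ hM₂ m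
  rw [e1, e2]
  have := cone_le (by linarith [hz.1]) c1 B
  rw [m1, ← ENNReal.ofReal_mul (by positivity)] at this
  simp only [Measure.coe_add, Pi.add_apply, Measure.smul_apply, smul_eq_mul] at this ⊢
  calc _ ≤ η B + _ := add_le_add le_rfl this
    _ ≤ _ := add_le_add le_self_add le_rfl

/-- uniform probability on the base -/
noncomputable def unifY : Measure ℝ := (2:ℝ≥0∞) • volume.restrict (Ioo (1/2) 1)

omit hz in
lemma unifY_univ : unifY univ = 1 := by
  simp only [unifY, Measure.smul_apply, smul_eq_mul, Measure.restrict_apply MeasurableSet.univ, univ_inter]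
  rw [vol_half]
  have : (2:ℝ≥0∞) = ENNReal.ofReal 2 := by simp
  rw [this, ← ENNReal.ofReal_mul (by norm_num)]; norm_num

lemma cone_unif (c : ℝ≥0∞) : Cone (1/2) (1+z) (c • volume.restrict (Ioo (1/2) 1)) := by
  rw [← withDensity_const]
  refine ⟨_, measurable_const, rfl, fun _ _ _ _ _ => le_rfl, fun x hx y hy hxy => ?_⟩
  refine mul_le_mul' (ENNReal.ofReal_le_ofReal ?_) le_rfl
  exact Real.rpow_le_rpow (by linarith [hx.1]) hxy (by linarith [hz.1])

/-- Lipschitz densities, after adding a big multiple of `3 - x`, are in the cone -/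
lemma cone_lip (g : ℝ → ℝ) (L : ℝ) (hL : ∀ x, |g x| ≤ L) (hLip : ∀ x y, |g x - g y| ≤ L * |x - y|) (N : ℝ) (hN : 2 * L ≤ N) :
    Cone (1/2) (1+z) ((volume.restrict (Ioo (1/2) 1)).withDensity fun x => ENNReal.ofReal (g x + N * (3 - x))) := by
  have hL0 : 0 ≤ L := (abs_nonneg _).trans (hL 0)
  have hcont : Continuous g := by
    refine (LipschitzWith.of_dist_le_mul (K := L.toNNReal) fun x y => ?_).continuous
    rw [Real.dist_eq, Real.dist_eq, Real.coe_toNNReal _ hL0]; exact hLip x y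
  have h1 : Cone (1/2) 1 ((volume.restrict (Ioo (1/2) 1)).withDensity fun x => ENNReal.ofReal (g x + N * (3 - x))) := by
    refine ⟨_, by fun_prop, rfl, ?_, ?_⟩
    · intro x hx y hy hxy
      refine ENNReal.ofReal_le_ofReal ?_
      have := abs_le.1 (hLip x y)
      rw [abs_of_nonpos (by linarith)] at this
      nlinarith
    · intro x hx y hy hxy
      rw [Real.rpow_one, Real.rpow_one, ← ENNReal.ofReal_mul (by linarith [hx.1]), ← ENNReal.ofReal_mul (by linarith [hy.1])]
      refine ENNReal.ofReal_le_ofReal ?_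
      have h3 := abs_le.1 (hLip x y)
      rw [abs_of_nonpos (by linarith)] at h3
      have h4 := abs_le.1 (hL y)
      have hx1 := hx.1
      have hx2 := hx.2
      have hy1 := hy.1
      have hy2 := hy.2
      have h5 : x * (g x - g y) ≤ L * (y - x) := by
        have : x * (g x - g y) ≤ x * (L * (y-x)) := mul_le_mul_of_nonneg_left (by linarith) (by linarith)
        have h6 : x * (L * (y-x)) ≤ 1 * (L * (y - x)) := mul_le_mul_of_nonneg_right hx2.le (mul_nonneg hL0 (by linarith))
        linarith
      have h6 : (y - x) * (-L) ≤ (y-x) * g y := mul_le_mul_of_nonneg_left h4.1 (by linarith)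
      have h7 : (y - x) * N * (3 - x - y) ≥ (y-x) * N * 1 := mul_le_mul_of_nonneg_left (by linarith) (mul_nonneg (by linarith) (by linarith))
      have h8 : (y-x) * (N - 2 * L) ≥ 0 := mul_nonneg (by linarith) (by linarith)
      nlinarith
  exact cone_mono (by norm_num) h1 (by linarith [hz.1])
end
end LSVproof

open MeasureTheory Set NNReal Filter
namespace LSVproof
set_option linter.unusedSectionVars false
set_option linter.unusedVariables false
set_option linter.style.haveILetI false
set_option linter.unusedSimpArgs false
open scoped ENNReal ContDiff

section
variable {z : ℝ} (hz : z ∈ Ioo (0:ℝ) 1)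
include hz

/-- Lebesgue on the base -/
noncomputable abbrev lamY : Measure ℝ := volume.restrict (Ioo (1/2) 1)

omit hz in
lemma lamY_le (B : Set ℝ) : lamY.real B ≤ 1 := by
  have : lamY.real B ≤ lamY.real univ := measureReal_mono (subset_univ _)
  refine this.trans ?_
  rw [Measure.real, Measure.restrict_apply MeasurableSet.univ, univ_inter, vol_half, ENNReal.toReal_ofReal (by norm_num)]
  norm_num

lemma couple_real_le {ν₁ ν₂ : Measure ℝ} [IsFiniteMeasure ν₁] [IsFiniteMeasure ν₂] (h₁ : Cone (1/2) (1+z) ν₁) (h₂ : Cone (1/2) (1+z) ν₂)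
    (hM : ν₁ univ = ν₂ univ) (m : ℕ) (B : Set ℝ) (hB : MeasurableSet B) :
    (ν₁.map (FF z)^[m]).real B ≤ (ν₂.map (FF z)^[m]).real B + 2 ^ (1+z+1) * (thz z ^ m * ν₁.real univ) * lamY.real B := by
  obtain ⟨M, hM1⟩ : ∃ M : ℝ≥0, ν₁ univ = M := ⟨(ν₁ univ).toNNReal, (ENNReal.coe_toNNReal (measure_ne_top _ _)).symm⟩
  have h := couple_le hz h₁ h₂ M hM1 (hM ▸ hM1) m B hB
  have hMr : ν₁.real univ = M := by rw [Measure.real, hM1]; rfl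
  have hθ := (thz_mem hz).1
  rw [hMr]
  have := ENNReal.toReal_mono (by finiteness) h
  rwa [ENNReal.toReal_add (by finiteness) (by finiteness), ENNReal.toReal_mul, ENNReal.toReal_ofReal (by positivity)] at this

lemma couple_real {ν₁ ν₂ : Measure ℝ} [IsFiniteMeasure ν₁] [IsFiniteMeasure ν₂] (h₁ : Cone (1/2) (1+z) ν₁) (h₂ : Cone (1/2) (1+z) ν₂)
    (hM : ν₁ univ = ν₂ univ) (m : ℕ) (B : Set ℝ) (hB : MeasurableSet B) :
    |(ν₁.map (FF z)^[m]).real B - (ν₂.map (FF z)^[m]).real B| ≤ 2 ^ (1+z+1) * (thz z ^ m * ν₁.real univ) * lamY.real B := by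
  have h1 := couple_real_le hz h₁ h₂ hM m B hB
  have h2 := couple_real_le hz h₂ h₁ hM.symm m B hB
  have : ν₂.real univ = ν₁.real univ := by rw [Measure.real, Measure.real, hM]
  rw [this] at h2
  rw [abs_le]; constructor <;> linarith

lemma cone_unifY : Cone (1/2) (1+z) unifY := cone_unif hz 2

omit hz in
instance unifY_prob : IsProbabilityMeasure unifY := ⟨unifY_univ⟩

lemma conv_cone {ν : Measure ℝ} [IsFiniteMeasure ν] (h : Cone (1/2) (1+z) ν) (m : ℕ) (B : Set ℝ) (hB : MeasurableSet B) :
    |(ν.map (FF z)^[m]).real B - ν.real univ * (unifY.map (FF z)^[m]).real B| ≤ 2 ^ (1+z+1) * (thz z ^ m * ν.real univ) := by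
  haveI : IsFiniteMeasure ((ν univ) • unifY) := ⟨by simp⟩
  have h1 := couple_real hz h (cone_smul (cone_unifY hz) (ν univ)) (by simp [unifY_univ]) m B hB
  rw [Measure.map_smul, measureReal_ennreal_smul_apply] at h1
  refine h1.trans ?_
  have hθ := (thz_mem hz).1
  exact mul_le_of_le_one_right (by positivity) (lamY_le B)

omit hz in
lemma dens_real (g : ℝ → ℝ) (L : ℝ) (hL : ∀ x, |g x| ≤ L) (hg : Continuous g) (N : ℝ) (hN : 2 * L ≤ N) :
    IsFiniteMeasure (lamY.withDensity fun x => ENNReal.ofReal (g x + N * (3 - x))) ∧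
    ∀ A, MeasurableSet A → (lamY.withDensity fun x => ENNReal.ofReal (g x + N * (3 - x))).real A = ∫ x in A, (g x + N * (3-x)) ∂lamY := by
  have hL0 : 0 ≤ L := (abs_nonneg _).trans (hL 0)
  have hi : Integrable (fun x => g x + N * (3 - x)) lamY := by
    have : ContinuousOn (fun x => g x + N * (3 - x)) (Icc (1/2) 1) := by fun_prop
    exact (this.integrableOn_Icc).mono_set Ioo_subset_Icc_self
  have hnn : 0 ≤ᵐ[lamY] fun x => g x + N * (3 - x) := by
    filter_upwards [ae_restrict_mem measurableSet_Ioo] with x hx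
    have := abs_le.1 (hL x)
    have h2 := hx.2
    have : N * 1 ≤ N * (3 - x) := mul_le_mul_of_nonneg_left (by linarith) (by linarith)
    simp only [Pi.zero_apply]
    linarith
  refine ⟨isFiniteMeasure_withDensity_ofReal hi.2, fun A hA => ?_⟩
  rw [Measure.real, withDensity_apply _ hA, integral_eq_lintegral_of_nonneg_ae (ae_restrict_of_ae hnn) hi.aestronglyMeasurable.restrict]

lemma setwise {P : Measure ℝ} [IsProbabilityMeasure P] (hac : P ≪ lamY) (hinv : MeasurePreserving (FF z) P P)
    (B : Set ℝ) (hB : MeasurableSet B) :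
    Tendsto (fun m => (unifY.map (FF z)^[m]).real B) atTop (nhds (P.real B)) := by
  set h : ℝ → ℝ := fun x => (P.rnDeriv lamY x).toReal with hh
  have hRintg : Integrable h lamY := Measure.integrable_toReal_rnDeriv
  have hP : ∀ A, P.real A = ∫ x in A, h x ∂lamY := fun A => (Measure.setIntegral_toReal_rnDeriv hac A).symm
  rw [Metric.tendsto_atTop]
  intro ε hε
  obtain ⟨g, hgc, hgs, hga⟩ := MemLp.exist_eLpNorm_sub_le (p := 1) (by simp) le_rfl (memLp_one_iff_integrable.2 hRintg) (ε := ε/4) (by positivity)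
  obtain ⟨C, hC⟩ := hgs.continuous.bounded_above_of_compact_support hgc
  obtain ⟨K, hK⟩ := hgs.lipschitzWith_of_hasCompactSupport hgc (by simp)
  set L := max C K with hLd
  have hL : ∀ x, |g x| ≤ L := fun x => (hC x).trans (le_max_left _ _)
  have hLip : ∀ x y, |g x - g y| ≤ L * |x - y| := fun x y => by
    have := hK.dist_le_mul x y
    rw [Real.dist_eq, Real.dist_eq] at this
    exact this.trans (mul_le_mul_of_nonneg_right (le_max_right _ _) (abs_nonneg _))
  have hL0 : 0 ≤ L := (abs_nonneg _).trans (hL 0)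
  obtain ⟨fin1, r1⟩ := dens_real g L hL hgs.continuous (2*L) le_rfl
  obtain ⟨fin2, r2⟩ := dens_real (fun _ => 0) L (fun x => by simpa) continuous_const (2*L) le_rfl
  have c1 := cone_lip hz g L hL hLip (2*L) le_rfl
  have c2 := cone_lip hz (fun _ => 0) L (fun x => by simpa) (fun x y => by simp; positivity) (2*L) le_rfl
  set ν1 := lamY.withDensity fun x => ENNReal.ofReal (g x + 2*L * (3 - x)) with hν1
  set ν2 := lamY.withDensity fun x => ENNReal.ofReal ((0:ℝ) + 2*L * (3 - x)) with hν2
  have hgi : Integrable g lamY := hgs.continuous.integrable_of_hasCompactSupport hgc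
  have hi2 : Integrable (fun x => (0:ℝ) + 2*L * (3 - x)) lamY := by
    have : ContinuousOn (fun x => (0:ℝ) + 2*L * (3 - x)) (Icc (1/2) 1) := by fun_prop
    exact (this.integrableOn_Icc).mono_set Ioo_subset_Icc_self
  have hdiff : ∀ A, MeasurableSet A → ν1.real A - ν2.real A = ∫ x in A, g x ∂lamY := fun A hA => by
    rw [r1 A hA, r2 A hA]
    have e : (fun x => g x + 2*L * (3 - x)) = fun x => g x + ((0:ℝ) + 2*L * (3 - x)) := by ext x; ring
    rw [e, integral_add hgi.restrict hi2.restrict]; ring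
  have happ : ∀ A, MeasurableSet A → |P.real A - ∫ x in A, g x ∂lamY| ≤ ε/4 := fun A hA => by
    rw [hP, ← integral_sub hRintg.restrict hgi.restrict]
    have hd : Integrable (fun x => h x - g x) lamY := hRintg.sub hgi
    refine (abs_integral_le_integral_abs).trans ((setIntegral_le_integral hd.abs (Eventually.of_forall fun x => abs_nonneg _)).trans ?_)
    rw [eLpNorm_one_eq_lintegral_enorm] at hga
    simp only [Pi.sub_apply] at hga
    have := ENNReal.toReal_mono ENNReal.ofReal_ne_top hga
    rw [ENNReal.toReal_ofReal (by positivity), ← integral_norm_eq_lintegral_enorm (hd.aestronglyMeasurable)] at this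
    exact this
  have hθ := thz_mem hz
  set D := 2 ^ (1+z+1) * (ν1.real univ + ν2.real univ) with hD
  have hlim : Tendsto (fun m : ℕ => D * thz z ^ m) atTop (nhds 0) := by
    simpa using (tendsto_pow_atTop_nhds_zero_of_lt_one hθ.1.le hθ.2).const_mul D
  obtain ⟨N, hN⟩ := (hlim.eventually (gt_mem_nhds (show (0:ℝ) < ε/4 by positivity))).exists_forall_of_atTop
  refine ⟨N, fun m hm => ?_⟩
  have hN := hN m hm
  set u := (unifY.map (FF z)^[m]).real B with hu
  have hFm := (meas_FF z).iterate m
  have hu1 : u ≤ 1 := by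
    haveI := Measure.isProbabilityMeasure_map (μ := unifY) hFm.aemeasurable
    exact measureReal_le_one
  have hu0 : 0 ≤ u := measureReal_nonneg
  have q1 := conv_cone hz c1 m B hB
  have q2 := conv_cone hz c2 m B hB
  rw [map_measureReal_apply hFm hB] at q1 q2
  have q3 := hdiff _ (hFm hB)
  have q4 := hdiff _ MeasurableSet.univ
  have q5 := happ _ (hFm hB)
  have q6 := happ _ MeasurableSet.univ
  have q7 : P.real ((FF z)^[m] ⁻¹' B) = P.real B := by
    rw [Measure.real, (hinv.iterate m).measure_preimage hB.nullMeasurableSet]; rfl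
  rw [probReal_univ] at q6
  rw [q7] at q5
  rw [← q3] at q5
  rw [← q4] at q6
  rw [Real.dist_eq]
  have q8 : |u * (1 - (ν1.real univ - ν2.real univ))| ≤ ε/4 := by
    rw [abs_mul, abs_of_nonneg hu0]
    exact (mul_le_of_le_one_left (abs_nonneg _) hu1).trans q6
  have e : D * thz z ^ m = 2 ^ (1+z+1) * (thz z ^ m * ν1.real univ) + 2 ^ (1+z+1) * (thz z ^ m * ν2.real univ) := by rw [hD]; ring
  rw [e] at hN
  rw [abs_le] at q1 q2 q5 q8
  rw [abs_lt]
  constructor <;> nlinarith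
end
end LSVproof

open MeasureTheory Set NNReal Filter
namespace LSVproof
set_option linter.unusedSectionVars false
set_option linter.unusedVariables false
set_option linter.style.haveILetI false
open scoped ENNReal ContDiff

section
variable {z : ℝ} (hz : z ∈ Ioo (0:ℝ) 1)
include hz

lemma tendsto_meas {P : Measure ℝ} [IsProbabilityMeasure P] (hac : P ≪ lamY) (hinv : MeasurePreserving (FF z) P P)
    (B : Set ℝ) (hB : MeasurableSet B) :
    Tendsto (fun m => unifY.map (FF z)^[m] B) atTop (nhds (P B)) := by
  have h := ENNReal.tendsto_ofReal (setwise hz hac hinv B hB)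
  simpa [ofReal_measureReal] using h

lemma P_cone {P : Measure ℝ} [IsProbabilityMeasure P] (hac : P ≪ lamY) (hinv : MeasurePreserving (FF z) P P) :
    Cone (1/2) (1+z) P := by
  have hF := meas_FF z
  have hθ := thz_mem hz
  have hc := fun m => push_Fiter hz (cone_unifY hz) m
  choose g hgm hge hga hgw using hc
  set h0 := P.rnDeriv lamY with hh0
  have hh0m : Measurable h0 := Measure.measurable_rnDeriv _ _
  have hP : lamY.withDensity h0 = P := Measure.withDensity_rnDeriv_eq _ _ hac
  set C : ℕ → ℝ≥0∞ := fun m => ENNReal.ofReal (2 ^ (1+z+1) * (thz z ^ m)) with hC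
  have hpr : ∀ m, (unifY.map (FF z)^[m]) univ = ((1:ℝ≥0):ℝ≥0∞) := fun m => by
    rw [Measure.map_apply (hF.iterate m) MeasurableSet.univ, preimage_univ, unifY_univ]; rfl
  have step : ∀ m j, (unifY.map (FF z)^[m]).map (FF z)^[j] = unifY.map (FF z)^[m+j] := fun m j => by
    rw [Measure.map_map (hF.iterate j) (hF.iterate m), ← Function.iterate_add, add_comm]
  have step' : ∀ m j, (unifY.map (FF z)^[j]).map (FF z)^[m] = unifY.map (FF z)^[m+j] := fun m j => by
    rw [step, add_comm]
  have b1 : ∀ m B, MeasurableSet B → unifY.map (FF z)^[m] B ≤ P B + C m * lamY B := fun m B hB => by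
    have ht : Tendsto (fun j => unifY.map (FF z)^[m+j] B + C m * lamY B) atTop (nhds (P B + C m * lamY B)) :=
      ((tendsto_meas hz hac hinv B hB).comp (tendsto_add_atTop_nat m |>.congr fun j => by ring)).add_const _
    refine ge_of_tendsto' ht fun j => ?_
    have := couple_le hz (cone_unifY hz) (push_Fiter hz (cone_unifY hz) j) 1 (by simpa using unifY_univ) (hpr j) m B hB
    rw [step'] at this
    simpa [hC] using this
  have b2 : ∀ m B, MeasurableSet B → P B ≤ unifY.map (FF z)^[m] B + C m * lamY B := fun m B hB => by
    have ht : Tendsto (fun j => unifY.map (FF z)^[m+j] B) atTop (nhds (P B)) :=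
      ((tendsto_meas hz hac hinv B hB).comp (tendsto_add_atTop_nat m |>.congr fun j => by ring))
    refine le_of_tendsto' ht fun j => ?_
    have := couple_le hz (push_Fiter hz (cone_unifY hz) j) (cone_unifY hz) 1 (hpr j) (by simpa using unifY_univ) m B hB
    rw [step'] at this
    simpa [hC] using this
  have a1 : ∀ m, ∀ᵐ x ∂lamY, g m x ≤ h0 x + C m := fun m => by
    refine ae_le_of_forall_setLIntegral_le_of_sigmaFinite (hgm m) fun B hB _ => ?_
    rw [lintegral_add_right _ measurable_const, ← withDensity_apply _ hB, ← withDensity_apply _ hB, ← hge, hP, setLIntegral_const]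
    exact b1 m B hB
  have a2 : ∀ m, ∀ᵐ x ∂lamY, h0 x ≤ g m x + C m := fun m => by
    refine ae_le_of_forall_setLIntegral_le_of_sigmaFinite hh0m fun B hB _ => ?_
    rw [lintegral_add_right _ measurable_const, ← withDensity_apply _ hB, ← withDensity_apply _ hB, ← hge, hP, setLIntegral_const]
    exact b2 m B hB
  have hC0 : Tendsto C atTop (nhds 0) := by
    have : Tendsto (fun m : ℕ => 2 ^ (1+z+1) * (thz z ^ m)) atTop (nhds 0) := by
      simpa using (tendsto_pow_atTop_nhds_zero_of_lt_one hθ.1.le hθ.2).const_mul (2 ^ (1+z+1))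
    simpa using ENNReal.tendsto_ofReal this
  set h : ℝ → ℝ≥0∞ := fun x => liminf (fun m => g m x) atTop with hh
  have hhm : Measurable h := .liminf hgm
  have heq : h0 =ᵐ[lamY] h := by
    filter_upwards [ae_all_iff.2 a1, ae_all_iff.2 a2] with x h1 h2
    have t : Tendsto (fun m => g m x) atTop (nhds (h0 x)) := by
      have t1 : Tendsto (fun m => h0 x + C m) atTop (nhds (h0 x)) := by simpa using tendsto_const_nhds.add hC0
      have t2 : Tendsto (fun m => h0 x - C m) atTop (nhds (h0 x)) := by
        have := ENNReal.Tendsto.sub (tendsto_const_nhds (x := h0 x)) hC0 (Or.inr (by simp))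
        simpa using this
      exact tendsto_of_tendsto_of_tendsto_of_le_of_le t2 t1 (fun m => tsub_le_iff_right.2 (h2 m)) h1
    exact t.liminf_eq.symm
  refine ⟨h, hhm, ?_, ?_, ?_⟩
  · rw [← hP]; exact withDensity_congr_ae heq
  · intro x hx y hy hxy
    exact liminf_le_liminf (Eventually.of_forall fun m => hga m hx hy hxy)
  · intro x hx y hy hxy
    simp only [hh]
    rw [← ENNReal.liminf_const_mul_of_ne_top ENNReal.ofReal_ne_top, ← ENNReal.liminf_const_mul_of_ne_top ENNReal.ofReal_ne_top]
    exact liminf_le_liminf (Eventually.of_forall fun m => hgw m x hx y hy hxy)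

/-- mixing on cylinders -/
lemma cyl_mix {P : Measure ℝ} [IsProbabilityMeasure P] (hac : P ≪ lamY) (hinv : MeasurePreserving (FF z) P P) :
    ∃ K > 0, ∀ (m : ℕ) (c : ℕ → ℕ) (j : ℕ) (B : Set ℝ), MeasurableSet B →
      |P.real (cylS z m c ∩ (FF z)^[m+j] ⁻¹' B) - P.real (cylS z m c) * P.real B|
        ≤ K * thz z ^ j * (P.real (cylS z m c) * P.real B) := by
  have hF := meas_FF z
  have hθ := thz_mem hz
  have hPc := P_cone hz hac hinv
  have hge := cone_ge (by linarith [hz.1]) hPc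
  rw [measure_univ, mul_one] at hge
  refine ⟨2 ^ (1+z+1) * 2 ^ (1 + z - 1), by positivity, fun m c j B hB => ?_⟩
  have hc := push_cyl hz hPc m c
  set ν := (P.restrict (cylS z m c)).map (FF z)^[m] with hν
  haveI : IsFiniteMeasure ν := by rw [hν]; infer_instance
  have hνu : ν univ = P (cylS z m c) := by
    rw [hν, Measure.map_apply (hF.iterate m) MeasurableSet.univ]; simp
  haveI : IsFiniteMeasure (P (cylS z m c) • P) := ⟨by simp⟩
  have h1 := couple_real hz hc (cone_smul hPc (P (cylS z m c))) (by simp [hνu]) j B hB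
  have e1 : (ν.map (FF z)^[j]).real B = P.real (cylS z m c ∩ (FF z)^[m+j] ⁻¹' B) := by
    rw [hν, Measure.map_map (hF.iterate j) (hF.iterate m), ← Function.iterate_add, map_measureReal_apply (hF.iterate _) hB,
      measureReal_restrict_apply ((hF.iterate _) hB), inter_comm, add_comm]
  have e2 : ((P (cylS z m c) • P).map (FF z)^[j]).real B = P.real (cylS z m c) * P.real B := by
    rw [Measure.map_smul, measureReal_ennreal_smul_apply, (hinv.iterate j).map_eq]; rfl
  have e3 : ν.real univ = P.real (cylS z m c) := by rw [Measure.real, hνu]; rfl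
  rw [e1, e2, e3] at h1
  refine h1.trans ?_
  have h2 : lamY.real B ≤ 2 ^ (1 + z - 1) * P.real B := by
    have := hge B
    rw [Measure.smul_apply, smul_eq_mul] at this
    have := ENNReal.toReal_mono (by finiteness) this
    rw [ENNReal.toReal_mul, ENNReal.toReal_ofReal (by positivity)] at this
    have h3 : (2:ℝ) ^ (1 + z - 1) * (2 ^ (1 - (1+z)) * lamY.real B) ≤ 2 ^ (1 + z - 1) * P.real B :=
      mul_le_mul_of_nonneg_left this (by positivity)
    rwa [← mul_assoc, ← Real.rpow_add (by norm_num), show 1 + z - 1 + (1 - (1+z)) = 0 by ring, Real.rpow_zero, one_mul] at h3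
  have hθ0 := hθ.1
  calc _ ≤ 2 ^ (1+z+1) * (thz z ^ j * P.real (cylS z m c)) * (2 ^ (1 + z - 1) * P.real B) :=
        mul_le_mul_of_nonneg_left h2 (by positivity)
    _ = _ := by ring
end
end LSVproof

open MeasureTheory Set NNReal Filter
namespace LSVproof
set_option linter.unusedSectionVars false
set_option linter.unusedVariables false
set_option linter.style.haveILetI false
open scoped ENNReal

section compare
variable {Ω : Type*} [MeasurableSpace Ω]

lemma compare_int (ν₁ ν₂ : Measure Ω) [IsFiniteMeasure ν₁] [IsFiniteMeasure ν₂] (δ : ℝ) (hδ : 0 ≤ δ)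
    (h1 : ν₁ ≤ ENNReal.ofReal (1 + δ) • ν₂) (h2 : ν₂ ≤ ν₁ + ENNReal.ofReal δ • ν₂)
    (B : Ω → ℂ) (hB : Integrable B ν₂) :
    Integrable B ν₁ ∧ ‖∫ x, B x ∂ν₁ - ∫ x, B x ∂ν₂‖ ≤ 3 * δ * ∫ x, ‖B x‖ ∂ν₂ := by
  have hB1 : Integrable B ν₁ := (hB.smul_measure ENNReal.ofReal_ne_top).mono_measure h1
  refine ⟨hB1, ?_⟩
  haveI : IsFiniteMeasure (ENNReal.ofReal (1 + δ) • ν₂) := ⟨by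
    rw [Measure.smul_apply, smul_eq_mul]; exact ENNReal.mul_lt_top ENNReal.ofReal_lt_top (measure_lt_top _ _)⟩
  set ρ := ENNReal.ofReal (1 + δ) • ν₂ - ν₁ with hρ
  have e : ρ + ν₁ = ENNReal.ofReal (1 + δ) • ν₂ := Measure.sub_add_cancel_of_le h1
  have hρle : ρ ≤ ENNReal.ofReal (2 * δ) • ν₂ := by
    refine Measure.le_intro fun s hs _ => ?_
    have e1 : ρ s + ν₁ s = ENNReal.ofReal (1+δ) * ν₂ s := by
      rw [← Measure.add_apply, e]; rfl
    have e2 : ν₂ s ≤ ν₁ s + ENNReal.ofReal δ * ν₂ s := h2 s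
    have e3 : ENNReal.ofReal (1 + δ) = 1 + ENNReal.ofReal δ := by rw [ENNReal.ofReal_add (by norm_num) hδ]; simp
    have e4 : ρ s + ν₁ s ≤ ENNReal.ofReal (2 * δ) * ν₂ s + ν₁ s := by
      rw [e1, e3, add_mul, one_mul, two_mul, ENNReal.ofReal_add hδ hδ, add_mul]
      calc _ ≤ ν₁ s + ENNReal.ofReal δ * ν₂ s + ENNReal.ofReal δ * ν₂ s := add_le_add e2 le_rfl
        _ = _ := by ring
    exact (ENNReal.add_le_add_iff_right (measure_ne_top _ _)).1 e4
  have hBρ : Integrable B ρ := (hB.smul_measure ENNReal.ofReal_ne_top).mono_measure hρle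
  have h3 : ∫ x, B x ∂ρ + ∫ x, B x ∂ν₁ = (1 + δ : ℝ) • ∫ x, B x ∂ν₂ := by
    rw [← integral_add_measure hBρ hB1, e, integral_smul_measure, ENNReal.toReal_ofReal (by linarith)]
  have h4 : ‖∫ x, B x ∂ρ‖ ≤ 2 * δ * ∫ x, ‖B x‖ ∂ν₂ := by
    refine (norm_integral_le_integral_norm _).trans ?_
    refine (integral_mono_measure hρle (Eventually.of_forall fun x => norm_nonneg _) (hB.norm.smul_measure ENNReal.ofReal_ne_top)).trans ?_
    rw [integral_smul_measure, ENNReal.toReal_ofReal (by linarith), smul_eq_mul]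
  have h5 : ‖∫ x, B x ∂ν₂‖ ≤ ∫ x, ‖B x‖ ∂ν₂ := norm_integral_le_integral_norm _
  have h6 : ∫ x, B x ∂ν₁ - ∫ x, B x ∂ν₂ = δ • ∫ x, B x ∂ν₂ - ∫ x, B x ∂ρ := by
    have : ∫ x, B x ∂ν₁ = (1 + δ : ℝ) • ∫ x, B x ∂ν₂ - ∫ x, B x ∂ρ := by rw [← h3]; ring
    rw [this, add_smul, one_smul]; ring
  rw [h6]
  refine (norm_sub_le _ _).trans ?_
  rw [norm_smul, Real.norm_eq_abs, abs_of_nonneg hδ]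
  nlinarith
end compare

section prob
variable {Ω : Type*} [MeasurableSpace Ω] {F : Ω → Ω} {R : Ω → ℕ}

/-- depends on first `m` symbols -/
def Dep (F : Ω → Ω) (R : Ω → ℕ) {β : Type*} (m : ℕ) (A : Ω → β) : Prop :=
  ∀ x y, (∀ i < m, R (F^[i] x) = R (F^[i] y)) → A x = A y

/-- symbolic code -/
def code (F : Ω → Ω) (R : Ω → ℕ) (m : ℕ) (x : Ω) : Fin m → ℕ := fun i => R (F^[i] x)

/-- abstract cylinder -/
def acyl (F : Ω → Ω) (R : Ω → ℕ) (m : ℕ) (c : ℕ → ℕ) : Set Ω := {x | ∀ i < m, R (F^[i] x) = c i}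

lemma Dep.factor {β : Type*} [Zero β] {m : ℕ} {A : Ω → β} (h : Dep F R m A) : ∃ a : (Fin m → ℕ) → β, A = fun x => a (code F R m x) := by
  refine ⟨Function.extend (code F R m) A (fun _ => 0), ?_⟩
  ext x
  symm
  refine Function.FactorsThrough.extend_apply (f := code F R m) (g := A) ?_ _ x
  intro x y hxy
  exact h x y fun i hi => congr_fun hxy ⟨i, hi⟩

lemma meas_code (hF : Measurable F) (hR : Measurable R) (m : ℕ) : Measurable (code F R m) :=
  measurable_pi_lambda _ fun i => hR.comp (hF.iterate i)

lemma Dep.meas {β : Type*} [Zero β] [MeasurableSpace β] (hF : Measurable F) (hR : Measurable R) {m : ℕ} {A : Ω → β} (h : Dep F R m A) : Measurable A := by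
  obtain ⟨a, rfl⟩ := h.factor
  exact (measurable_from_top (f := a)).comp (by
    have := meas_code hF hR m
    refine this.mono le_rfl ?_
    exact fun s _ => (Set.to_countable s).measurableSet)

variable {P : Measure Ω} [IsProbabilityMeasure P] (hF : MeasurePreserving F P P) (hR : Measurable R)
  {K θ : ℝ} (hK : 0 ≤ K) (hθ0 : 0 < θ) (hθ1 : θ < 1)
  (hmix : ∀ (m : ℕ) (c : ℕ → ℕ) (j : ℕ) (B : Set Ω), MeasurableSet B →
      |P.real (acyl F R m c ∩ F^[m+j] ⁻¹' B) - P.real (acyl F R m c) * P.real B|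
        ≤ K * θ ^ j * (P.real (acyl F R m c) * P.real B))
include hF hR hK hθ0 hmix

lemma joint_cmp (m j : ℕ) :
    P.map (fun x => (code F R m x, F^[m+j] x)) ≤ ENNReal.ofReal (1 + K * θ^j) • ((P.map (code F R m)).prod P) ∧
    (P.map (code F R m)).prod P ≤ P.map (fun x => (code F R m x, F^[m+j] x)) + ENNReal.ofReal (K * θ^j) • ((P.map (code F R m)).prod P) := by
  have hc := meas_code hF.measurable hR m
  have hFm := hF.measurable.iterate (m+j)
  have hδ : 0 ≤ K * θ^j := by positivity
  haveI : IsProbabilityMeasure (P.map (code F R m)) := Measure.isProbabilityMeasure_map hc.aemeasurable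
  set J := P.map (fun x => (code F R m x, F^[m+j] x)) with hJ
  set Q := (P.map (code F R m)).prod P with hQ
  haveI : IsProbabilityMeasure J := Measure.isProbabilityMeasure_map (hc.prodMk hFm).aemeasurable
  have base : ∀ (c : Fin m → ℕ) (B : Set Ω), MeasurableSet B →
      |J.real ({c} ×ˢ B) - Q.real ({c} ×ˢ B)| ≤ K * θ^j * Q.real ({c} ×ˢ B) := by
    intro c B hB
    have e0 : code F R m ⁻¹' {c} = acyl F R m (fun i => if h : i < m then c ⟨i, h⟩ else 0) := by
      ext x
      simp only [mem_preimage, mem_singleton_iff, acyl, mem_ofPred_eq, code]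
      constructor
      · rintro h i hi
        rw [dif_pos hi, ← h]; rfl
      · intro h
        ext i
        show R (F^[i] x) = c i
        rw [h i i.2, dif_pos i.2]
    have e1 : J.real ({c} ×ˢ B) = P.real (acyl F R m (fun i => if h : i < m then c ⟨i, h⟩ else 0) ∩ F^[m+j] ⁻¹' B) := by
      rw [hJ, map_measureReal_apply (hc.prodMk hFm) ((measurableSet_singleton c).prod hB), ← e0]; rfl
    have e2 : Q.real ({c} ×ˢ B) = P.real (acyl F R m (fun i => if h : i < m then c ⟨i, h⟩ else 0)) * P.real B := by
      rw [hQ, measureReal_prod_prod, map_measureReal_apply hc (measurableSet_singleton c), ← e0]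
    rw [e1, e2]
    exact hmix m _ j B hB
  have b1 : ∀ (c : Fin m → ℕ) (B : Set Ω), MeasurableSet B → J ({c} ×ˢ B) ≤ ENNReal.ofReal (1 + K * θ^j) * Q ({c} ×ˢ B) := by
    intro c B hB
    have := (abs_le.1 (base c B hB)).2
    rw [← ofReal_measureReal (μ := J), ← ofReal_measureReal (μ := Q), ← ENNReal.ofReal_mul (by linarith)]
    exact ENNReal.ofReal_le_ofReal (by linarith)
  have b2 : ∀ (c : Fin m → ℕ) (B : Set Ω), MeasurableSet B → Q ({c} ×ˢ B) ≤ J ({c} ×ˢ B) + ENNReal.ofReal (K * θ^j) * Q ({c} ×ˢ B) := by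
    intro c B hB
    have := (abs_le.1 (base c B hB)).1
    rw [← ofReal_measureReal (μ := J), ← ofReal_measureReal (μ := Q), ← ENNReal.ofReal_mul hδ, ← ENNReal.ofReal_add measureReal_nonneg (by positivity)]
    exact ENNReal.ofReal_le_ofReal (by linarith)
  have slice : ∀ (ν : Measure ((Fin m → ℕ) × Ω)) (s : Set ((Fin m → ℕ) × Ω)), MeasurableSet s →
      ν s = ∑' c : Fin m → ℕ, ν ({c} ×ˢ (Prod.mk c ⁻¹' s)) := by
    intro ν s hs
    rw [← measure_iUnion]
    · congr 1; ext ⟨c, x⟩; simp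
    · intro a b hab
      rw [Function.onFun, Set.disjoint_left]
      rintro ⟨c, x⟩ ⟨h1, _⟩ ⟨h2, _⟩
      exact hab (h1.symm.trans h2)
    · intro c; exact (measurableSet_singleton c).prod (measurable_prodMk_left hs)
  constructor
  · refine Measure.le_intro fun s hs _ => ?_
    rw [Measure.smul_apply, smul_eq_mul, slice J s hs, slice Q s hs, ← ENNReal.tsum_mul_left]
    exact ENNReal.tsum_le_tsum fun c => b1 c _ (measurable_prodMk_left hs)
  · refine Measure.le_intro fun s hs _ => ?_
    rw [Measure.add_apply, Measure.smul_apply, smul_eq_mul, slice J s hs, slice Q s hs, ← ENNReal.tsum_mul_left, ← ENNReal.tsum_add]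
    exact ENNReal.tsum_le_tsum fun c => b2 c _ (measurable_prodMk_left hs)

/-- main mixing estimate -/
lemma MIX (m j : ℕ) (A B : Ω → ℂ) (hA : Dep F R m A) (hAi : Integrable A P) (hB : Integrable B P) (hBm : Measurable B) :
    Integrable (fun x => A x * B (F^[m+j] x)) P ∧
    ‖∫ x, A x * B (F^[m+j] x) ∂P - (∫ x, A x ∂P) * ∫ x, B x ∂P‖ ≤ 3 * (K * θ^j) * ((∫ x, ‖A x‖ ∂P) * ∫ x, ‖B x‖ ∂P) := by
  obtain ⟨a, rfl⟩ := hA.factor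
  have hc := meas_code hF.measurable hR m
  have hFm := hF.measurable.iterate (m+j)
  have hδ : 0 ≤ K * θ^j := by positivity
  haveI : IsProbabilityMeasure (P.map (code F R m)) := Measure.isProbabilityMeasure_map hc.aemeasurable
  haveI : IsProbabilityMeasure (P.map (fun x => (code F R m x, F^[m+j] x))) := Measure.isProbabilityMeasure_map (hc.prodMk hFm).aemeasurable
  obtain ⟨h1, h2⟩ := joint_cmp hF hR hK hθ0 hmix m j
  have ham : Measurable a := fun s _ => (Set.to_countable _).measurableSet
  have hai : Integrable a (P.map (code F R m)) := (integrable_map_measure ham.aestronglyMeasurable hc.aemeasurable).2 hAi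
  have hprod : Integrable (fun p : (Fin m → ℕ) × Ω => a p.1 * B p.2) ((P.map (code F R m)).prod P) := hai.mul_prod hB
  have hm2 : Measurable (fun p : (Fin m → ℕ) × Ω => a p.1 * B p.2) := (ham.comp measurable_fst).mul (hBm.comp measurable_snd)
  obtain ⟨i1, i2⟩ := compare_int _ _ (K * θ^j) hδ h1 h2 _ hprod
  rw [integral_map (hc.prodMk hFm).aemeasurable hm2.aestronglyMeasurable, integral_prod_mul] at i2
  have i3 : ∫ p, ‖a p.1 * B p.2‖ ∂((P.map (code F R m)).prod P) = (∫ x, ‖a (code F R m x)‖ ∂P) * ∫ x, ‖B x‖ ∂P := by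
    simp only [norm_mul]
    rw [integral_prod_mul (fun x => ‖a x‖) (fun x => ‖B x‖), integral_map hc.aemeasurable ham.norm.aestronglyMeasurable]
  rw [i3, integral_map hc.aemeasurable ham.aestronglyMeasurable] at i2
  exact ⟨(integrable_map_measure hm2.aestronglyMeasurable (hc.prodMk hFm).aemeasurable).1 i1, i2⟩

end prob
end LSVproof

open MeasureTheory Set NNReal Filter
namespace LSVproof
set_option linter.unusedSectionVars false
set_option linter.unusedVariables false
set_option linter.style.haveILetI false
open scoped ENNReal

section moments
variable {Ω : Type*} [MeasurableSpace Ω] {P : Measure Ω} [IsProbabilityMeasure P]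

lemma lint_rpow_Ioc (a M : ℝ) (ha : -1 < a) (hM : 0 < M) :
    ∫⁻ t in Ioc 0 M, ENNReal.ofReal (t ^ a) = ENNReal.ofReal (M ^ (a+1) / (a+1)) := by
  have hi : IntegrableOn (fun t : ℝ => t ^ a) (Ioc 0 M) :=
    (intervalIntegrable_iff_integrableOn_Ioc_of_le hM.le).1 (intervalIntegral.intervalIntegrable_rpow' ha)
  rw [← ofReal_integral_eq_lintegral_ofReal hi]
  · rw [← intervalIntegral.integral_of_le hM.le, integral_rpow (Or.inl ha), Real.zero_rpow (by linarith), sub_zero]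
  · filter_upwards [ae_restrict_mem measurableSet_Ioc] with t ht
    exact Real.rpow_nonneg ht.1.le _

lemma lint_rpow_Ioi (a M : ℝ) (ha : a < -1) (hM : 0 < M) :
    ∫⁻ t in Ioi M, ENNReal.ofReal (t ^ a) = ENNReal.ofReal (-M ^ (a+1) / (a+1)) := by
  have hi : IntegrableOn (fun t : ℝ => t ^ a) (Ioi M) := integrableOn_Ioi_rpow_of_lt ha hM
  rw [← ofReal_integral_eq_lintegral_ofReal hi]
  · rw [integral_Ioi_rpow_of_lt ha hM]
  · filter_upwards [ae_restrict_mem measurableSet_Ioi] with t ht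
    exact Real.rpow_nonneg (hM.trans ht).le _

lemma moment_low (f : Ω → ℝ) (hf : Measurable f) (hf0 : ∀ x, 0 ≤ f x) (α C p M : ℝ) (hC : 0 ≤ C) (hα : 0 < α) (hp : α < p) (hM : 0 < M)
    (htail : ∀ y > 0, P.real {x | y < f x} ≤ C * y ^ (-α)) :
    ∫⁻ x, ENNReal.ofReal (if f x ≤ M then f x ^ p else 0) ∂P ≤ ENNReal.ofReal (p * C / (p - α) * M ^ (p - α)) := by
  have hp0 : 0 < p := hα.trans hp
  have e : ∀ x, (if f x ≤ M then f x ^ p else 0) = (if f x ≤ M then f x else 0) ^ p := fun x => by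
    split_ifs
    · rfl
    · rw [Real.zero_rpow hp0.ne']
  simp only [e]
  have hg : Measurable fun x => if f x ≤ M then f x else 0 := Measurable.ite (measurableSet_le hf measurable_const) hf measurable_const
  rw [lintegral_rpow_eq_lintegral_meas_lt_mul P (Eventually.of_forall fun x => ?_) hg.aemeasurable hp0]
  swap
  · simp only [Pi.zero_apply]; split_ifs
    · exact hf0 x
    · exact le_rfl
  have h1 : ∫⁻ t in Ioi 0, P {a | t < if f a ≤ M then f a else 0} * ENNReal.ofReal (t ^ (p-1)) ≤
      ENNReal.ofReal C * ∫⁻ t in Ioc 0 M, ENNReal.ofReal (t ^ (p - 1 - α)) := by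
    rw [← lintegral_const_mul' _ _ ENNReal.ofReal_ne_top, ← lintegral_indicator measurableSet_Ioi, ← lintegral_indicator measurableSet_Ioc]
    refine lintegral_mono fun t => ?_
    by_cases ht : 0 < t
    · rw [indicator_of_mem (show t ∈ Ioi (0:ℝ) from ht)]
      by_cases htM : t ≤ M
      · rw [indicator_of_mem (show t ∈ Ioc 0 M from ⟨ht, htM⟩)]
        have h2 : P {a | t < if f a ≤ M then f a else 0} ≤ ENNReal.ofReal (C * t ^ (-α)) := by
          refine le_trans (measure_mono fun x hx => ?_) (?_ : P {x | t < f x} ≤ _)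
          · simp only [mem_ofPred_eq] at hx ⊢
            split_ifs at hx with h
            · exact hx
            · linarith
          · rw [← ofReal_measureReal]; exact ENNReal.ofReal_le_ofReal (htail t ht)
        refine (mul_le_mul' h2 le_rfl).trans (le_of_eq ?_)
        rw [← ENNReal.ofReal_mul (by positivity), ← ENNReal.ofReal_mul hC, mul_assoc, ← Real.rpow_add ht]
        congr 3; ring
      · have : {a | t < if f a ≤ M then f a else 0} = ∅ := by
          ext x; simp only [mem_ofPred_eq, mem_empty_iff_false, iff_false]
          split_ifs <;> linarith
        rw [this]; simp
    · rw [indicator_of_notMem (show t ∉ Ioi (0:ℝ) from ht)]; exact zero_le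
  refine (mul_le_mul' le_rfl h1).trans (le_of_eq ?_)
  rw [lint_rpow_Ioc _ _ (by linarith) hM, ← ENNReal.ofReal_mul hC, ← ENNReal.ofReal_mul hp0.le]
  congr 1
  rw [show p - 1 - α + 1 = p - α by ring]; field_simp

lemma moment_high (f : Ω → ℝ) (hf : Measurable f) (hf0 : ∀ x, 0 ≤ f x) (α C p M : ℝ) (hC : 0 ≤ C) (hp0 : 0 < p) (hp : p < α) (hM : 0 < M)
    (htail : ∀ y > 0, P.real {x | y < f x} ≤ C * y ^ (-α)) :
    ∫⁻ x, ENNReal.ofReal (if f x ≤ M then 0 else f x ^ p) ∂P ≤ ENNReal.ofReal (α * C / (α - p) * M ^ (p - α)) := by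
  have hα : 0 < α := hp0.trans hp
  have e : ∀ x, (if f x ≤ M then 0 else f x ^ p) = (if f x ≤ M then 0 else f x) ^ p := fun x => by
    split_ifs
    · rw [Real.zero_rpow hp0.ne']
    · rfl
  simp only [e]
  have hg : Measurable fun x => if f x ≤ M then 0 else f x := Measurable.ite (measurableSet_le hf measurable_const) measurable_const hf
  rw [lintegral_rpow_eq_lintegral_meas_lt_mul P (Eventually.of_forall fun x => ?_) hg.aemeasurable hp0]
  swap
  · simp only [Pi.zero_apply]; split_ifs
    · exact le_rfl
    · exact hf0 x
  have hm : ∀ t > 0, P {x | t < f x} ≤ ENNReal.ofReal (C * t ^ (-α)) := fun t ht => by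
    rw [← ofReal_measureReal]; exact ENNReal.ofReal_le_ofReal (htail t ht)
  have h1 : ∫⁻ t in Ioc 0 M, P {a | t < if f a ≤ M then 0 else f a} * ENNReal.ofReal (t ^ (p-1)) ≤
      ENNReal.ofReal (C * M ^ (-α)) * ∫⁻ t in Ioc 0 M, ENNReal.ofReal (t ^ (p - 1)) := by
    rw [← lintegral_const_mul' _ _ ENNReal.ofReal_ne_top]
    refine setLIntegral_mono' measurableSet_Ioc fun t ht => mul_le_mul' ?_ le_rfl
    refine le_trans (measure_mono fun x hx => ?_) (hm M hM)
    simp only [mem_ofPred_eq] at hx ⊢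
    split_ifs at hx with h
    · linarith [ht.1]
    · linarith
  have h2 : ∫⁻ t in Ioi M, P {a | t < if f a ≤ M then 0 else f a} * ENNReal.ofReal (t ^ (p-1)) ≤
      ENNReal.ofReal C * ∫⁻ t in Ioi M, ENNReal.ofReal (t ^ (p - 1 - α)) := by
    rw [← lintegral_const_mul' _ _ ENNReal.ofReal_ne_top]
    refine setLIntegral_mono' measurableSet_Ioi fun t ht => ?_
    have ht0 : 0 < t := hM.trans ht
    have h2 : P {a | t < if f a ≤ M then 0 else f a} ≤ ENNReal.ofReal (C * t ^ (-α)) := by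
      refine le_trans (measure_mono fun x hx => ?_) (hm t ht0)
      simp only [mem_ofPred_eq] at hx ⊢
      split_ifs at hx with h
      · linarith
      · exact hx
    refine (mul_le_mul' h2 le_rfl).trans (le_of_eq ?_)
    rw [← ENNReal.ofReal_mul (by positivity), ← ENNReal.ofReal_mul hC, mul_assoc, ← Real.rpow_add ht0]
    congr 3; ring
  rw [← Ioc_union_Ioi_eq_Ioi hM.le, lintegral_union measurableSet_Ioi (by
    rw [Set.disjoint_left]; intro t ht ht2; exact absurd ht.2 (not_le.2 ht2))]
  refine (mul_le_mul' le_rfl (add_le_add h1 h2)).trans (le_of_eq ?_)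
  have hap : 0 < α - p := by linarith
  have q1 : 0 ≤ M ^ (p - 1 + 1) / (p - 1 + 1) := by rw [sub_add_cancel]; positivity
  have q2 : -M ^ (p - 1 - α + 1) / (p - 1 - α + 1) = M ^ (p - α) / (α - p) := by
    rw [show p - 1 - α + 1 = -(α - p) by ring, neg_div_neg_eq, show -(α - p) = p - α by ring]
  rw [lint_rpow_Ioc _ _ (by linarith) hM, lint_rpow_Ioi _ _ (by linarith) hM, q2, ← ENNReal.ofReal_mul (by positivity), ← ENNReal.ofReal_mul hC,
    ← ENNReal.ofReal_add (by positivity) (by positivity), ← ENNReal.ofReal_mul hp0.le]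
  congr 1
  have : M ^ (-α) * M ^ p = M ^ (p - α) := by rw [← Real.rpow_add hM]; congr 1; ring
  rw [sub_add_cancel, ← this]
  field_simp
  ring
end moments
end LSVproof

open MeasureTheory Set NNReal Filter
namespace LSVproof
set_option linter.unusedSectionVars false
set_option linter.unusedVariables false
set_option linter.style.haveILetI false
open scoped ENNReal

section prob
variable {Ω : Type*} [MeasurableSpace Ω] {F : Ω → Ω} {R : Ω → ℕ}

/-- Birkhoff sums along `F` -/
def bsum (F : Ω → Ω) (A : Ω → ℝ) (k : ℕ) (x : Ω) : ℝ := ∑ i ∈ Finset.range k, A (F^[i] x)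

lemma bsum_succ (A : Ω → ℝ) (k : ℕ) (x : Ω) : bsum F A (k+1) x = A x + bsum F A k (F x) := by
  simp only [bsum]; rw [Finset.sum_range_succ']; simp [add_comm]

lemma bsum_add (A : Ω → ℝ) (k l : ℕ) (x : Ω) : bsum F A (k+l) x = bsum F A k x + bsum F A l (F^[k] x) := by
  simp only [bsum]; rw [Finset.sum_range_add]
  congr 1
  refine Finset.sum_congr rfl fun i _ => ?_
  rw [← Function.iterate_add_apply, add_comm]

lemma bsum_meas (hF : Measurable F) (A : Ω → ℝ) (hA : Measurable A) (k : ℕ) : Measurable (bsum F A k) :=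
  Finset.measurable_sum _ fun i _ => hA.comp (hF.iterate i)

lemma int_comp {P : Measure Ω} {G : Ω → Ω} (hG : MeasurePreserving G P P) {f : Ω → ℝ} (hf : Measurable f) :
    ∫ x, f (G x) ∂P = ∫ x, f x ∂P := by
  have := integral_map (μ := P) hG.measurable.aemeasurable (f := f) hf.aestronglyMeasurable
  rw [hG.map_eq] at this
  exact this.symm

lemma geom_le {θ : ℝ} (hθ0 : 0 < θ) (hθ1 : θ < 1) (n : ℕ) : ∑ i ∈ Finset.range n, θ^i ≤ 1/(1-θ) := by
  rw [one_div, ← tsum_geometric_of_lt_one hθ0.le hθ1]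
  exact (summable_geometric_of_lt_one hθ0.le hθ1).sum_le_tsum _ fun i _ => by positivity

variable {P : Measure Ω} [IsProbabilityMeasure P] (hF : MeasurePreserving F P P) (hR : Measurable R)
  {K θ : ℝ} (hK : 0 ≤ K) (hθ0 : 0 < θ) (hθ1 : θ < 1)
  (hmix : ∀ (m : ℕ) (c : ℕ → ℕ) (j : ℕ) (B : Set Ω), MeasurableSet B →
      |P.real (acyl F R m c ∩ F^[m+j] ⁻¹' B) - P.real (acyl F R m c) * P.real B|
        ≤ K * θ ^ j * (P.real (acyl F R m c) * P.real B))
include hF hR hK hθ0 hmix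

lemma MIXr (m j : ℕ) (A B : Ω → ℝ) (hA : Dep F R m A) (hAi : Integrable A P) (hB : Integrable B P) (hBm : Measurable B) :
    Integrable (fun x => A x * B (F^[m+j] x)) P ∧
    |∫ x, A x * B (F^[m+j] x) ∂P - (∫ x, A x ∂P) * ∫ x, B x ∂P| ≤ 3 * (K * θ^j) * ((∫ x, |A x| ∂P) * ∫ x, |B x| ∂P) := by
  have h := MIX hF hR hK hθ0 hmix m j (fun x => (A x : ℂ)) (fun x => (B x : ℂ)) (fun x y hxy => congrArg (fun t : ℝ => (t:ℂ)) (hA x y hxy)) hAi.ofReal hB.ofReal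
    (Complex.measurable_ofReal.comp hBm)
  obtain ⟨h1, h2⟩ := h
  constructor
  · have := h1.re
    simpa [← Complex.ofReal_mul] using this
  · simp only [← Complex.ofReal_mul, integral_complex_ofReal, ← Complex.ofReal_sub, Complex.norm_real, Real.norm_eq_abs] at h2
    exact h2

include hθ1

lemma var_zero (m : ℕ) (A : Ω → ℝ) (hA : Dep F R m A) (hA2 : MemLp A 2 P) (h0 : ∫ x, A x ∂P = 0) (k : ℕ) :
    MemLp (bsum F A k) 2 P ∧ ∫ x, bsum F A k x ^ 2 ∂P ≤ k * (1 + 2 * (m + 3 * K / (1-θ))) * ∫ x, A x ^ 2 ∂P := by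
  have hAm : Measurable A := hA.meas hF.measurable hR
  have hAi : Integrable A P := hA2.integrable (by norm_num)
  have hsq : Integrable (fun x => A x ^ 2) P := hA2.integrable_sq
  set σ := ∫ x, A x ^ 2 ∂P with hσ
  have hσ0 : 0 ≤ σ := integral_nonneg fun x => sq_nonneg _
  have hit : ∀ l, MemLp (fun x => A (F^[l] x)) 2 P := fun l => hA2.comp_measurePreserving (hF.iterate l)
  have hisq : ∀ l, ∫ x, A (F^[l] x) ^ 2 ∂P = σ := fun l => int_comp (hF.iterate l) (hAm.pow_const 2)
  have c1 : ∀ l, ∫ x, A x * A (F^[l] x) ∂P ≤ σ := fun l => by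
    have hp : Integrable (fun x => A x * A (F^[l] x)) P := hA2.integrable_mul (hit l)
    have : ∫ x, A x * A (F^[l] x) ∂P ≤ ∫ x, (A x ^ 2 / 2 + A (F^[l] x) ^ 2 / 2) ∂P := by
      refine integral_mono hp ((hsq.div_const 2).add ((hit l).integrable_sq.div_const 2)) fun x => ?_
      simp only
      nlinarith [sq_nonneg (A x - A (F^[l] x))]
    rw [integral_add (hsq.div_const 2) ((hit l).integrable_sq.div_const 2), integral_div, integral_div, hisq] at this
    linarith
  have c2 : ∀ j, ∫ x, A x * A (F^[m+j] x) ∂P ≤ 3 * K * θ^j * σ := fun j => by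
    have := (MIXr hF hR hK hθ0 hmix m j A A hA hAi hAi hAm).2
    rw [h0] at this
    have h2 : (∫ x, |A x| ∂P) * (∫ x, |A x| ∂P) ≤ σ := by
      have hv := ProbabilityTheory.variance_nonneg (fun x => |A x|) P
      rw [ProbabilityTheory.variance_eq_sub (by exact hA2.abs)] at hv
      simp only [Pi.pow_apply, sq_abs] at hv
      rw [← sq]; linarith
    have h3 := le_abs_self (∫ x, A x * A (F^[m+j] x) ∂P)
    have h4 : 3 * (K * θ^j) * ((∫ x, |A x| ∂P) * (∫ x, |A x| ∂P)) ≤ 3 * (K * θ^j) * σ := mul_le_mul_of_nonneg_left h2 (by positivity)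
    simp only [zero_mul, sub_zero] at this
    linarith
  have hθ' : 0 < 1 - θ := by linarith
  have csum : ∀ N, ∑ l ∈ Finset.range N, ∫ x, A x * A (F^[l+1] x) ∂P ≤ (m + 3 * K / (1-θ)) * σ := by
    intro N
    rcases le_total N m with h | h
    · calc _ ≤ ∑ l ∈ Finset.range N, σ := Finset.sum_le_sum fun l _ => c1 _
        _ = N * σ := by simp
        _ ≤ (m + 3 * K / (1-θ)) * σ := by
          refine mul_le_mul_of_nonneg_right ?_ hσ0
          have : (N:ℝ) ≤ m := by exact_mod_cast h
          have : 0 ≤ 3 * K / (1-θ) := by positivity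
          linarith
    · obtain ⟨n, rfl⟩ := Nat.exists_eq_add_of_le h
      rw [Finset.sum_range_add]
      have h1 : ∑ l ∈ Finset.range m, ∫ x, A x * A (F^[l+1] x) ∂P ≤ m * σ := by
        calc _ ≤ ∑ l ∈ Finset.range m, σ := Finset.sum_le_sum fun l _ => c1 _
          _ = m * σ := by simp
      have h2 : ∑ l ∈ Finset.range n, ∫ x, A x * A (F^[m+l+1] x) ∂P ≤ 3 * K / (1-θ) * σ := by
        calc _ ≤ ∑ l ∈ Finset.range n, 3 * K * σ * θ^l := Finset.sum_le_sum fun l _ => by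
              refine (c2 (l+1)).trans ?_
              have : θ^(l+1) ≤ θ^l := pow_le_pow_of_le_one hθ0.le hθ1.le (by omega)
              have : 3 * K * σ * θ^(l+1) ≤ 3 * K * σ * θ^l := mul_le_mul_of_nonneg_left this (by positivity)
              linarith
          _ ≤ 3 * K * σ * (1/(1-θ)) := by
              rw [← Finset.mul_sum]
              exact mul_le_mul_of_nonneg_left (geom_le hθ0 hθ1 n) (by positivity)
          _ = _ := by ring
      linarith
  induction k with
  | zero =>
    have : bsum F A 0 = fun _ => 0 := by ext x; simp [bsum]
    rw [this]; simp
  | succ k ih =>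
    obtain ⟨i1, i2⟩ := ih
    have e : bsum F A (k+1) = fun x => A x + bsum F A k (F x) := by ext x; exact bsum_succ A k x
    have i3 : MemLp (fun x => bsum F A k (F x)) 2 P := i1.comp_measurePreserving hF
    rw [e]
    refine ⟨hA2.add i3, ?_⟩
    have e2 : ∀ x, (A x + bsum F A k (F x))^2 = A x ^ 2 + 2 * (A x * bsum F A k (F x)) + (bsum F A k (F x))^2 := fun x => by ring
    simp only [e2]
    have hp : Integrable (fun x => A x * bsum F A k (F x)) P := hA2.integrable_mul i3
    have hs12 : Integrable (fun x => A x^2 + 2*(A x * bsum F A k (F x))) P := hsq.add (hp.const_mul 2)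
    rw [integral_add hs12 i3.integrable_sq, integral_add hsq (hp.const_mul 2), integral_const_mul]
    have e3 : ∫ x, (bsum F A k (F x))^2 ∂P = ∫ x, bsum F A k x ^ 2 ∂P := int_comp hF ((bsum_meas hF.measurable A hAm k).pow_const 2)
    have e4 : ∫ x, A x * bsum F A k (F x) ∂P = ∑ l ∈ Finset.range k, ∫ x, A x * A (F^[l+1] x) ∂P := by
      rw [← integral_finsetSum _ fun l _ => ?_]
      · congr 1; ext x; simp only [bsum, Finset.mul_sum]; rfl
      · exact hA2.integrable_mul (hit (l+1))
    rw [e3, e4]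
    have := csum k
    push_cast
    nlinarith
end prob
end LSVproof

open MeasureTheory Set NNReal Filter
namespace LSVproof
set_option linter.unusedSectionVars false
set_option linter.unusedVariables false
set_option linter.style.haveILetI false
open scoped ENNReal

section prob
variable {Ω : Type*} [MeasurableSpace Ω] {F : Ω → Ω} {R : Ω → ℕ}

lemma Dep.mono {β : Type*} {A : Ω → β} {m n : ℕ} (h : Dep F R m A) (hmn : m ≤ n) : Dep F R n A :=
  fun x y hxy => h x y fun i hi => hxy i (lt_of_lt_of_le hi hmn)

lemma Dep.R1 : Dep F R 1 R := fun x y hxy => hxy 0 (by norm_num)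

variable {P : Measure Ω} [IsProbabilityMeasure P]

lemma cheb (f : Ω → ℝ) (hf : MemLp f 2 P) (y : ℝ) (hy : 0 < y) (V : ℝ) (hV : ∫ x, f x ^ 2 ∂P ≤ V) :
    P.real {x | y ≤ |f x|} ≤ V / y ^ 2 := by
  have h := mul_meas_ge_le_integral_of_nonneg (μ := P) (f := fun x => f x ^ 2) (Eventually.of_forall fun x => sq_nonneg _) hf.integrable_sq (y^2)
  have e : {x | y^2 ≤ f x ^ 2} = {x | y ≤ |f x|} := by
    ext x
    simp only [Set.mem_ofPred_eq]
    rw [← sq_abs (f x)]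
    exact pow_le_pow_iff_left₀ hy.le (abs_nonneg _) (by norm_num)
  rw [e] at h
  rw [le_div_iff₀ (by positivity)]
  linarith

lemma markov (f : Ω → ℝ) (hf : Integrable f P) (y : ℝ) (hy : 0 < y) (V : ℝ) (hV : ∫ x, |f x| ∂P ≤ V) :
    P.real {x | y ≤ |f x|} ≤ V / y := by
  have h := mul_meas_ge_le_integral_of_nonneg (μ := P) (f := fun x => |f x|) (Eventually.of_forall fun x => abs_nonneg _) hf.abs y
  rw [le_div_iff₀ (by positivity)]
  linarith

lemma bsum_sub_const (A : Ω → ℝ) (c : ℝ) (k : ℕ) (x : Ω) : bsum F (fun x => A x - c) k x = bsum F A k x - k * c := by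
  simp [bsum, Finset.sum_sub_distrib]

variable (hF : MeasurePreserving F P P) (hR : Measurable R)
  {K θ : ℝ} (hK : 0 ≤ K) (hθ0 : 0 < θ) (hθ1 : θ < 1)
  (hmix : ∀ (m : ℕ) (c : ℕ → ℕ) (j : ℕ) (B : Set Ω), MeasurableSet B →
      |P.real (acyl F R m c ∩ F^[m+j] ⁻¹' B) - P.real (acyl F R m c) * P.real B|
        ≤ K * θ ^ j * (P.real (acyl F R m c) * P.real B))

section
include hF hR hK hθ0 hmix hθ1
lemma var_gen (m : ℕ) (A : Ω → ℝ) (hA : Dep F R m A) (hA2 : MemLp A 2 P) (k : ℕ) :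
    MemLp (fun x => bsum F A k x - k * ∫ x, A x ∂P) 2 P ∧
    ∫ x, (bsum F A k x - k * ∫ x, A x ∂P) ^ 2 ∂P ≤ k * (1 + 2 * (m + 3 * K / (1-θ))) * ∫ x, A x ^ 2 ∂P := by
  set e := ∫ x, A x ∂P with he
  have hAi : Integrable A P := hA2.integrable (by norm_num)
  have hB2 : MemLp (fun x => A x - e) 2 P := hA2.sub (memLp_const e)
  have h := var_zero hF hR hK hθ0 hθ1 hmix m (fun x => A x - e) (fun x y hxy => by show A x - e = A y - e; rw [hA x y hxy])
    hB2 (by rw [integral_sub hAi (integrable_const _)]; simp [he]) k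
  have e1 : bsum F (fun x => A x - e) k = fun x => bsum F A k x - k * e := by ext x; exact bsum_sub_const A e k x
  rw [e1] at h
  refine ⟨h.1, h.2.trans ?_⟩
  refine mul_le_mul_of_nonneg_left ?_ (by have : 0 < 1 - θ := by linarith
                                          positivity)
  have hv := ProbabilityTheory.variance_eq_sub hA2
  rw [ProbabilityTheory.variance_eq_integral hA2.aemeasurable] at hv
  simp only [Pi.pow_apply] at hv
  rw [← he] at hv
  rw [hv]; nlinarith [sq_nonneg e]

lemma union_k (S : Set Ω) (hS : MeasurableSet S) (k : ℕ) : P.real {x | ∃ i < k, F^[i] x ∈ S} ≤ k * P.real S := by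
  have e : {x | ∃ i < k, F^[i] x ∈ S} = ⋃ i ∈ Finset.range k, F^[i] ⁻¹' S := by ext x; simp
  rw [e]
  refine (measureReal_biUnion_finset_le _ _).trans ?_
  have : ∀ i ∈ Finset.range k, P.real (F^[i] ⁻¹' S) = P.real S := fun i _ => by
    rw [measureReal_def, (hF.iterate i).measure_preimage hS.nullMeasurableSet]; rfl
  rw [Finset.sum_congr rfl this]; simp

set_option maxHeartbeats 2000000 in
lemma gen_tail (α C0 s C : ℝ) (hα : 0 < α) (hs : α/2 < s) (hsα : s < α) (hC0 : 0 ≤ C0) (hC : 0 ≤ C)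
    (htail : ∀ y > 0, P.real {x | y < (R x : ℝ)} ≤ C0 * y ^ (-α)) :
    ∃ C' > 0, ∀ (m : ℕ) (A : Ω → ℝ), 1 ≤ m → Dep F R m A → (∀ x, |A x| ≤ C * (R x:ℝ)^s) → Integrable A P ∧ ∀ (k : ℕ) (y : ℝ), 0 < y →
      P.real {x | y < |bsum F A k x - k * ∫ x, A x ∂P|} ≤ C' * k * (m+1) * y^(-(α/s)) := by
  have hs0 : 0 < s := by linarith
  have hθ' : 0 < 1 - θ := by linarith
  set c := 3 * K / (1-θ) with hc
  have hc0 : 0 ≤ c := by positivity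
  set D1 := C * (α * C0 / (α - s)) with hD1
  set D2 := C^2 * (2 * s * C0 / (2 * s - α)) with hD2
  have hαs : 0 < α - s := by linarith
  have hαs2 : 0 < 2 * s - α := by linarith
  have hD10 : 0 ≤ D1 := by positivity
  have hD20 : 0 ≤ D2 := by positivity
  have hRm : Measurable (fun x => (R x : ℝ)) := measurable_from_nat.comp hR
  refine ⟨1 + 2 * D1 + C0 + 4 * D2 * (2 + 2 * c), by positivity, fun m A hm hA hAC => ?_⟩
  have hAm : Measurable A := hA.meas hF.measurable hR
  -- integrability of R^s tails
  have high : ∀ M > 0, Integrable (fun x => if (R x:ℝ) ≤ M then 0 else (R x:ℝ)^s) P ∧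
      ∫ x, (if (R x:ℝ) ≤ M then 0 else (R x:ℝ)^s) ∂P ≤ α * C0 / (α - s) * M ^ (s - α) := fun M hM => by
    have h := moment_high (P := P) (fun x => (R x:ℝ)) hRm (fun x => Nat.cast_nonneg _) α C0 s M hC0 hs0 hsα hM htail
    have hm : Measurable (fun x => if (R x:ℝ) ≤ M then 0 else (R x:ℝ)^s) :=
      Measurable.ite (measurableSet_le hRm measurable_const) measurable_const (hRm.pow_const s)
    have hn : ∀ x, 0 ≤ (if (R x:ℝ) ≤ M then 0 else (R x:ℝ)^s) := fun x => by split_ifs <;> positivity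
    have hi : Integrable (fun x => if (R x:ℝ) ≤ M then 0 else (R x:ℝ)^s) P :=
      (lintegral_ofReal_ne_top_iff_integrable hm.aestronglyMeasurable (Eventually.of_forall hn)).1 (ne_top_of_le_ne_top ENNReal.ofReal_ne_top h)
    refine ⟨hi, ?_⟩
    rw [← ofReal_integral_eq_lintegral_ofReal hi (Eventually.of_forall hn)] at h
    exact (ENNReal.ofReal_le_ofReal_iff (by positivity)).1 h
  have low : ∀ M > 0, ∫ x, (if (R x:ℝ) ≤ M then (R x:ℝ)^(2*s) else 0) ∂P ≤ 2 * s * C0 / (2 * s - α) * M ^ (2 * s - α) := fun M hM => by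
    have h := moment_low (P := P) (fun x => (R x:ℝ)) hRm (fun x => Nat.cast_nonneg _) α C0 (2*s) M hC0 hα (by linarith) hM htail
    have hm : Measurable (fun x => if (R x:ℝ) ≤ M then (R x:ℝ)^(2*s) else 0) :=
      Measurable.ite (measurableSet_le hRm measurable_const) (hRm.pow_const _) measurable_const
    have hn : ∀ x, 0 ≤ (if (R x:ℝ) ≤ M then (R x:ℝ)^(2*s) else 0) := fun x => by split_ifs <;> positivity
    have hi : Integrable (fun x => if (R x:ℝ) ≤ M then (R x:ℝ)^(2*s) else 0) P :=
      (lintegral_ofReal_ne_top_iff_integrable hm.aestronglyMeasurable (Eventually.of_forall hn)).1 (ne_top_of_le_ne_top ENNReal.ofReal_ne_top h)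
    rw [← ofReal_integral_eq_lintegral_ofReal hi (Eventually.of_forall hn)] at h
    exact (ENNReal.ofReal_le_ofReal_iff (by positivity)).1 h
  -- truncation
  have trunc : ∀ M > 0, ∃ A' : Ω → ℝ, Dep F R m A' ∧ (∀ x, (R x:ℝ) ≤ M → A' x = A x) ∧ MemLp A' 2 P ∧ Integrable A P ∧
      |∫ x, A x ∂P - ∫ x, A' x ∂P| ≤ D1 * M^(s-α) ∧ ∫ x, A' x ^ 2 ∂P ≤ D2 * M^(2*s-α) := fun M hM => by
    set A' : Ω → ℝ := fun x => if (R x:ℝ) ≤ M then A x else 0 with hA'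
    have hm' : Measurable A' := Measurable.ite (measurableSet_le hRm measurable_const) hAm measurable_const
    have b1 : ∀ x, |A' x| ≤ C * M^s := fun x => by
      simp only [hA']
      split_ifs with h
      · exact (hAC x).trans (mul_le_mul_of_nonneg_left (Real.rpow_le_rpow (Nat.cast_nonneg _) h hs0.le) hC)
      · simp; positivity
    have hL : MemLp A' 2 P := MemLp.of_bound hm'.aestronglyMeasurable (C * M^s) (Eventually.of_forall b1)
    have hA'i : Integrable A' P := hL.integrable (by norm_num)
    have b2 : ∀ x, |A x - A' x| ≤ C * (if (R x:ℝ) ≤ M then 0 else (R x:ℝ)^s) := fun x => by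
      simp only [hA']
      split_ifs with h
      · simp
      · simpa using hAC x
    have hdi : Integrable (fun x => A x - A' x) P := Integrable.mono' ((high M hM).1.const_mul C) (hAm.sub hm').aestronglyMeasurable (Eventually.of_forall b2)
    have hAi : Integrable A P := by
      have := hdi.add hA'i
      refine this.congr (Eventually.of_forall fun x => ?_)
      simp
    refine ⟨A', ?_, fun x hx => by simp [hA', hx], hL, hAi, ?_, ?_⟩
    · intro x y hxy
      have h1 := hxy 0 (by omega)
      simp only [Function.iterate_zero, id] at h1
      simp only [hA', h1, hA x y hxy]
    · rw [← integral_sub hAi hA'i]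
      refine (abs_integral_le_integral_abs).trans ?_
      refine (integral_mono hdi.abs ((high M hM).1.const_mul C) b2).trans ?_
      rw [integral_const_mul]
      calc _ ≤ C * (α * C0 / (α - s) * M ^ (s - α)) := mul_le_mul_of_nonneg_left (high M hM).2 hC
        _ = _ := by rw [hD1]; ring
    · have b3 : ∀ x, A' x ^ 2 ≤ C^2 * (if (R x:ℝ) ≤ M then (R x:ℝ)^(2*s) else 0) := fun x => by
        simp only [hA']
        split_ifs with h
        · have : (R x:ℝ)^(2*s) = ((R x:ℝ)^s)^2 := by rw [mul_comm, Real.rpow_mul (Nat.cast_nonneg _)]; norm_num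
          rw [this, ← mul_pow, ← sq_abs]
          exact pow_le_pow_left₀ (abs_nonneg _) (hAC x) 2
        · simp
      have hm2 : Measurable (fun x => if (R x:ℝ) ≤ M then (R x:ℝ)^(2*s) else 0) :=
        Measurable.ite (measurableSet_le hRm measurable_const) (hRm.pow_const _) measurable_const
      have hi2 : Integrable (fun x => if (R x:ℝ) ≤ M then (R x:ℝ)^(2*s) else 0) P :=
        Integrable.of_bound hm2.aestronglyMeasurable (M^(2*s)) (Eventually.of_forall fun x => by
          simp only [Real.norm_eq_abs]
          split_ifs with h
          · rw [abs_of_nonneg (by positivity)]; exact Real.rpow_le_rpow (Nat.cast_nonneg _) h (by linarith)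
          · simp; positivity)
      refine (integral_mono hL.integrable_sq (hi2.const_mul (C^2)) b3).trans ?_
      rw [integral_const_mul]
      calc _ ≤ C^2 * (2 * s * C0 / (2 * s - α) * M ^ (2 * s - α)) := mul_le_mul_of_nonneg_left (low M hM) (by positivity)
        _ = _ := by rw [hD2]; ring
  refine ⟨(trunc 1 one_pos).choose_spec.2.2.2.1, fun k y hy => ?_⟩
  set M := y^(1/s) with hM
  have hM0 : 0 < M := by positivity
  obtain ⟨A', t1, t2, t3, t4, t5, t6⟩ := trunc M hM0
  have m1 : M^(s-α) = y * y^(-(α/s)) := by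
    rw [hM, ← Real.rpow_mul hy.le]; nth_rw 2 [← Real.rpow_one y]; rw [← Real.rpow_add hy]; congr 1; field_simp; ring
  have m2 : M^(2*s-α) = y^2 * y^(-(α/s)) := by
    rw [hM, ← Real.rpow_mul hy.le]; rw [← Real.rpow_natCast y 2, ← Real.rpow_add hy]; congr 1; field_simp; push_cast; ring
  have m3 : M^(-α) = y^(-(α/s)) := by
    rw [hM, ← Real.rpow_mul hy.le]; congr 1; field_simp
  rw [m1] at t5; rw [m2] at t6
  set Y := y^(-(α/s)) with hY
  have hY0 : 0 < Y := by positivity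
  have hm1 : (1:ℝ) ≤ m := by exact_mod_cast hm
  rcases le_or_gt ((k:ℝ) * D1 * Y) (1/2) with h | h
  · have hsub : {x | y < |bsum F A k x - k * ∫ x, A x ∂P|} ⊆ {x | ∃ i < k, F^[i] x ∈ {x | M < (R x:ℝ)}} ∪
        {x | y/2 ≤ |bsum F A' k x - k * ∫ x, A' x ∂P|} := by
      intro x hx
      by_cases hx2 : ∃ i < k, F^[i] x ∈ {x | M < (R x:ℝ)}
      · exact Or.inl hx2
      · right
        push Not at hx2
        have e : bsum F A k x = bsum F A' k x := Finset.sum_congr rfl fun i hi => by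
          have := hx2 i (Finset.mem_range.1 hi)
          simp only [Set.mem_ofPred_eq, not_lt] at this
          exact (t2 _ this).symm
        simp only [Set.mem_ofPred_eq] at hx ⊢
        rw [e] at hx
        have h1 : (k:ℝ) * |∫ x, A x ∂P - ∫ x, A' x ∂P| ≤ y/2 := by
          calc _ ≤ (k:ℝ) * (D1 * (y * Y)) := mul_le_mul_of_nonneg_left t5 (Nat.cast_nonneg _)
            _ = y * (k * D1 * Y) := by ring
            _ ≤ y * (1/2) := mul_le_mul_of_nonneg_left h hy.le
            _ = y/2 := by ring
        have h2 : |bsum F A' k x - k * ∫ x, A x ∂P| ≤ |bsum F A' k x - k * ∫ x, A' x ∂P| + (k:ℝ) * |∫ x, A x ∂P - ∫ x, A' x ∂P| := by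
          rw [← abs_of_nonneg (Nat.cast_nonneg k : (0:ℝ) ≤ k), ← abs_mul, abs_of_nonneg (Nat.cast_nonneg k : (0:ℝ) ≤ k)]
          have : bsum F A' k x - k * ∫ x, A x ∂P = (bsum F A' k x - k * ∫ x, A' x ∂P) - (k:ℝ) * (∫ x, A x ∂P - ∫ x, A' x ∂P) := by ring
          rw [this]; exact abs_sub _ _
        linarith
    refine (measureReal_mono hsub).trans ((measureReal_union_le _ _).trans ?_)
    have p1 := union_k hF hR hK hθ0 hθ1 hmix {x | M < (R x:ℝ)} (measurableSet_lt measurable_const hRm) k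
    have p2 := htail M hM0
    rw [m3] at p2
    obtain ⟨v1, v2⟩ := var_gen hF hR hK hθ0 hθ1 hmix m A' t1 t3 k
    have p3 := cheb _ v1 (y/2) (by positivity) (k * (1 + 2 * (m + c)) * (D2 * (y^2 * Y)))
      (v2.trans (mul_le_mul_of_nonneg_left t6 (by positivity)))
    have p4 : k * (1 + 2 * (m + c)) * (D2 * (y^2 * Y)) / (y/2)^2 = 4 * D2 * (1 + 2 * (m + c)) * (k * Y) := by
      field_simp; ring
    rw [p4] at p3
    have p5 : (k:ℝ) * P.real {x | M < (R x:ℝ)} ≤ k * (C0 * Y) := mul_le_mul_of_nonneg_left p2 (Nat.cast_nonneg _)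
    have hkY : 0 ≤ (k:ℝ) * Y := by positivity
    have q1 : 1 + 2 * ((m:ℝ) + c) ≤ (2 + 2 * c) * (m+1) := by nlinarith
    have q2 : 4 * D2 * (1 + 2 * (m + c)) * (k * Y) ≤ 4 * D2 * ((2 + 2 * c) * (m+1)) * (k * Y) := by gcongr
    have q3 : (k:ℝ) * (C0 * Y) ≤ C0 * (m+1) * (k*Y) := by nlinarith [mul_nonneg hC0 hkY]
    have q4 : 0 ≤ (1 + 2 * D1) * (m+1) * (k * Y) := by positivity
    have : (1 + 2 * D1 + C0 + 4 * D2 * (2 + 2 * c)) * k * (m+1) * Y = (1 + 2 * D1) * (m+1) * (k * Y) + C0 * (m+1) * (k*Y) + 4 * D2 * ((2 + 2 * c) * (m+1)) * (k * Y) := by ring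
    linarith
  · refine (measureReal_le_one).trans ?_
    have hkY : 0 ≤ (k:ℝ) * Y := by positivity
    have q1 : 1 ≤ 2 * D1 * (m+1) * (k*Y) := by nlinarith [mul_nonneg hD10 hkY]
    have q4 : 0 ≤ (1 + C0 + 4 * D2 * (2 + 2 * c)) * (m+1) * (k * Y) := by positivity
    have : (1 + 2 * D1 + C0 + 4 * D2 * (2 + 2 * c)) * k * (m+1) * Y = (1 + C0 + 4 * D2 * (2 + 2 * c)) * (m+1) * (k * Y) + 2 * D1 * (m+1) * (k*Y) := by ring
    linarith
end
end prob
end LSVproof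

open MeasureTheory Set NNReal Filter
namespace LSVproof
set_option linter.unusedSectionVars false
set_option linter.unusedVariables false
set_option linter.style.haveILetI false
open scoped ENNReal

section prob
variable {Ω : Type*} [MeasurableSpace Ω] {F : Ω → Ω} {R : Ω → ℕ}

/-- products along `F` -/
def bprod (F : Ω → Ω) (X : Ω → ℂ) (k : ℕ) (x : Ω) : ℂ := ∏ i ∈ Finset.range k, X (F^[i] x)

lemma bprod_succ (X : Ω → ℂ) (k : ℕ) (x : Ω) : bprod F X (k+1) x = X x * bprod F X k (F x) := by
  simp only [bprod]; rw [Finset.prod_range_succ']; simp [mul_comm]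

lemma bprod_meas (hF : Measurable F) (X : Ω → ℂ) (hX : Measurable X) (k : ℕ) : Measurable (bprod F X k) :=
  Finset.measurable_prod _ fun i _ => hX.comp (hF.iterate i)

lemma bprod_norm (X : Ω → ℂ) (hX : ∀ x, ‖X x‖ ≤ 1) (k : ℕ) (x : Ω) : ‖bprod F X k x‖ ≤ 1 := by
  simp only [bprod, norm_prod]
  exact Finset.prod_le_one (fun i _ => norm_nonneg _) fun i _ => hX _

variable {P : Measure Ω} [IsProbabilityMeasure P]

lemma int_compC {G : Ω → Ω} (hG : MeasurePreserving G P P) {f : Ω → ℂ} (hf : Measurable f) :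
    ∫ x, f (G x) ∂P = ∫ x, f x ∂P := by
  have := integral_map (μ := P) hG.measurable.aemeasurable (f := f) hf.aestronglyMeasurable
  rw [hG.map_eq] at this
  exact this.symm

variable (hF : MeasurePreserving F P P) (hR : Measurable R)
  {K θ : ℝ} (hK : 0 ≤ K) (hθ0 : 0 < θ) (hθ1 : θ < 1)
  (hmix : ∀ (m : ℕ) (c : ℕ → ℕ) (j : ℕ) (B : Set Ω), MeasurableSet B →
      |P.real (acyl F R m c ∩ F^[m+j] ⁻¹' B) - P.real (acyl F R m c) * P.real B|
        ≤ K * θ ^ j * (P.real (acyl F R m c) * P.real B))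
include hF hR hK hθ0 hmix

lemma tel0 (X : Ω → ℂ) (hX : Dep F R 1 X) (hX1 : ∀ x, ‖X x‖ ≤ 1) (A : Ω → ℂ) (hA : Dep F R 1 A) (hAi : Integrable A P) (k : ℕ) : ∀ j,
    ‖∫ x, A x * bprod F X k (F^[1+j] x) ∂P - (∫ x, A x ∂P) * ∫ x, bprod F X k x ∂P‖ ≤
      (∑ i ∈ Finset.range k, 3 * (K * θ^(j+i))) * ((∫ x, ‖A x‖ ∂P) * ∫ x, ‖X x - 1‖ ∂P) := by
  have hXm : Measurable X := hX.meas hF.measurable hR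
  have hAm : Measurable A := hA.meas hF.measurable hR
  have hbi : ∀ k, Integrable (bprod F X k) P := fun k =>
    Integrable.of_bound (bprod_meas hF.measurable X hXm k).aestronglyMeasurable 1 (Eventually.of_forall (bprod_norm X hX1 k))
  have hX1i : Integrable (fun x => X x - 1) P := Integrable.of_bound (hXm.sub_const 1).aestronglyMeasurable 2
    (Eventually.of_forall fun x => (norm_sub_le _ _).trans (by have := hX1 x; simp; linarith))
  induction k with
  | zero => intro j; simp [bprod]
  | succ k ih =>
    intro j
    set B : Ω → ℂ := fun x => (X x - 1) * bprod F X k (F x) with hB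
    have hBm : Measurable B := (hXm.sub_const 1).mul ((bprod_meas hF.measurable X hXm k).comp hF.measurable)
    have hBb : ∀ x, ‖B x‖ ≤ ‖X x - 1‖ := fun x => by
      simp only [hB, norm_mul]
      exact mul_le_of_le_one_right (norm_nonneg _) (bprod_norm X hX1 k _)
    have hBi : Integrable B P := hX1i.norm.mono' hBm.aestronglyMeasurable (Eventually.of_forall hBb)
    have e : ∀ y, bprod F X (k+1) y = bprod F X k (F y) + B y := fun y => by
      rw [bprod_succ]; simp only [hB]; ring
    obtain ⟨m1, m2⟩ := MIX hF hR hK hθ0 hmix 1 j A B hA hAi hBi hBm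
    have h1 := ih (j+1)
    have e2 : ∫ x, bprod F X (k+1) x ∂P = ∫ x, bprod F X k x ∂P + ∫ x, B x ∂P := by
      simp only [e]
      have : Integrable (fun x => bprod F X k (F x)) P := (hF.integrable_comp (hbi k).aestronglyMeasurable).2 (hbi k)
      rw [integral_add this hBi, int_compC hF (bprod_meas hF.measurable X hXm k)]
    have hi2 : Integrable (fun x => A x * bprod F X k (F^[1+(j+1)] x)) P := by
      refine hAi.norm.mono' (hAm.mul ((bprod_meas hF.measurable X hXm k).comp (hF.measurable.iterate _))).aestronglyMeasurable (Eventually.of_forall fun x => ?_)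
      rw [norm_mul]
      exact mul_le_of_le_one_right (norm_nonneg _) (bprod_norm X hX1 k _)
    have e3 : ∫ x, A x * bprod F X (k+1) (F^[1+j] x) ∂P = ∫ x, A x * bprod F X k (F^[1+(j+1)] x) ∂P + ∫ x, A x * B (F^[1+j] x) ∂P := by
      rw [← integral_add hi2 m1]
      congr 1; ext x
      rw [e, mul_add, ← Function.iterate_succ_apply' F (1+j) x]
      rfl
    rw [e2, e3, Finset.sum_range_succ', add_mul]
    have e4 : ∀ a b c u v : ℂ, a + b - c * (u + v) = (a - c * u) + (b - c * v) := fun a b c u v => by ring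
    rw [e4]
    refine (norm_add_le _ _).trans (add_le_add ?_ (m2.trans ?_))
    · refine h1.trans (le_of_eq ?_)
      congr 1
      refine Finset.sum_congr rfl fun i _ => ?_
      rw [show j + 1 + i = j + (i+1) by ring]
    · have : ∫ x, ‖B x‖ ∂P ≤ ∫ x, ‖X x - 1‖ ∂P := integral_mono hBi.norm hX1i.norm hBb
      have h0 : 0 ≤ ∫ x, ‖A x‖ ∂P := integral_nonneg fun x => norm_nonneg _
      rw [add_zero]
      gcongr

include hθ1
lemma tel (X : Ω → ℂ) (hX : Dep F R 1 X) (hX1 : ∀ x, ‖X x‖ ≤ 1) (A : Ω → ℂ) (hA : Dep F R 1 A) (hAi : Integrable A P) (k : ℕ) :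
    ‖∫ x, A x * bprod F X k (F x) ∂P - (∫ x, A x ∂P) * ∫ x, bprod F X k x ∂P‖ ≤
      (3 * K / (1-θ)) * ((∫ x, ‖A x‖ ∂P) * ∫ x, ‖X x - 1‖ ∂P) := by
  have h := tel0 hF hR hK hθ0 hmix X hX hX1 A hA hAi k 0
  simp only [add_zero, zero_add, Function.iterate_one] at h
  refine h.trans (mul_le_mul_of_nonneg_right ?_ ?_)
  · have := geom_le hθ0 hθ1 k
    calc _ = 3 * K * ∑ i ∈ Finset.range k, θ^i := by rw [Finset.mul_sum]; exact Finset.sum_congr rfl fun i _ => by ring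
      _ ≤ 3 * K * (1/(1-θ)) := mul_le_mul_of_nonneg_left this (by positivity)
      _ = _ := by ring
  · exact mul_nonneg (integral_nonneg fun x => norm_nonneg _) (integral_nonneg fun x => norm_nonneg _)

lemma tel_pow (X : Ω → ℂ) (hX : Dep F R 1 X) (hX1 : ∀ x, ‖X x‖ ≤ 1) (k : ℕ) :
    ‖∫ x, bprod F X k x ∂P - (∫ x, X x ∂P)^k‖ ≤ k * ((3 * K / (1-θ)) * (∫ x, ‖X x - 1‖ ∂P)^2) := by
  have hXm : Measurable X := hX.meas hF.measurable hR
  have hXi : Integrable X P := Integrable.of_bound hXm.aestronglyMeasurable 1 (Eventually.of_forall hX1)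
  have hX1i : Integrable (fun x => X x - 1) P := hXi.sub (integrable_const 1)
  have hρ : ‖∫ x, X x ∂P‖ ≤ 1 := by
    refine (norm_integral_le_integral_norm _).trans ?_
    refine (integral_mono hXi.norm (integrable_const 1) hX1).trans ?_
    simp
  set ρ := ∫ x, X x ∂P with hρd
  have hbi : ∀ k, Integrable (bprod F X k) P := fun k =>
    Integrable.of_bound (bprod_meas hF.measurable X hXm k).aestronglyMeasurable 1 (Eventually.of_forall (bprod_norm X hX1 k))
  induction k with
  | zero => simp [bprod]
  | succ k ih =>
    have h := tel hF hR hK hθ0 hθ1 hmix X hX hX1 (fun x => X x - 1) (fun x y hxy => congrArg (· - 1) (hX x y hxy)) hX1i k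
    have hc : Integrable (fun x => bprod F X k (F x)) P := (hF.integrable_comp (hbi k).aestronglyMeasurable).2 (hbi k)
    have e : ∫ x, (X x - 1) * bprod F X k (F x) ∂P = ∫ x, bprod F X (k+1) x ∂P - ∫ x, bprod F X k x ∂P := by
      rw [← int_compC hF (bprod_meas hF.measurable X hXm k), ← integral_sub (hbi _) hc]
      congr 1; ext x; rw [bprod_succ]; ring
    have e2 : ∫ x, (X x - 1) ∂P = ρ - 1 := by
      rw [integral_sub hXi (integrable_const 1)]; simp [hρd]
    rw [e, e2] at h
    have e3 : ∫ x, bprod F X (k+1) x ∂P - ρ^(k+1) = (∫ x, bprod F X (k+1) x ∂P - ∫ x, bprod F X k x ∂P - (ρ - 1) * ∫ x, bprod F X k x ∂P)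
      + ρ * (∫ x, bprod F X k x ∂P - ρ^k) := by ring
    rw [e3]
    refine (norm_add_le _ _).trans ?_
    rw [norm_mul]
    have h3 : ‖ρ‖ * ‖∫ x, bprod F X k x ∂P - ρ^k‖ ≤ ‖∫ x, bprod F X k x ∂P - ρ^k‖ := mul_le_of_le_one_left (norm_nonneg _) hρ
    push_cast
    nlinarith

/-- The characteristic function limit. -/
lemma CF (hRintg : Integrable (fun ω => (R ω : ℝ)) P)
    (α c r : ℝ) (h1 : 1 < α) (h2 : α < 2) (hc : 0 < c) (hr : r = ∫ ω, (R ω : ℝ) ∂P)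
    (htail : Tendsto (fun n : ℕ => P.real {ω | n < R ω} * (n:ℝ) ^ α) atTop (nhds c)) :
    ∃ ψ : ℂ, ψ ≠ 0 ∧ ∀ (t κ : ℝ) (k : ℕ → ℕ), 0 < t → 0 < κ → Tendsto (fun n => (k n : ℝ) / n) atTop (nhds κ) →
      Tendsto (fun n : ℕ => ∫ x, (R x : ℂ) * Complex.exp (Complex.I * ((t * (n:ℝ)^(-(1/α))) * bsum F (fun x => (R x:ℝ) - r) (k n) (F x) : ℝ)) ∂P) atTop
        (nhds (r * Complex.exp (κ * (t^α : ℝ) * ψ))) := by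
  obtain ⟨ψ, hψ, hlim⟩ := char_R P R hR hRintg α c r h1 h2 hc hr htail
  refine ⟨ψ, hψ, fun t κ k ht hκ hk => ?_⟩
  have hRm : Measurable (fun x => (R x : ℝ)) := measurable_from_nat.comp hR
  set L := 3 * K / (1-θ) with hL
  have hL0 : 0 ≤ L := by have : 0 < 1 - θ := by linarith
                         positivity
  set tn : ℕ → ℝ := fun n => t * (n:ℝ)^(-(1/α)) with htn
  set X : ℕ → Ω → ℂ := fun n x => Complex.exp (Complex.I * (tn n * ((R x:ℝ) - r) : ℝ)) with hX
  have hX1 : ∀ n x, ‖X n x‖ ≤ 1 := fun n x => by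
    simp only [hX]; rw [mul_comm, Complex.norm_exp_ofReal_mul_I]
  have hXd : ∀ n, Dep F R 1 (X n) := fun n x y hxy => by
    have := hxy 0 (by norm_num)
    simp only [Function.iterate_zero, id] at this
    simp only [hX, this]
  have hXm : ∀ n, Measurable (X n) := fun n => (hXd n).meas hF.measurable hR
  have hXi : ∀ n, Integrable (X n) P := fun n => Integrable.of_bound (hXm n).aestronglyMeasurable 1 (Eventually.of_forall (hX1 n))
  set D := ∫ x, |(R x:ℝ) - r| ∂P with hD
  have hDi : Integrable (fun x => |(R x:ℝ) - r|) P := (hRintg.sub (integrable_const r)).abs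
  have hD0 : 0 ≤ D := integral_nonneg fun x => abs_nonneg _
  have htn0 : ∀ n, 0 ≤ tn n := fun n => by positivity
  have hδ : ∀ n, ∫ x, ‖X n x - 1‖ ∂P ≤ tn n * D := fun n => by
    rw [hD, ← integral_const_mul]
    refine integral_mono ((hXi n).sub (integrable_const 1)).norm (hDi.const_mul _) fun x => ?_
    have := (exp_sub_one_norm (tn n * ((R x:ℝ) - r))).trans (min_le_right _ _)
    rw [abs_mul, abs_of_nonneg (htn0 n)] at this
    exact this
  have hδ0 : ∀ n, 0 ≤ ∫ x, ‖X n x - 1‖ ∂P := fun n => integral_nonneg fun x => norm_nonneg _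
  have hprod : ∀ n x, Complex.exp (Complex.I * (tn n * bsum F (fun x => (R x:ℝ) - r) (k n) (F x) : ℝ)) = bprod F (X n) (k n) (F x) := fun n x => by
    simp only [bprod, hX, bsum]
    rw [← Complex.exp_sum]
    congr 1
    push_cast
    rw [Finset.mul_sum, Finset.mul_sum]
  have hα0 : 0 < α := by linarith
  have htend0 : Tendsto tn atTop (nhds 0) := by
    have : Tendsto (fun n : ℕ => (n:ℝ)^(-(1/α))) atTop (nhds 0) := (tendsto_rpow_neg_atTop (y := 1/α) (by positivity)).comp tendsto_natCast_atTop_atTop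
    have h3 := this.const_mul t
    rw [mul_zero] at h3; exact h3
  have htpos : ∀ n, 1 ≤ n → 0 < tn n := fun n hn => by
    have : (0:ℝ) < n := by exact_mod_cast hn
    positivity
  have hkinf : Tendsto k atTop atTop := by
    have : Tendsto (fun n => (k n : ℝ) / n * n) atTop atTop := hk.pos_mul_atTop hκ tendsto_natCast_atTop_atTop
    have h2 : Tendsto (fun n => (k n : ℝ)) atTop atTop := this.congr' (by
      filter_upwards [eventually_ge_atTop 1] with n hn
      have : (n:ℝ) ≠ 0 := by positivity
      field_simp)
    exact tendsto_natCast_atTop_iff.1 h2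
  -- ρ limit
  have hρ : Tendsto (fun n => ((∫ x, X n x ∂P) - 1) / (((tn n)^α : ℝ):ℂ)) atTop (nhds ψ) := by
    refine hlim.comp (tendsto_nhdsWithin_iff.2 ⟨htend0, ?_⟩)
    filter_upwards [eventually_ge_atTop 1] with n hn using htpos n hn
  have htα : ∀ n, 1 ≤ n → (tn n)^α = t^α / n := fun n hn => by
    have hn' : (0:ℝ) < n := by exact_mod_cast hn
    simp only [htn]
    rw [Real.mul_rpow ht.le (by positivity), ← Real.rpow_mul hn'.le]
    rw [show -(1/α)*α = -1 by field_simp, Real.rpow_neg_one]; rfl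
  have hLim : Tendsto (fun n => (k n : ℂ) * ((∫ x, X n x ∂P) - 1)) atTop (nhds (κ * (t^α : ℝ) * ψ)) := by
    have hkC : Tendsto (fun n => (((k n : ℝ) / n * t^α : ℝ) : ℂ)) atTop (nhds ((κ * t^α : ℝ) : ℂ)) :=
      (Complex.continuous_ofReal.tendsto _).comp (hk.mul_const _)
    have := hkC.mul hρ
    push_cast at this ⊢
    refine this.congr' ?_
    filter_upwards [eventually_ge_atTop 1] with n hn
    have hn' : (n:ℂ) ≠ 0 := by exact_mod_cast (by omega : n ≠ 0)
    have ht' : ((t^α : ℝ):ℂ) ≠ 0 := by exact_mod_cast (Real.rpow_pos_of_pos ht α).ne'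
    rw [htα n hn]
    push_cast
    field_simp
  have hpow := pow_limit (fun n => ∫ x, X n x ∂P) k _ (fun n => by
    refine (norm_integral_le_integral_norm _).trans ?_
    refine (integral_mono (hXi n).norm (integrable_const 1) (hX1 n)).trans ?_
    simp) hkinf hLim
  -- u limit
  have herr : Tendsto (fun n => (k n:ℝ) * (L * (tn n * D)^2)) atTop (nhds 0) := by
    have e : Tendsto (fun n : ℕ => (n:ℝ)^(-(2/α-1))) atTop (nhds 0) :=
      (tendsto_rpow_neg_atTop (y := 2/α-1) (by rw [sub_pos, lt_div_iff₀ hα0]; linarith)).comp tendsto_natCast_atTop_atTop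
    have := (hk.mul e).const_mul (L * D^2 * t^2)
    rw [mul_zero, mul_zero] at this
    refine this.congr' ?_
    filter_upwards [eventually_ge_atTop 1] with n hn
    have hn' : (0:ℝ) < n := by exact_mod_cast hn
    have : (n:ℝ)^(-(2/α-1)) = n * ((n:ℝ)^(-(1/α)))^2 := by
      rw [← Real.rpow_natCast, ← Real.rpow_mul hn'.le]; nth_rw 2 [← Real.rpow_one (n:ℝ)]; rw [← Real.rpow_add hn']; congr 1; push_cast; ring
    rw [this]; simp only [htn]; field_simp
  have hu : Tendsto (fun n => ∫ x, bprod F (X n) (k n) x ∂P) atTop (nhds (Complex.exp (κ * (t^α : ℝ) * ψ))) := by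
    have : Tendsto (fun n => ∫ x, bprod F (X n) (k n) x ∂P - (∫ x, X n x ∂P)^(k n)) atTop (nhds 0) := by
      refine squeeze_zero_norm (fun n => ?_) herr
      refine (tel_pow hF hR hK hθ0 hθ1 hmix (X n) (hXd n) (hX1 n) (k n)).trans ?_
      have := pow_le_pow_left₀ (hδ0 n) (hδ n) 2
      exact mul_le_mul_of_nonneg_left (mul_le_mul_of_nonneg_left this hL0) (Nat.cast_nonneg _)
    have := this.add hpow
    simpa using this
  have hRr : ∫ x, (R x:ℂ) ∂P = r := by
    rw [hr, ← integral_complex_ofReal]; simp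
  have hfin : Tendsto (fun n => ∫ x, (R x:ℂ) * bprod F (X n) (k n) (F x) ∂P - r * ∫ x, bprod F (X n) (k n) x ∂P) atTop (nhds 0) := by
    refine squeeze_zero_norm (a := fun n => L * (r * (tn n * D))) (fun n => ?_) ?_
    · have := tel hF hR hK hθ0 hθ1 hmix (X n) (hXd n) (hX1 n) (fun x => (R x:ℂ)) (fun x y hxy => congrArg _ (Dep.R1 x y hxy)) (by
        have := hRintg.ofReal (𝕜 := ℂ); simpa using this) (k n)
      rw [hRr] at this
      refine this.trans ?_
      have e : ∫ x, ‖(R x:ℂ)‖ ∂P = r := by rw [hr]; simp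
      rw [e]
      have hr0 : 0 ≤ r := by rw [hr]; exact integral_nonneg fun x => Nat.cast_nonneg _
      exact mul_le_mul_of_nonneg_left (mul_le_mul_of_nonneg_left (hδ n) hr0) hL0
    · have := ((htend0.mul_const D).const_mul r).const_mul L
      simpa using this
  have := hfin.add (hu.const_mul (r:ℂ))
  simp only [sub_add_cancel, zero_add] at this
  refine this.congr fun n => ?_
  congr 1; ext x; rw [← hprod]
end prob
end LSVproof

open MeasureTheory Set NNReal Filter
namespace LSVproof
set_option linter.unusedSectionVars false
set_option linter.unusedVariables false
set_option linter.style.haveILetI false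
open scoped ENNReal

/-- preimages of 1 under the left branch -/
noncomputable def aseq (z : ℝ) : ℕ → ℝ
  | 0 => 1
  | n+1 => Function.invFunOn (gl z) (Icc 0 (1/2)) (aseq z n)

section
variable {z : ℝ} (hz : z ∈ Ioo (0:ℝ) 1)
include hz

lemma aseq_step {n : ℕ} (h : aseq z n ∈ Ioc (0:ℝ) 1) : aseq z (n+1) ∈ Ioc (0:ℝ) (1/2) ∧ gl z (aseq z (n+1)) = aseq z n := by
  have hex : ∃ y ∈ Icc (0:ℝ) (1/2), gl z y = aseq z n := by
    have := intermediate_value_Icc (by norm_num : (0:ℝ) ≤ 1/2) (gl_cont hz).continuousOn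
    rw [gl_zero hz, gl_half hz] at this
    exact this ⟨h.1.le, h.2⟩
  have h1 : aseq z (n+1) ∈ Icc (0:ℝ) (1/2) := Function.invFunOn_mem hex
  have h2 : gl z (aseq z (n+1)) = aseq z n := Function.invFunOn_eq hex
  refine ⟨⟨lt_of_le_of_ne h1.1 fun h0 => ?_, h1.2⟩, h2⟩
  rw [← h0, gl_zero hz] at h2
  exact h.1.ne h2

lemma aseq_mem (n : ℕ) : aseq z n ∈ Ioc (0:ℝ) 1 := by
  induction n with
  | zero => simp [aseq]
  | succ n ih => have := (aseq_step hz ih).1; exact ⟨this.1, this.2.trans (by norm_num)⟩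

lemma aseq_gl (n : ℕ) : gl z (aseq z (n+1)) = aseq z n := (aseq_step hz (aseq_mem hz n)).2
lemma aseq_half (n : ℕ) : aseq z (n+1) ≤ 1/2 := (aseq_step hz (aseq_mem hz n)).1.2
lemma aseq_anti : Antitone (aseq z) := antitone_nat_of_succ_le fun n => by
  rw [← aseq_gl hz n]; exact gl_ge hz (aseq_mem hz _).1.le

lemma aseq_iff (n : ℕ) : ∀ y ∈ Ico (0:ℝ) 1, (∀ i < n, (lsv z)^[i] y < 1/2) ↔ y < aseq z n := by
  induction n with
  | zero => intro y hy; simp [aseq, hy.2]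
  | succ n ih =>
    intro y hy
    have key : y < 1/2 → ((∀ i < n, (lsv z)^[i] (lsv z y) < 1/2) ↔ y < aseq z (n+1)) := fun hy2 => by
      rw [lsv_left hy2]
      have hlt : gl z y < 1 := by
        rw [← gl_half hz]; exact gl_strictMono hz hy.1 (by norm_num) hy2
      rw [ih _ ⟨hy.1.trans (gl_ge hz hy.1), hlt⟩, ← aseq_gl hz n]
      exact (gl_strictMono hz).lt_iff_lt hy.1 (aseq_mem hz _).1.le
    constructor
    · intro h
      have h0 : y < 1/2 := h 0 (by omega)
      exact (key h0).1 fun i hi => by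
        have := h (i+1) (by omega)
        rwa [Function.iterate_succ_apply] at this
    · intro h i hi
      have h0 : y < 1/2 := h.trans_le (aseq_half hz n)
      rcases i with _ | i
      · exact h0
      · rw [Function.iterate_succ_apply]
        exact (key h0).2 h i (by omega)

lemma lt_RR_iff {x : ℝ} (hx : x ∈ Ioo (1/2:ℝ) 1) (n : ℕ) : n < RR z x ↔ 2 * x - 1 < aseq z n := by
  rw [RR, lt_ret_iff (exists_return' hz hx), ← aseq_iff hz n (2*x-1) ⟨by linarith [hx.1], by linarith [hx.2]⟩, ← lsv_right (z := z) hx.1.le]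
  constructor
  · intro h i hi
    have := h (i+1) (by omega) (by omega)
    rw [Function.iterate_succ_apply] at this
    simpa using this
  · intro h j h1 h2
    obtain ⟨i, rfl⟩ : ∃ i, j = i+1 := ⟨j-1, by omega⟩
    have := h i (by omega)
    rw [Function.iterate_succ_apply]
    simpa using this

lemma aseq_tendsto : Tendsto (aseq z) atTop (nhds 0) := by
  have hb : BddBelow (range (aseq z)) := ⟨0, by rintro _ ⟨n, rfl⟩; exact (aseq_mem hz n).1.le⟩
  have h1 := tendsto_atTop_ciInf (aseq_anti hz) hb
  set L := ⨅ n, aseq z n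
  have hL0 : 0 ≤ L := ge_of_tendsto' h1 fun n => (aseq_mem hz n).1.le
  have h2 : Tendsto (fun n => gl z (aseq z (n+1))) atTop (nhds (gl z L)) :=
    ((gl_cont hz).tendsto L).comp (h1.comp (tendsto_add_atTop_nat 1))
  have h3 : gl z L = L := by
    refine tendsto_nhds_unique h2 ?_
    simp only [aseq_gl hz]; exact h1
  have h4 : L = 0 := by
    by_contra hne
    have hpos : 0 < L := lt_of_le_of_ne hL0 (Ne.symm hne)
    have : 0 < L * (2^z * L^z) := by positivity
    unfold gl at h3
    linarith [h3]
  rwa [h4] at h1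

lemma aseq_asymp : ∃ A > 0, Tendsto (fun n : ℕ => aseq z n * (n:ℝ)^(1/z)) atTop (nhds A) := by
  have hz0 := hz.1
  set b : ℕ → ℝ := fun n => (aseq z n)^(-z) with hb
  set w : ℕ → ℝ := fun n => (aseq z (n+1))^z with hw
  have hw0 : ∀ n, 0 < w n := fun n => Real.rpow_pos_of_pos (aseq_mem hz _).1 _
  have hwt : Tendsto w atTop (nhds 0) := by
    have := ((aseq_tendsto hz).comp (tendsto_add_atTop_nat 1)).rpow_const (p := z) (Or.inr hz0.le)
    rw [Real.zero_rpow hz0.ne'] at this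
    exact this
  have hder : HasDerivAt (fun w : ℝ => (1 + 2^z * w)^(-z)) (-(z * 2^z)) 0 := by
    have h1 : HasDerivAt (fun w : ℝ => 1 + 2^z * w) (2^z) 0 := by
      simpa using ((hasDerivAt_id (0:ℝ)).const_mul (2^z)).const_add 1
    have := h1.rpow_const (p := -z) (Or.inl (by simp))
    convert this using 1
    simp; ring
  have hdiff : ∀ n, b (n+1) - b n = -(((1 + 2^z * w n)^(-z) - 1) / w n) := fun n => by
    have hp := (aseq_mem hz (n+1)).1
    simp only [hb, hw]
    rw [← aseq_gl hz n, gl, Real.mul_rpow hp.le (by positivity), Real.rpow_neg hp.le]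
    have : (aseq z (n+1))^z ≠ 0 := (hw0 n).ne'
    field_simp; ring
  have hlim : Tendsto (fun n => b (n+1) - b n) atTop (nhds (z * 2^z)) := by
    have := hder.tendsto_slope_zero
    have h2 := this.comp (tendsto_nhdsWithin_iff.2 ⟨hwt, Eventually.of_forall fun n => (hw0 n).ne'⟩)
    have h3 := h2.neg
    rw [neg_neg] at h3
    refine h3.congr fun n => ?_
    rw [hdiff]
    simp [div_eq_inv_mul]
  have hces := hlim.cesaro
  have hbn : Tendsto (fun n : ℕ => b n / n) atTop (nhds (z * 2^z)) := by
    have h1 : Tendsto (fun n : ℕ => (n:ℝ)⁻¹ * 1) atTop (nhds (0 * 1)) := (tendsto_inv_atTop_nhds_zero_nat).mul_const 1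
    have := hces.add h1
    rw [zero_mul, add_zero] at this
    refine this.congr fun n => ?_
    rw [Finset.sum_range_sub]
    have : b 0 = 1 := by simp [hb, aseq]
    rw [this]; ring
  have hA : 0 < z * 2^z := by positivity
  refine ⟨(z * 2^z)^(-(1/z)), by positivity, ?_⟩
  have := hbn.rpow_const (p := -(1/z)) (Or.inl hA.ne')
  refine this.congr' ?_
  filter_upwards [eventually_ge_atTop 1] with n hn
  have hn' : (0:ℝ) < n := by exact_mod_cast hn
  have hp := (aseq_mem hz n).1
  simp only [hb]
  rw [Real.div_rpow (by positivity) hn'.le, ← Real.rpow_mul hp.le, Real.rpow_neg hn'.le]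
  rw [show -z * -(1/z) = 1 by field_simp, Real.rpow_one]
  field_simp

lemma aseq_le : ∃ C > 0, ∀ n : ℕ, 1 ≤ n → aseq z n ≤ C * (n:ℝ)^(-(1/z)) := by
  obtain ⟨A, hA, h⟩ := aseq_asymp hz
  obtain ⟨C, hC⟩ := h.bddAbove_range
  refine ⟨max C 1, by positivity, fun n hn => ?_⟩
  have hn' : (0:ℝ) < n := by exact_mod_cast hn
  rw [Real.rpow_neg hn'.le, ← div_eq_mul_inv, le_div_iff₀ (by positivity)]
  exact (hC ⟨n, rfl⟩).trans (le_max_left _ _)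

lemma cone_edge {P : Measure ℝ} [IsProbabilityMeasure P] (h : Cone (1/2) (1+z) P) :
    ∃ H > 0, Tendsto (fun s => P.real (Ioo (1/2) (1/2+s)) / s) (nhdsWithin 0 (Ioi 0)) (nhds H) := by
  obtain ⟨g, hg, hP, ha, hw⟩ := h
  have hκ : 0 ≤ 1 + z := by linarith [hz.1]
  have hb := cone_bounds hκ g ha hw 1 (by rw [← hP]; simp)
  set G : ℝ → ℝ := fun x => (g x).toReal with hG
  set C0 : ℝ := 2^(1+z+1) with hC0
  have hfin : ∀ x ∈ Ioo (1/2:ℝ) 1, g x ≠ ⊤ := fun x hx => ne_top_of_le_ne_top (by simp) (hb x hx).1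
  have hGle : ∀ x ∈ Ioo (1/2:ℝ) 1, G x ≤ C0 := fun x hx => by
    have := (hb x hx).1
    rw [mul_one] at this
    exact ENNReal.toReal_le_of_le_ofReal (by positivity) this
  have hGpos : ∀ x ∈ Ioo (1/2:ℝ) 1, 0 < G x := fun x hx => by
    refine ENNReal.toReal_pos ?_ (hfin x hx)
    have := (hb x hx).2
    rw [mul_one] at this
    refine (lt_of_lt_of_le ?_ this).ne'
    exact ENNReal.ofReal_pos.2 (by positivity)
  have hbdd : BddAbove (G '' Ioo (1/2) 1) := ⟨C0, by rintro _ ⟨x, hx, rfl⟩; exact hGle x hx⟩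
  set H := sSup (G '' Ioo (1/2) 1) with hH
  have hGH : ∀ x ∈ Ioo (1/2:ℝ) 1, G x ≤ H := fun x hx => le_csSup hbdd ⟨x, hx, rfl⟩
  have h34 : (3/4:ℝ) ∈ Ioo (1/2:ℝ) 1 := by constructor <;> norm_num
  refine ⟨H, (hGpos _ h34).trans_le (hGH _ h34), ?_⟩
  have hmeas : ∀ s, 0 < s → s < 1/2 → P (Ioo (1/2) (1/2+s)) = ∫⁻ x in Ioo (1/2) (1/2+s), g x := fun s h1 h2 => by
    rw [hP, withDensity_apply _ measurableSet_Ioo, Measure.restrict_restrict measurableSet_Ioo]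
    congr 2
    exact inter_eq_left.2 (Ioo_subset_Ioo le_rfl (by linarith))
  have up : ∀ s, 0 < s → s < 1/2 → P.real (Ioo (1/2) (1/2+s)) ≤ H * s := fun s h1 h2 => by
    have : P (Ioo (1/2) (1/2+s)) ≤ ENNReal.ofReal (H * s) := by
      rw [hmeas s h1 h2]
      calc _ ≤ ∫⁻ x in Ioo (1/2) (1/2+s), ENNReal.ofReal H := setLIntegral_mono measurable_const fun x hx => by
            have hx' : x ∈ Ioo (1/2:ℝ) 1 := ⟨hx.1, by linarith [hx.2]⟩
            rw [← ENNReal.ofReal_toReal (hfin x hx')]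
            exact ENNReal.ofReal_le_ofReal (hGH x hx')
        _ = _ := by
          rw [setLIntegral_const, Real.volume_Ioo, ← ENNReal.ofReal_mul ((hGpos _ h34).le.trans (hGH _ h34))]; congr 2; ring
    exact ENNReal.toReal_le_of_le_ofReal (mul_nonneg ((hGpos _ h34).le.trans (hGH _ h34)) h1.le) this
  have dn : ∀ s, 0 < s → s < 1/2 → G (1/2+s) * s ≤ P.real (Ioo (1/2) (1/2+s)) := fun s h1 h2 => by
    have hs' : 1/2+s ∈ Ioo (1/2:ℝ) 1 := ⟨by linarith, by linarith⟩
    have : ENNReal.ofReal (G (1/2+s) * s) ≤ P (Ioo (1/2) (1/2+s)) := by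
      rw [hmeas s h1 h2]
      calc _ = ∫⁻ x in Ioo (1/2) (1/2+s), g (1/2+s) := by
            rw [setLIntegral_const, Real.volume_Ioo, ENNReal.ofReal_mul (hGpos _ hs').le, ENNReal.ofReal_toReal (hfin _ hs')]; congr 2; ring
        _ ≤ _ := setLIntegral_mono hg fun x hx => ha ⟨hx.1, by linarith [hx.2]⟩ hs' hx.2.le
    exact (ENNReal.ofReal_le_iff_le_toReal (measure_ne_top _ _)).1 this
  refine tendsto_order.2 ⟨fun a hlt => ?_, fun a hlt => ?_⟩
  · obtain ⟨_, ⟨x, hx, rfl⟩, hax⟩ := exists_lt_of_lt_csSup ⟨_, mem_image_of_mem G h34⟩ hlt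
    filter_upwards [Ioo_mem_nhdsGT (show (0:ℝ) < x - 1/2 by linarith [hx.1])] with s hs
    have hs2 : s < 1/2 := by linarith [hs.2, hx.2]
    rw [lt_div_iff₀ hs.1]
    have hs' : 1/2+s ∈ Ioo (1/2:ℝ) 1 := ⟨by linarith [hs.1], by linarith⟩
    have : G x ≤ G (1/2+s) := ENNReal.toReal_mono (hfin _ hs') (ha hs' hx (by linarith [hs.2]))
    have := dn s hs.1 hs2
    nlinarith [hs.1]
  · filter_upwards [Ioo_mem_nhdsGT (show (0:ℝ) < 1/2 by norm_num)] with s hs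
    rw [div_lt_iff₀ hs.1]
    have := up s hs.1 hs.2
    nlinarith [hs.1]

lemma tail_RR {P : Measure ℝ} [IsProbabilityMeasure P] (h : Cone (1/2) (1+z) P) :
    ∃ c > 0, Tendsto (fun n : ℕ => P.real {x | n < RR z x} * (n:ℝ)^(1/z)) atTop (nhds c) := by
  obtain ⟨H, hH, hlim⟩ := cone_edge hz h
  obtain ⟨A, hA, hAl⟩ := aseq_asymp hz
  refine ⟨H * (A/2), by positivity, ?_⟩
  have h1 : Tendsto (fun n => aseq z n / 2) atTop (nhdsWithin 0 (Ioi 0)) := by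
    refine tendsto_nhdsWithin_iff.2 ⟨?_, Eventually.of_forall fun n => by have := (aseq_mem hz n).1; show 0 < aseq z n / 2; linarith⟩
    have := (aseq_tendsto hz).div_const 2
    simpa using this
  have h2 := (hlim.comp h1).mul (hAl.div_const 2)
  refine h2.congr fun n => ?_
  have hp := (aseq_mem hz n).1
  have e : P.real {x | n < RR z x} = P.real (Ioo (1/2) (1/2 + aseq z n / 2)) := by
    rw [measureReal_def, measureReal_def]
    congr 1
    have hs : P (Ioo (1/2) 1)ᶜ = 0 := cone_supp hz h _ disjoint_compl_left measurableSet_Ioo.compl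
    have hae : ∀ᵐ x ∂P, x ∈ Ioo (1/2:ℝ) 1 := by rw [ae_iff]; exact hs
    refine measure_congr ?_
    filter_upwards [hae] with x hx
    apply propext
    show n < RR z x ↔ x ∈ Ioo (1/2) (1/2 + aseq z n / 2)
    rw [lt_RR_iff hz hx]
    constructor
    · intro h; exact ⟨hx.1, by linarith⟩
    · intro h; linarith [h.2]
  simp only [Function.comp]
  rw [e]
  field_simp
end
end LSVproof

open MeasureTheory Set NNReal Filter
namespace LSVproof
set_option linter.unusedSectionVars false
set_option linter.unusedVariables false
set_option linter.style.haveILetI false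
open scoped ENNReal

section prob
variable {Ω : Type*} [MeasurableSpace Ω] {F : Ω → Ω} {R : Ω → ℕ}
variable {P : Measure Ω} [IsProbabilityMeasure P]
variable (hF : MeasurePreserving F P P) (hR : Measurable R)
  {K θ : ℝ} (hK : 0 ≤ K) (hθ0 : 0 < θ) (hθ1 : θ < 1)
  (hmix : ∀ (m : ℕ) (c : ℕ → ℕ) (j : ℕ) (B : Set Ω), MeasurableSet B →
      |P.real (acyl F R m c ∩ F^[m+j] ⁻¹' B) - P.real (acyl F R m c) * P.real B|
        ≤ K * θ ^ j * (P.real (acyl F R m c) * P.real B))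
  {α C0 r : ℝ} (hα1 : 1 < α) (hα2 : α < 2) (hC0 : 0 ≤ C0)
  (htail : ∀ y > 0, P.real {x | y < (R x : ℝ)} ≤ C0 * y ^ (-α))
  (hRintg : Integrable (fun x => (R x:ℝ)) P) (hr : r = ∫ x, (R x:ℝ) ∂P) (hR1 : ∀ᵐ x ∂P, 1 ≤ R x)

section R
include hF hR hK hθ0 hθ1 hmix hα1 hα2 hC0 htail hRintg hr hR1
lemma r_ge : 1 ≤ r := by
  rw [hr]
  have : ∫ x, (1:ℝ) ∂P ≤ ∫ x, (R x:ℝ) ∂P := integral_mono_ae (integrable_const 1) hRintg (by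
    filter_upwards [hR1] with x hx
    exact_mod_cast hx)
  simpa using this

lemma R_tail : ∃ C > 0, ∀ (k : ℕ) (y : ℝ), 0 < y → P.real {x | y < |bsum F (fun x => (R x:ℝ)) k x - k * r|} ≤ C * k * y^(-α) := by
  obtain ⟨C', hC', h⟩ := gen_tail hF hR hK hθ0 hθ1 hmix α C0 1 1 (by linarith) (by linarith) hα1 hC0 zero_le_one htail
  obtain ⟨h1, h2⟩ := h 1 (fun x => (R x:ℝ)) le_rfl (fun x y hxy => congrArg _ (Dep.R1 x y hxy)) (fun x => by simp)
  refine ⟨C' * 2, by positivity, fun k y hy => ?_⟩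
  have := h2 k y hy
  rw [← hr, div_one] at this
  refine this.trans (le_of_eq ?_)
  push_cast; ring
end R

variable {W : Ω → ℝ} (hWm : Measurable W) (hWi : Integrable W P) (hW0 : ∫ x, W x ∂P = 0) {s C D η : ℝ}
  (hs : α/2 < s) (hs1 : s < 1) (hC : 0 ≤ C) (hD : 0 ≤ D) (hη0 : 0 < η) (hη1 : η < 1)
  (hW : ∀ m : ℕ, 1 ≤ m → ∃ Wm : Ω → ℝ, Dep F R m Wm ∧ (∀ x, |Wm x| ≤ C * (R x:ℝ)^s) ∧ ∀ᵐ x ∂P, |W x - Wm x| ≤ D * η^m * R x)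
section W
include hF hR hK hθ0 hθ1 hmix hα1 hα2 hC0 htail hRintg hr hR1 hWm hWi hW0 hs hs1 hC hD hη0 hη1 hW

lemma W_tail : ∃ C1 > 0, ∀ (m k : ℕ) (y : ℝ), 1 ≤ m → 0 < y →
    P.real {x | y < |bsum F W k x|} ≤ C1 * k * (m+1) * (y/2)^(-(α/s)) + 4 * (k * (D * η^m * r)) / y := by
  obtain ⟨C', hC', h⟩ := gen_tail hF hR hK hθ0 hθ1 hmix α C0 s C (by linarith) hs (by linarith) hC0 hC htail
  refine ⟨C', hC', fun m k y hm hy => ?_⟩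
  obtain ⟨Wm, w1, w2, w3⟩ := hW m hm
  obtain ⟨hWmi, ht⟩ := h m Wm hm w1 w2
  have hr1 := r_ge hF hR hK hθ0 hθ1 hmix hα1 hα2 hC0 htail hRintg hr hR1
  have hWmm : Measurable Wm := w1.meas hF.measurable hR
  set q := D * η^m * r with hq
  have hq0 : 0 ≤ q := by positivity
  have hdi : Integrable (fun x => W x - Wm x) P := hWi.sub hWmi
  have hdint : ∫ x, |W x - Wm x| ∂P ≤ q := by
    refine (integral_mono_ae hdi.abs (hRintg.const_mul (D * η^m)) w3).trans ?_
    rw [integral_const_mul, ← hr]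
  have hE : |∫ x, Wm x ∂P| ≤ q := by
    have : ∫ x, (W x - Wm x) ∂P = - ∫ x, Wm x ∂P := by rw [integral_sub hWi hWmi, hW0]; ring
    rw [← abs_neg, ← this]
    exact (abs_integral_le_integral_abs).trans hdint
  rcases le_or_gt ((k:ℝ) * q) (y/4) with hle | hgt
  · have hsub : {x | y < |bsum F W k x|} ⊆ {x | y/2 < |bsum F Wm k x - k * ∫ x, Wm x ∂P|} ∪ {x | y/4 ≤ |bsum F (fun x => |W x - Wm x|) k x|} := by
      intro x hx
      by_contra hcon
      simp only [Set.mem_union, Set.mem_ofPred_eq, not_or, not_lt, not_le] at hcon hx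
      obtain ⟨c1, c2⟩ := hcon
      have e1 : |bsum F W k x - bsum F Wm k x| ≤ |bsum F (fun x => |W x - Wm x|) k x| := by
        refine le_trans ?_ (le_abs_self _)
        simp only [bsum, ← Finset.sum_sub_distrib]
        exact Finset.abs_sum_le_sum_abs _ _
      have e2 : |(k:ℝ) * ∫ x, Wm x ∂P| ≤ y/4 := by
        rw [abs_mul, abs_of_nonneg (Nat.cast_nonneg k : (0:ℝ) ≤ k)]
        exact (mul_le_mul_of_nonneg_left hE (Nat.cast_nonneg _)).trans hle
      have := abs_le.1 e1
      have := abs_le.1 e2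
      have := abs_le.1 c1
      have h5 : |bsum F W k x| ≤ y := by
        rw [abs_le]; constructor <;> linarith
      linarith
    refine (measureReal_mono hsub).trans ((measureReal_union_le _ _).trans (add_le_add (ht k (y/2) (by positivity)) ?_))
    have hbi : ∀ i, Integrable (fun x => |W (F^[i] x) - Wm (F^[i] x)|) P := fun i =>
      ((hF.iterate i).integrable_comp hdi.abs.aestronglyMeasurable).2 hdi.abs
    have hbint : Integrable (bsum F (fun x => |W x - Wm x|) k) P := integrable_finsetSum _ fun i _ => hbi i
    have hm := markov (bsum F (fun x => |W x - Wm x|) k) hbint (y/4) (by positivity) (k * q) (by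
      have e : ∀ x, |bsum F (fun x => |W x - Wm x|) k x| = bsum F (fun x => |W x - Wm x|) k x := fun x =>
        abs_of_nonneg (Finset.sum_nonneg fun i _ => abs_nonneg _)
      simp only [e]
      unfold bsum
      rw [integral_finsetSum _ fun i _ => hbi i]
      have : ∀ i ∈ Finset.range k, ∫ x, |W (F^[i] x) - Wm (F^[i] x)| ∂P ≤ q := fun i _ => by
        have := int_comp (hF.iterate i) (f := fun x => |W x - Wm x|) (hWm.sub hWmm).abs
        rw [this]; exact hdint
      refine (Finset.sum_le_sum this).trans ?_
      simp)
    refine hm.trans (le_of_eq ?_)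
    field_simp
  · refine measureReal_le_one.trans ?_
    have : 1 ≤ 4 * (k * q) / y := by rw [le_div_iff₀ hy]; linarith
    have : 0 ≤ C' * k * (m+1) * (y/2)^(-(α/s)) := by positivity
    linarith

lemma W_small (δ B ε : ℝ) (hδ : 0 < δ) (hB : 0 < B) (hε : 0 < ε) : ∃ n0 : ℕ, ∀ n : ℕ, n0 ≤ n → ∀ k : ℕ, k ≤ n → ∀ y : ℝ, δ * (n:ℝ)^(1/α) ≤ y → y ≤ B * n →
    P.real {x | y < |bsum F W k x|} ≤ ε * n * y^(-α) := by
  obtain ⟨C1, hC1, h⟩ := W_tail hF hR hK hθ0 hθ1 hmix hα1 hα2 hC0 htail hRintg hr hR1 hWm hWi hW0 hs hs1 hC hD hη0 hη1 hW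
  have hr1 := r_ge hF hR hK hθ0 hθ1 hmix hα1 hα2 hC0 htail hRintg hr hR1
  have hs0 : 0 < s := by linarith
  have hα0 : 0 < α := by linarith
  have hlη : 0 < - Real.log η := by have := Real.log_neg hη0 hη1; linarith
  set A := 2 / (- Real.log η) with hA
  have hA0 : 0 < A := by positivity
  set m : ℕ → ℕ := fun n => ⌈A * Real.log n⌉₊ + 1 with hm
  set β := α * (1/s - 1) with hβ
  have hs1' : 0 < 1/s - 1 := by rw [sub_pos, lt_div_iff₀ hs0]; linarith
  have hβ0 : 0 < β := by positivity
  set γ := 1/s - 1 with hγ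
  -- limits
  have l1 : Tendsto (fun n : ℕ => Real.log n * (n:ℝ)^(-γ)) atTop (nhds 0) := by
    have := (isLittleO_log_rpow_atTop hs1').tendsto_div_nhds_zero.comp tendsto_natCast_atTop_atTop (α := ℕ)
    refine this.congr fun n => ?_
    simp only [Function.comp]
    rw [Real.rpow_neg (Nat.cast_nonneg _)]; rfl
  have l2 : Tendsto (fun n : ℕ => (n:ℝ)^(-γ)) atTop (nhds 0) := (tendsto_rpow_neg_atTop hs1').comp tendsto_natCast_atTop_atTop
  have l3 : Tendsto (fun n : ℕ => (n:ℝ)^(-(3-α))) atTop (nhds 0) := (tendsto_rpow_neg_atTop (by linarith)).comp tendsto_natCast_atTop_atTop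
  have L : Tendsto (fun n : ℕ => C1 * 2^(α/s) * δ^(-β) * (A * (Real.log n * (n:ℝ)^(-γ)) + 3 * (n:ℝ)^(-γ)) + 4 * D * r * B^(α-1) * (n:ℝ)^(-(3-α))) atTop (nhds 0) := by
    have := (((l1.const_mul A).add (l2.const_mul 3)).const_mul (C1 * 2^(α/s) * δ^(-β))).add (l3.const_mul (4 * D * r * B^(α-1)))
    simpa using this
  obtain ⟨n0, hn0⟩ := eventually_atTop.1 (L.eventually (gt_mem_nhds hε))
  refine ⟨max n0 1, fun n hn k hk y hy1 hy2 => ?_⟩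
  have hn1 : 1 ≤ n := (le_max_right _ _).trans hn
  have hnR : (1:ℝ) ≤ n := by exact_mod_cast hn1
  have hnpos : (0:ℝ) < n := by linarith
  have hL := hn0 n ((le_max_left _ _).trans hn)
  have hy : 0 < y := lt_of_lt_of_le (by positivity) hy1
  have hkn : (k:ℝ) ≤ n := by exact_mod_cast hk
  have hlog : 0 ≤ Real.log n := Real.log_nonneg hnR
  refine (h (m n) k y (by simp [hm]) hy).trans ?_
  have hmle : (m n : ℝ) + 1 ≤ A * Real.log n + 3 := by
    simp only [hm]; push_cast
    have := Nat.ceil_lt_add_one (show 0 ≤ A * Real.log n by positivity)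
    linarith
  have hηm : η^(m n) ≤ (n:ℝ)^(-(2:ℝ)) := by
    rw [← Real.rpow_natCast, ← Real.log_le_log_iff (by positivity) (by positivity), Real.log_rpow hη0, Real.log_rpow hnpos]
    have h1 : A * Real.log n ≤ m n := by
      simp only [hm]; push_cast
      have := Nat.le_ceil (A * Real.log n)
      linarith
    have h2 : A * Real.log n * (- Real.log η) = 2 * Real.log n := by
      rw [hA]; have := hlη.ne'; generalize - Real.log η = u at this ⊢; field_simp
    nlinarith
  have hyβ : y^(-β) ≤ δ^(-β) * (n:ℝ)^(-γ) := by
    have : (n:ℝ)^(-γ) = ((n:ℝ)^(1/α))^(-β) := by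
      rw [← Real.rpow_mul hnpos.le]; congr 1; rw [hβ]; field_simp
    rw [this, ← Real.mul_rpow hδ.le (by positivity)]
    exact Real.rpow_le_rpow_of_nonpos (by positivity) hy1 (by linarith)
  have hsplit : (y/2)^(-(α/s)) = 2^(α/s) * (y^(-α) * y^(-β)) := by
    rw [Real.div_rpow hy.le (by norm_num), ← Real.rpow_add hy, Real.rpow_neg (by norm_num : (0:ℝ) ≤ 2)]
    rw [show -(α/s) = -α + -β by rw [hβ, hγ]; field_simp; ring]
    field_simp
  have t1 : C1 * k * (m n+1) * (y/2)^(-(α/s)) ≤ n * y^(-α) * (C1 * 2^(α/s) * δ^(-β) * (A * (Real.log n * (n:ℝ)^(-γ)) + 3 * (n:ℝ)^(-γ))) := by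
    rw [hsplit]
    calc _ ≤ C1 * n * (A * Real.log n + 3) * (2^(α/s) * (y^(-α) * (δ^(-β) * (n:ℝ)^(-γ)))) := by gcongr
      _ = _ := by ring
  have hyy : 1 / y ≤ y^(-α) * (B^(α-1) * (n:ℝ)^(α-1)) := by
    have : 1/y = y^(-α) * y^(α-1) := by rw [← Real.rpow_add hy]; rw [show -α + (α-1) = -1 by ring, Real.rpow_neg_one]; simp
    rw [this, ← Real.mul_rpow hB.le hnpos.le]
    exact mul_le_mul_of_nonneg_left (Real.rpow_le_rpow hy.le hy2 (by linarith)) (by positivity)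
  have t2 : 4 * (k * (D * η^(m n) * r)) / y ≤ n * y^(-α) * (4 * D * r * B^(α-1) * (n:ℝ)^(-(3-α))) := by
    have e : (n:ℝ)^(-(3-α)) = (n:ℝ)^(-(2:ℝ)) * (n:ℝ)^(α-1) := by rw [← Real.rpow_add hnpos]; congr 1; ring
    rw [e, div_eq_mul_one_div]
    calc _ ≤ 4 * (n * (D * (n:ℝ)^(-(2:ℝ)) * r)) * (y^(-α) * (B^(α-1) * (n:ℝ)^(α-1))) := by gcongr
      _ = _ := by ring
  have hny : 0 < n * y^(-α) := by positivity
  calc _ ≤ n * y^(-α) * (C1 * 2^(α/s) * δ^(-β) * (A * (Real.log n * (n:ℝ)^(-γ)) + 3 * (n:ℝ)^(-γ)) + 4 * D * r * B^(α-1) * (n:ℝ)^(-(3-α))) := by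
        refine (add_le_add t1 t2).trans (le_of_eq (by ring))
    _ ≤ n * y^(-α) * ε := mul_le_mul_of_nonneg_left hL.le hny.le
    _ = _ := by ring
end W
end prob
end LSVproof

open MeasureTheory Set NNReal Filter
namespace LSVproof
set_option linter.unusedSectionVars false
set_option linter.unusedVariables false
set_option linter.style.haveILetI false
open scoped ENNReal

section prob
variable {Ω : Type*} [MeasurableSpace Ω] {F : Ω → Ω} {R : Ω → ℕ} {T : Ω → Ω}

/-- time of `k`-th return -/
def tauN (F : Ω → Ω) (R : Ω → ℕ) (k : ℕ) (x : Ω) : ℕ := ∑ i ∈ Finset.range k, R (F^[i] x)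

lemma tauN_cast (k : ℕ) (x : Ω) : (tauN F R k x : ℝ) = bsum F (fun x => (R x:ℝ)) k x := by
  simp [tauN, bsum]

lemma tauN_succ (k : ℕ) (x : Ω) : tauN F R (k+1) x = tauN F R k x + R (F^[k] x) := by
  simp [tauN, Finset.sum_range_succ]

lemma iter_tauN (hFT : ∀ x, F x = T^[R x] x) (k : ℕ) (x : Ω) : F^[k] x = T^[tauN F R k x] x := by
  induction k with
  | zero => simp [tauN]
  | succ k ih => rw [Function.iterate_succ_apply', hFT, tauN_succ, add_comm, Function.iterate_add_apply, ← ih]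

lemma bsum_tauN (hFT : ∀ x, F x = T^[R x] x) (φ : Ω → ℝ) (k : ℕ) (x : Ω) :
    bsum T φ (tauN F R k x) x = bsum F (fun x => bsum T φ (R x) x) k x := by
  induction k with
  | zero => simp [tauN, bsum]
  | succ k ih =>
    rw [tauN_succ, bsum_add, ih, bsum_add, ← iter_tauN hFT]
    congr 1
    simp [bsum]

lemma bsum_bd {φ : Ω → ℝ} {B : ℝ} (hφ : ∀ x, |φ x| ≤ B) (n : ℕ) (x : Ω) : |bsum T φ n x| ≤ B * n := by
  refine (Finset.abs_sum_le_sum_abs _ _).trans ((Finset.sum_le_sum fun i _ => hφ _).trans ?_)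
  simp [mul_comm]

variable {P : Measure Ω} [IsProbabilityMeasure P] (hF : MeasurePreserving F P P)
  (hT : Measurable T) (hFT : ∀ x, F x = T^[R x] x) {φ : Ω → ℝ} (hφm : Measurable φ) {Cφ φ0 : ℝ} (hCφ : 0 < Cφ) (hφ : ∀ x, |φ x| ≤ Cφ) (hφ0 : |φ0| ≤ Cφ)
  {α r : ℝ} (hα1 : 1 < α) (hα2 : α < 2) (hr1 : 1 ≤ r) {W : Ω → ℝ} (hW : ∀ x, W x = bsum T φ (R x) x - φ0 * (R x - r))
  {CR : ℝ} (hCR : 0 < CR) (hRt : ∀ (k : ℕ) (y : ℝ), 0 < y → P.real {x | y < |bsum F (fun x => (R x:ℝ)) k x - k * r|} ≤ CR * k * y^(-α))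
  (hWs : ∀ (δ B ε : ℝ), 0 < δ → 0 < B → 0 < ε → ∃ n0 : ℕ, ∀ n : ℕ, n0 ≤ n → ∀ k : ℕ, k ≤ n → ∀ y : ℝ, δ * (n:ℝ)^(1/α) ≤ y → y ≤ B * n →
    P.real {x | y < |bsum F W k x|} ≤ ε * n * y^(-α))

include hFT hW in
lemma decomp (k n : ℕ) (x : Ω) (h : tauN F R k x ≤ n) :
    bsum T φ n x = bsum F W k x + φ0 * (bsum F (fun x => (R x:ℝ)) k x - k * r) + bsum T φ (n - tauN F R k x) (F^[k] x) := by
  obtain ⟨l, rfl⟩ := Nat.exists_eq_add_of_le h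
  rw [bsum_add, Nat.add_sub_cancel_left, iter_tauN hFT, bsum_tauN hFT]
  congr 1
  have : bsum F W k x = bsum F (fun x => bsum T φ (R x) x - φ0 * (R x - r)) k x := by
    congr 1; ext x; exact hW x
  rw [this]
  simp only [bsum, Finset.sum_sub_distrib, ← Finset.mul_sum]
  simp

include hr1 in
lemma k_props (n : ℕ) (h : ℝ) (h0 : 0 ≤ h) (hn : h ≤ n) : (⌊((n:ℝ)-h)/r⌋₊ : ℝ) * r ≤ n - h ∧ n - h - r < (⌊((n:ℝ)-h)/r⌋₊ : ℝ) * r ∧ ⌊((n:ℝ)-h)/r⌋₊ ≤ n := by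
  have hr0 : 0 < r := by linarith
  have h1 := Nat.floor_le (show 0 ≤ ((n:ℝ)-h)/r from div_nonneg (by linarith) hr0.le)
  have h2 := Nat.lt_floor_add_one (((n:ℝ)-h)/r)
  rw [le_div_iff₀ hr0] at h1
  rw [div_lt_iff₀ hr0] at h2
  refine ⟨h1, by linarith, ?_⟩
  have : (⌊((n:ℝ)-h)/r⌋₊ : ℝ) ≤ n := by nlinarith [Nat.cast_nonneg (α := ℝ) ⌊((n:ℝ)-h)/r⌋₊]
  exact_mod_cast this

/-- On the good event, the last stretch is short. -/
lemma win (k n : ℕ) (x : Ω) (h : ℝ) (hb : |bsum F (fun x => (R x:ℝ)) k x - k * r| ≤ h) (h1 : (k:ℝ) * r ≤ n - h) (h2 : n - h - r < (k:ℝ) * r) :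
    tauN F R k x ≤ n ∧ ((n - tauN F R k x : ℕ) : ℝ) ≤ 2 * h + r := by
  rw [← tauN_cast] at hb
  have := abs_le.1 hb
  have h3 : (tauN F R k x : ℝ) ≤ n := by linarith
  have h4 : tauN F R k x ≤ n := by exact_mod_cast h3
  refine ⟨h4, ?_⟩
  rw [Nat.cast_sub h4]; linarith

include hF hT hFT hφm hCφ hφ hφ0 hα1 hα2 hr1 hW hCR hRt hWs

lemma T_P : ∃ C > 0, ∀ (n : ℕ) (y : ℝ), 0 < y → P.real {x | y < |bsum T φ n x|} ≤ C * n * y^(-α) := by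
  have hα0 : 0 < α := by linarith
  set B := 4 * r * Cφ with hB
  have hB0 : 0 < B := by positivity
  obtain ⟨n0, hn0⟩ := hWs (B/2) Cφ 1 (by positivity) hCφ one_pos
  set C := B^α + CR * (12 * Cφ)^α + 2^α + (Cφ * n0)^α with hC
  have hCn0 : 0 ≤ (Cφ * n0)^α := by positivity
  have hCB : 0 < B^α := by positivity
  have hC12 : 0 < CR * (12 * Cφ)^α := by positivity
  have hC2 : (0:ℝ) < 2^α := by positivity
  refine ⟨C, by positivity, fun n y hy => ?_⟩
  rcases le_or_gt (Cφ * n) y with hbig | hsmall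
  · have : {x | y < |bsum T φ n x|} = ∅ := by
      ext x; simp only [Set.mem_ofPred_eq, mem_empty_iff_false, iff_false, not_lt]
      exact (bsum_bd hφ n x).trans hbig
    rw [this]; simp; positivity
  have hn1 : 1 ≤ n := by
    rcases Nat.eq_zero_or_pos n with h | h
    · subst h; simp at hsmall; linarith
    · exact h
  have hnR : (1:ℝ) ≤ n := by exact_mod_cast hn1
  have triv : ∀ b : ℝ, 0 ≤ b → y ≤ b → 1 ≤ b^α * y^(-α) := fun b hb hyb => by
    rw [Real.rpow_neg hy.le, ← div_eq_mul_inv, le_div_iff₀ (by positivity), one_mul]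
    exact Real.rpow_le_rpow hy.le hyb hα0.le
  have hyα : 0 < y^(-α) := by positivity
  rcases lt_or_ge n n0 with hlt | hge
  · refine measureReal_le_one.trans ?_
    have h1 := triv (Cφ * n0) (by positivity) (hsmall.le.trans (by gcongr))
    have h2 : (Cφ * n0)^α * y^(-α) ≤ C * n * y^(-α) := by
      have : (Cφ * n0)^α ≤ C := by rw [hC]; linarith
      have : (Cφ * n0)^α ≤ C * n := by nlinarith
      gcongr
    linarith
  rcases lt_or_ge y (B * (n:ℝ)^(1/α)) with hlt2 | hge2
  · refine measureReal_le_one.trans ?_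
    have h1 := triv (B * (n:ℝ)^(1/α)) (by positivity) hlt2.le
    have e : (B * (n:ℝ)^(1/α))^α = B^α * n := by
      rw [Real.mul_rpow hB0.le (by positivity), ← Real.rpow_mul (by positivity)]
      rw [one_div_mul_cancel hα0.ne', Real.rpow_one]
    rw [e] at h1
    refine h1.trans ?_
    have : B^α ≤ C := by rw [hC]; linarith
    gcongr
  set h := y / (12 * Cφ) with hh
  have hh0 : 0 < h := by positivity
  have hCh : 12 * Cφ * h = y := by rw [hh]; field_simp
  have hhn : h ≤ n := by
    rw [hh, div_le_iff₀ (by positivity)]; nlinarith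
  set k := ⌊((n:ℝ)-h)/r⌋₊ with hk
  obtain ⟨k1, k2, k3⟩ := k_props hr1 n h hh0.le hhn
  have hyB : B ≤ y := by
    have : (1:ℝ) ≤ (n:ℝ)^(1/α) := Real.one_le_rpow hnR (by positivity)
    nlinarith
  have hsub : {x | y < |bsum T φ n x|} ⊆ {x | h < |bsum F (fun x => (R x:ℝ)) k x - k * r|} ∪ {x | y/2 < |bsum F W k x|} := by
    intro x hx
    by_contra hcon
    simp only [Set.mem_union, Set.mem_ofPred_eq, not_or, not_lt] at hcon hx
    obtain ⟨c1, c2⟩ := hcon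
    obtain ⟨w1, w2⟩ := win k n x h c1 k1 k2
    rw [decomp hFT hW k n x w1] at hx
    have e1 := bsum_bd (T := T) hφ (n - tauN F R k x) (F^[k] x)
    have e2 : |φ0 * (bsum F (fun x => (R x:ℝ)) k x - k * r)| ≤ Cφ * h := by
      rw [abs_mul]; gcongr
    have e3 : Cφ * ((n - tauN F R k x : ℕ) : ℝ) ≤ Cφ * (2 * h + r) := by gcongr
    have := abs_add_three (bsum F W k x) (φ0 * (bsum F (fun x => (R x:ℝ)) k x - k * r)) (bsum T φ (n - tauN F R k x) (F^[k] x))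
    nlinarith
  refine (measureReal_mono hsub).trans ((measureReal_union_le _ _).trans ?_)
  have p1 := hRt k h hh0
  have p2 := hn0 n hge k k3 (y/2) (by linarith) (by linarith)
  have q1 : CR * k * h^(-α) ≤ CR * (12*Cφ)^α * n * y^(-α) := by
    have : h^(-α) = (12*Cφ)^α * y^(-α) := by
      rw [hh, Real.div_rpow hy.le (by positivity), Real.rpow_neg (by positivity : 0 ≤ 12*Cφ)]; field_simp
    rw [this]
    have : (k:ℝ) ≤ n := by exact_mod_cast k3
    calc _ ≤ CR * n * ((12*Cφ)^α * y^(-α)) := by gcongr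
      _ = _ := by ring
  have q2 : (y/2)^(-α) = 2^α * y^(-α) := by
    rw [Real.div_rpow hy.le (by positivity), Real.rpow_neg (by positivity : (0:ℝ) ≤ 2)]; field_simp
  rw [q2] at p2
  have hny : 0 ≤ n * y^(-α) := by positivity
  have : C * n * y^(-α) = (B^α + (Cφ * n0)^α) * (n * y^(-α)) + CR * (12*Cφ)^α * n * y^(-α) + 1 * n * (2^α * y^(-α)) := by rw [hC]; ring
  rw [this]
  have : 0 ≤ (B^α + (Cφ * n0)^α) * (n * y^(-α)) := by positivity
  linarith

lemma MAXb : ∃ C > 0, ∀ (L g : ℕ) (y : ℝ), 1 ≤ g → 0 < y → Cφ * g ≤ y/2 →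
    P.real {x | ∃ j ≤ L, y < |bsum T φ j x|} ≤ ((L:ℝ)/g+1) * (C * L * (y/2)^(-α)) := by
  obtain ⟨C, hC, h⟩ := T_P hF hT hFT hφm hCφ hφ hφ0 hα1 hα2 hr1 hW hCR hRt hWs
  refine ⟨C, hC, fun L g y hg hy hgy => ?_⟩
  have hsub : {x | ∃ j ≤ L, y < |bsum T φ j x|} ⊆ ⋃ i ∈ Finset.range (L/g+1), {x | y/2 < |bsum T φ (i*g) x|} := by
    rintro x ⟨j, hj, hx⟩
    simp only [mem_iUnion, Finset.mem_range]
    refine ⟨j/g, Nat.lt_succ_of_le (Nat.div_le_div_right hj), ?_⟩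
    simp only [Set.mem_ofPred_eq]
    have e : bsum T φ j x = bsum T φ (j/g*g) x + bsum T φ (j%g) (T^[j/g*g] x) := by
      rw [← bsum_add, Nat.div_add_mod']
    have e1 := bsum_bd (T := T) hφ (j%g) (T^[j/g*g] x)
    have e2 : ((j%g : ℕ):ℝ) ≤ g := by exact_mod_cast (Nat.mod_lt j (by omega)).le
    have e3 : Cφ * ((j%g : ℕ):ℝ) ≤ Cφ * g := by gcongr
    have := abs_add_le (bsum T φ (j/g*g) x) (bsum T φ (j%g) (T^[j/g*g] x))
    rw [← e] at this
    linarith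
  refine (measureReal_mono hsub (measure_ne_top _ _)).trans ((measureReal_biUnion_finset_le _ _).trans ?_)
  have hterm : ∀ i ∈ Finset.range (L/g+1), P.real {x | y/2 < |bsum T φ (i*g) x|} ≤ C * L * (y/2)^(-α) := fun i hi => by
    refine (h (i*g) (y/2) (by positivity)).trans ?_
    have : i * g ≤ L := (Nat.mul_le_mul_right g (Nat.lt_succ_iff.1 (Finset.mem_range.1 hi))).trans (Nat.div_mul_le_self L g)
    have : ((i*g : ℕ):ℝ) ≤ L := by exact_mod_cast this
    gcongr
  refine (Finset.sum_le_sum hterm).trans ?_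
  simp only [Finset.sum_const, Finset.card_range, nsmul_eq_mul]
  refine mul_le_mul_of_nonneg_right ?_ (by positivity)
  push_cast
  have := Nat.cast_div_le (α := ℝ) (m := L) (n := g)
  linarith

lemma INPROB : ∃ k : ℕ → ℕ, Tendsto (fun n => (k n:ℝ)/n) atTop (nhds (1/r)) ∧ ∀ δ > 0,
    Tendsto (fun n : ℕ => P.real {x | δ * (n:ℝ)^(1/α) < |bsum T φ n x - φ0 * bsum F (fun x => (R x:ℝ) - r) (k n) x|}) atTop (nhds 0) := by
  obtain ⟨C, hC, hmax⟩ := MAXb hF hT hFT hφm hCφ hφ hφ0 hα1 hα2 hr1 hW hCR hRt hWs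
  have hα0 : 0 < α := by linarith
  have hr0 : 0 < r := by linarith
  set a := 1/α with ha
  have ha1 : a < 1 := by rw [ha, div_lt_one hα0]; exact hα1
  have ha0 : 0 < a := by positivity
  set e := (1-a)/4 with he
  have he0 : 0 < e := by rw [he]; linarith
  set h : ℕ → ℝ := fun n => (n:ℝ)^(a+e) with hh
  set k : ℕ → ℕ := fun n => ⌊((n:ℝ)-h n)/r⌋₊ with hk
  have hhn : ∀ n : ℕ, 1 ≤ n → h n ≤ n := fun n hn => by
    have hnR : (1:ℝ) ≤ n := by exact_mod_cast hn
    calc (n:ℝ)^(a+e) ≤ (n:ℝ)^(1:ℝ) := Real.rpow_le_rpow_of_exponent_le hnR (by rw [he]; linarith)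
      _ = n := Real.rpow_one _
  have hkp : ∀ n : ℕ, 1 ≤ n → (k n:ℝ) * r ≤ n - h n ∧ n - h n - r < (k n:ℝ) * r ∧ k n ≤ n := fun n hn =>
    k_props hr1 n (h n) (by positivity) (hhn n hn)
  refine ⟨k, ?_, fun δ hδ => ?_⟩
  · have l1 : Tendsto (fun n : ℕ => (n:ℝ)^(-(1-a-e))) atTop (nhds 0) := (tendsto_rpow_neg_atTop (by rw [he]; linarith)).comp tendsto_natCast_atTop_atTop
    have l2 : Tendsto (fun n : ℕ => r * ((n:ℝ)⁻¹)) atTop (nhds (r * 0)) := tendsto_inv_atTop_nhds_zero_nat.const_mul r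
    have lo : Tendsto (fun n : ℕ => (1 - (n:ℝ)^(-(1-a-e)) - r * ((n:ℝ)⁻¹)) / r) atTop (nhds (1/r)) := by
      have := (((tendsto_const_nhds (x := (1:ℝ))).sub l1).sub l2).div_const r
      simpa using this
    have hi : Tendsto (fun n : ℕ => (1:ℝ)/r) atTop (nhds (1/r)) := tendsto_const_nhds
    refine tendsto_of_tendsto_of_tendsto_of_le_of_le' lo hi ?_ ?_
    · filter_upwards [eventually_ge_atTop 1] with n hn
      have hn' : (0:ℝ) < n := by exact_mod_cast hn
      have hx : (n:ℝ)^(-(1-a-e)) = h n / n := by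
        simp only [hh]; rw [eq_div_iff hn'.ne']; nth_rw 2 [← Real.rpow_one (n:ℝ)]; rw [← Real.rpow_add hn']; congr 1; ring
      rw [hx, div_le_div_iff₀ hr0 hn']
      have := (hkp n hn).2.1
      have : (1 - h n / n - r * (n:ℝ)⁻¹) * n = n - h n - r := by field_simp
      linarith
    · filter_upwards [eventually_ge_atTop 1] with n hn
      have hn' : (0:ℝ) < n := by exact_mod_cast hn
      rw [div_le_div_iff₀ hn' hr0]
      have := (hkp n hn).1
      have : 0 ≤ h n := by positivity
      linarith
  · refine tendsto_order.2 ⟨fun b hb => Eventually.of_forall fun n => lt_of_lt_of_le hb measureReal_nonneg, fun ε hε => ?_⟩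
    set ε1 := ε/2 * (δ/2)^α with hε1
    obtain ⟨n0, hn0⟩ := hWs (δ/2) (δ/2) ε1 (by positivity) (by positivity) (by positivity)
    set C2 := ((2+r) * (8 * Cφ / δ) + 1) * (C * (2+r) * (δ/4)^(-α)) with hC2
    have l1 : Tendsto (fun n : ℕ => (n:ℝ)^(-(e*α))) atTop (nhds 0) := (tendsto_rpow_neg_atTop (by positivity)).comp tendsto_natCast_atTop_atTop
    have l2 : Tendsto (fun n : ℕ => (n:ℝ)^(-(1-a-2*e))) atTop (nhds 0) := (tendsto_rpow_neg_atTop (by rw [he]; linarith)).comp tendsto_natCast_atTop_atTop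
    have L : Tendsto (fun n : ℕ => CR * (n:ℝ)^(-(e*α)) + C2 * (n:ℝ)^(-(1-a-2*e))) atTop (nhds 0) := by
      have := (l1.const_mul CR).add (l2.const_mul C2)
      simpa using this
    have l3 : Tendsto (fun n : ℕ => (n:ℝ)^a) atTop atTop := (_root_.tendsto_rpow_atTop ha0).comp tendsto_natCast_atTop_atTop
    filter_upwards [L.eventually (gt_mem_nhds (half_pos hε)), eventually_ge_atTop 1, eventually_ge_atTop n0, l3.eventually (eventually_ge_atTop (8 * Cφ / δ))] with n hL hn1 hnn0 hna
    have hnR : (1:ℝ) ≤ n := by exact_mod_cast hn1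
    have hn' : (0:ℝ) < n := by linarith
    obtain ⟨k1, k2, k3⟩ := hkp n hn1
    have hh1 : 1 ≤ h n := Real.one_le_rpow hnR (by positivity)
    have hna0 : 0 < (n:ℝ)^a := by positivity
    set N := ⌊(2+r) * h n⌋₊ with hN
    set g := ⌊δ * (n:ℝ)^a / (4 * Cφ)⌋₊ with hg
    set E := {x | ∃ j ≤ N, δ * (n:ℝ)^a / 2 < |bsum T φ j x|} with hE
    have hEm : MeasurableSet E := by
      have : E = ⋃ j ∈ Finset.range (N+1), {x | δ * (n:ℝ)^a / 2 < |bsum T φ j x|} := by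
        ext x; simp [hE, Nat.lt_succ_iff]
      rw [this]
      exact Finset.measurableSet_biUnion _ fun j _ => measurableSet_lt measurable_const (bsum_meas hT φ hφm j).abs
    have hsub : {x | δ * (n:ℝ)^a < |bsum T φ n x - φ0 * bsum F (fun x => (R x:ℝ) - r) (k n) x|} ⊆
        {x | h n < |bsum F (fun x => (R x:ℝ)) (k n) x - k n * r|} ∪ {x | δ * (n:ℝ)^a / 2 < |bsum F W (k n) x|} ∪ F^[k n] ⁻¹' E := by
      intro x hx
      by_contra hcon
      simp only [Set.mem_union, Set.mem_ofPred_eq, not_or, not_lt] at hcon hx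
      obtain ⟨⟨c1, c2⟩, c3⟩ := hcon
      obtain ⟨w1, w2⟩ := win (k n) n x (h n) c1 k1 k2
      rw [decomp hFT hW (k n) n x w1, bsum_sub_const] at hx
      have hle : n - tauN F R (k n) x ≤ N := Nat.le_floor (by nlinarith)
      have c4 : |bsum T φ (n - tauN F R (k n) x) (F^[k n] x)| ≤ δ * (n:ℝ)^a / 2 := by
        by_contra hc; push Not at hc
        exact c3 ⟨_, hle, hc⟩
      have e0 : ∀ u v w : ℝ, u + v + w - v = u + w := fun u v w => by ring
      rw [e0] at hx
      have := abs_add_le (bsum F W (k n) x) (bsum T φ (n - tauN F R (k n) x) (F^[k n] x))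
      linarith
    have hbound := (measureReal_mono (μ := P) hsub).trans ((measureReal_union_le _ _).trans (add_le_add (measureReal_union_le _ _) le_rfl))
    have p1 := hRt (k n) (h n) (by positivity)
    have hkn : (k n:ℝ) ≤ n := by exact_mod_cast k3
    have q1 : CR * (k n) * (h n)^(-α) ≤ CR * (n:ℝ)^(-(e*α)) := by
      have : (n:ℝ)^(-(e*α)) = n * (h n)^(-α) := by
        simp only [hh]; rw [← Real.rpow_mul hn'.le]; nth_rw 2 [← Real.rpow_one (n:ℝ)]; rw [← Real.rpow_add hn']; congr 1; rw [ha]; field_simp; ring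
      rw [this, mul_assoc]; gcongr
    have p2 := hn0 n hnn0 (k n) k3 (δ * (n:ℝ)^a / 2) (by linarith) (by
      have : (n:ℝ)^a ≤ (n:ℝ)^(1:ℝ) := Real.rpow_le_rpow_of_exponent_le hnR ha1.le
      rw [Real.rpow_one] at this
      nlinarith)
    have hnaα : ∀ b > 0, (b * (n:ℝ)^a)^(-α) = b^(-α) * (n:ℝ)⁻¹ := fun b hb => by
      rw [Real.mul_rpow hb.le hna0.le, ← Real.rpow_mul hn'.le]
      rw [show a * -α = -1 by rw [ha]; field_simp, Real.rpow_neg_one]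
    have q2 : ε1 * n * (δ * (n:ℝ)^a / 2)^(-α) = ε/2 := by
      rw [show δ * (n:ℝ)^a / 2 = (δ/2) * (n:ℝ)^a by ring, hnaα _ (by positivity), hε1, Real.rpow_neg (by positivity)]
      field_simp
    rw [q2] at p2
    have hg2 : 2 ≤ δ * (n:ℝ)^a / (4 * Cφ) := by
      rw [div_le_iff₀ hδ] at hna
      rw [le_div_iff₀ (by positivity)]; linarith
    have hg1 : 1 ≤ g := Nat.le_floor (by push_cast; linarith)
    have hgle : (g:ℝ) ≤ δ * (n:ℝ)^a / (4 * Cφ) := Nat.floor_le (by positivity)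
    have hgge : δ * (n:ℝ)^a / (8 * Cφ) ≤ g := by
      have := Nat.lt_floor_add_one (δ * (n:ℝ)^a / (4 * Cφ))
      have e8 : δ * (n:ℝ)^a / (8 * Cφ) = δ * (n:ℝ)^a / (4 * Cφ) / 2 := by field_simp; norm_num
      rw [e8]
      linarith
    have p3 := hmax N g (δ * (n:ℝ)^a / 2) hg1 (by positivity) (by
      rw [le_div_iff₀ (by positivity)] at hgle; linarith)
    have hNle : (N:ℝ) ≤ (2+r) * h n := Nat.floor_le (by positivity)
    have q3 : ((N:ℝ)/g+1) * (C * N * (δ * (n:ℝ)^a / 2/2)^(-α)) ≤ C2 * (n:ℝ)^(-(1-a-2*e)) := by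
      have e1 : (N:ℝ)/g + 1 ≤ ((2+r) * (8 * Cφ / δ) + 1) * (n:ℝ)^e := by
        have : (N:ℝ)/g ≤ ((2+r) * h n) / (δ * (n:ℝ)^a / (8 * Cφ)) := by gcongr
        have e2 : ((2+r) * h n) / (δ * (n:ℝ)^a / (8 * Cφ)) = (2+r) * (8 * Cφ / δ) * (n:ℝ)^e := by
          simp only [hh]; rw [Real.rpow_add hn']; field_simp
        have : (1:ℝ) ≤ (n:ℝ)^e := Real.one_le_rpow hnR he0.le
        linarith
      have e3 : C * N * (δ * (n:ℝ)^a / 2/2)^(-α) ≤ (C * (2+r) * (δ/4)^(-α)) * (h n * (n:ℝ)⁻¹) := by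
        rw [show δ * (n:ℝ)^a / 2/2 = (δ/4) * (n:ℝ)^a by ring, hnaα _ (by positivity)]
        calc _ ≤ C * ((2+r) * h n) * ((δ/4)^(-α) * (n:ℝ)⁻¹) := by gcongr
          _ = _ := by ring
      have e4 : (n:ℝ)^(-(1-a-2*e)) = (n:ℝ)^e * (h n * (n:ℝ)⁻¹) := by
        simp only [hh]; rw [← Real.rpow_neg_one (n:ℝ), ← Real.rpow_add hn', ← Real.rpow_add hn']; congr 1; ring
      rw [e4, hC2]
      calc _ ≤ (((2+r) * (8 * Cφ / δ) + 1) * (n:ℝ)^e) * ((C * (2+r) * (δ/4)^(-α)) * (h n * (n:ℝ)⁻¹)) := by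
            apply mul_le_mul e1 e3 (by positivity) (by positivity)
        _ = _ := by ring
    have p4 : P.real (F^[k n] ⁻¹' E) = P.real E := by
      rw [measureReal_def, (hF.iterate _).measure_preimage hEm.nullMeasurableSet]; rfl
    rw [p4] at hbound
    linarith
end prob
end LSVproof

open MeasureTheory Set NNReal Filter
namespace LSVproof
set_option linter.unusedSectionVars false
set_option linter.unusedVariables false
set_option linter.style.haveILetI false
open scoped ENNReal

lemma sum_rpow_le {s : ℝ} (hs0 : 0 < s) (hs1 : s ≤ 1) (n : ℕ) : ∑ i ∈ Finset.range n, ((i:ℝ)+1)^(s-1) ≤ (n:ℝ)^s / s := by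
  induction n with
  | zero => simp [Real.zero_rpow hs0.ne']
  | succ n ih =>
    rw [Finset.sum_range_succ]
    have hn : (0:ℝ) < (n:ℝ)+1 := by positivity
    have h1 := rpow_one_add_le_one_add_mul_self (s := -1/((n:ℝ)+1)) (p := s) (by
      rw [le_div_iff₀ hn]; have := Nat.cast_nonneg (α := ℝ) n; linarith) hs0.le hs1
    have e : 1 + -1/((n:ℝ)+1) = n/((n:ℝ)+1) := by field_simp; ring
    rw [e, Real.div_rpow (Nat.cast_nonneg _) hn.le, div_le_iff₀ (by positivity)] at h1
    have h2 : ((n:ℝ)+1)^(s-1) = ((n:ℝ)+1)^s / ((n:ℝ)+1) := Real.rpow_sub_one hn.ne' s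
    have h3 : (1 + s * (-1/((n:ℝ)+1))) * ((n:ℝ)+1)^s = ((n:ℝ)+1)^s - s * ((n:ℝ)+1)^(s-1) := by
      rw [h2]; field_simp; ring
    rw [h3] at h1
    push_cast
    rw [le_div_iff₀ hs0] at *
    nlinarith

section
variable {z : ℝ} (hz : z ∈ Ioo (0:ℝ) 1)
include hz

lemma gl_expand {a b : ℝ} (ha : 0 ≤ a) (hb : 0 ≤ b) : |a - b| ≤ |gl z a - gl z b| := by
  wlog hab : b ≤ a generalizing a b
  · rw [abs_sub_comm, abs_sub_comm (gl z a)]; exact this hb ha (not_le.1 hab).le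
  have h1 : b^z ≤ a^z := Real.rpow_le_rpow hb hab hz.1.le
  have h2 : (0:ℝ) < 2^z := by positivity
  have h3 : 0 ≤ b^z := by positivity
  have h4 : a - b ≤ gl z a - gl z b := by
    unfold gl
    have : b * (2^z*b^z) ≤ a * (2^z*a^z) := mul_le_mul hab (by gcongr) (by positivity) ha
    linarith
  rw [abs_of_nonneg (by linarith), abs_of_nonneg (by linarith)]; exact h4

lemma exc_lt {x : ℝ} {j : ℕ} (hj1 : 1 ≤ j) (hj : j < RR z x) : (lsv z)^[j] x < 1/2 := by
  have := not_mem_of_lt_ret (T := lsv z) (Y := Ici (1/2:ℝ)) hj1 hj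
  simpa using this

lemma exc_bound {x : ℝ} (hx : x ∈ Ioo (1/2:ℝ) 1) {j : ℕ} (hj1 : 1 ≤ j) (hj : j < RR z x) :
    (lsv z)^[j] x < aseq z (RR z x - j) := by
  have h0 : (lsv z)^[j] x ∈ Icc (0:ℝ) 1 := lsv_iter_mem hz ⟨by linarith [hx.1], hx.2.le⟩ j
  have h1 := exc_lt hz hj1 hj
  rw [← aseq_iff hz _ _ ⟨h0.1, by linarith⟩]
  intro i hi
  rw [← Function.iterate_add_apply]
  exact exc_lt hz (by omega) (by omega)

lemma exc_dist {x y : ℝ} (hx : x ∈ Ioo (1/2:ℝ) 1) (hy : y ∈ Ioo (1/2:ℝ) 1) (h : RR z x = RR z y) {j : ℕ} (hj1 : 1 ≤ j) (hj : j ≤ RR z x) :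
    |(lsv z)^[j] x - (lsv z)^[j] y| ≤ |FF z x - FF z y| := by
  obtain ⟨l, hl⟩ := Nat.exists_eq_add_of_le hj
  induction l generalizing j with
  | zero =>
    have e1 : FF z x = (lsv z)^[j] x := by show (lsv z)^[RR z x] x = _; rw [hl]; rfl
    have e2 : FF z y = (lsv z)^[j] y := by show (lsv z)^[RR z y] y = _; rw [← h, hl]; rfl
    rw [e1, e2]
  | succ l ih =>
    refine le_trans ?_ (ih (j := j+1) (by omega) (by omega) (by omega))
    rw [Function.iterate_succ_apply', Function.iterate_succ_apply', lsv_left (exc_lt hz hj1 (by omega)), lsv_left (exc_lt hz hj1 (by omega))]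
    exact gl_expand hz (lsv_iter_mem hz ⟨by linarith [hx.1], hx.2.le⟩ j).1 (lsv_iter_mem hz ⟨by linarith [hy.1], hy.2.le⟩ j).1

lemma exc_dist0 {x y : ℝ} (hx : x ∈ Ioo (1/2:ℝ) 1) (hy : y ∈ Ioo (1/2:ℝ) 1) (h : RR z x = RR z y) :
    |x - y| ≤ |FF z x - FF z y| / 2 := by
  have := exc_dist hz hx hy h le_rfl (RR_pos hz hx)
  rw [Function.iterate_one, lsv_right hx.1.le, lsv_right hy.1.le] at this
  have e : 2*x-1-(2*y-1) = 2*(x-y) := by ring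
  rw [e, abs_mul, abs_two] at this
  linarith

lemma code_dist (m : ℕ) : ∀ {x y : ℝ}, (∀ i, (FF z)^[i] x ∈ Ioo (1/2:ℝ) 1) → (∀ i, (FF z)^[i] y ∈ Ioo (1/2:ℝ) 1) →
    (∀ i < m, RR z ((FF z)^[i] x) = RR z ((FF z)^[i] y)) → |x - y| ≤ (1/2)^m := by
  induction m with
  | zero =>
    intro x y hx hy _
    have h1 := hx 0
    have h2 := hy 0
    simp only [Function.iterate_zero, id] at h1 h2
    rw [pow_zero, abs_le]; constructor <;> linarith [h1.1, h1.2, h2.1, h2.2]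
  | succ m ih =>
    intro x y hx hy h
    have h1 := ih (x := FF z x) (y := FF z y) (fun i => by rw [← Function.iterate_succ_apply]; exact hx _)
      (fun i => by rw [← Function.iterate_succ_apply]; exact hy _) (fun i hi => by
        rw [← Function.iterate_succ_apply, ← Function.iterate_succ_apply]; exact h (i+1) (by omega))
    have h2 := exc_dist0 hz (hx 0) (hy 0) (h 0 (by omega))
    simp only [Function.iterate_zero, id] at h2
    rw [pow_succ]; linarith

variable {φ : ℝ → ℝ} {Cφ H ρ : ℝ} (hCφ : 0 < Cφ) (hφ : ∀ x, |φ x| ≤ Cφ) (hH : 0 < H) (hρ : 0 < ρ)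
  (hhol : ∀ x ∈ Icc (0:ℝ) 1, ∀ y ∈ Icc (0:ℝ) 1, |φ x - φ y| ≤ H * |x - y|^ρ)
include hCφ hφ hH hρ hhol

lemma V_bound {s : ℝ} (hs0 : 0 < s) (hs1 : s < 1) (hs : 1 - s ≤ ρ/z) : ∃ C > 0, ∀ x ∈ Ioo (1/2:ℝ) 1,
    |bsum (lsv z) φ (RR z x) x - φ 0 * RR z x| ≤ C * (RR z x : ℝ)^s := by
  obtain ⟨A, hA, ha⟩ := aseq_le hz
  refine ⟨2 * Cφ + H * A^ρ / s, by positivity, fun x hx => ?_⟩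
  have hR := RR_pos hz hx
  obtain ⟨n, hn⟩ := Nat.exists_eq_add_of_le' hR
  have e : bsum (lsv z) φ (RR z x) x - φ 0 * RR z x = ∑ j ∈ Finset.range (n+1), (φ ((lsv z)^[j] x) - φ 0) := by
    rw [bsum, hn, Finset.sum_sub_distrib]; simp; ring
  rw [e, Finset.sum_range_succ']
  refine (abs_add_le _ _).trans ?_
  have h0 : |φ ((lsv z)^[0] x) - φ 0| ≤ 2 * Cφ := by
    refine (abs_sub _ _).trans ?_
    linarith [hφ ((lsv z)^[0] x), hφ 0]
  have hterm : ∀ j ∈ Finset.range n, |φ ((lsv z)^[j+1] x) - φ 0| ≤ H * A^ρ * (((n-1-j:ℕ):ℝ)+1)^(s-1) := by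
    intro j hj
    rw [Finset.mem_range] at hj
    have hm : (lsv z)^[j+1] x ∈ Icc (0:ℝ) 1 := lsv_iter_mem hz ⟨by linarith [hx.1], hx.2.le⟩ _
    have h1 := hhol _ hm 0 ⟨le_rfl, zero_le_one⟩
    rw [sub_zero, abs_of_nonneg hm.1] at h1
    refine h1.trans ?_
    have h2 := (exc_bound hz hx (j := j+1) (by omega) (by omega)).le
    have e3 : RR z x - (j+1) = n-1-j+1 := by omega
    rw [e3] at h2
    set k := n-1-j
    have h3 := h2.trans (ha (k+1) (by omega))
    have hk : (1:ℝ) ≤ (k:ℝ)+1 := by have := Nat.cast_nonneg (α := ℝ) k; linarith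
    have hk0 : (0:ℝ) < (k:ℝ)+1 := by linarith
    rw [mul_assoc]
    refine mul_le_mul_of_nonneg_left ?_ hH.le
    refine (Real.rpow_le_rpow hm.1 h3 hρ.le).trans ?_
    push_cast
    rw [Real.mul_rpow hA.le (by positivity), ← Real.rpow_mul hk0.le]
    refine mul_le_mul_of_nonneg_left (Real.rpow_le_rpow_of_exponent_le hk ?_) (by positivity)
    have : -(1/z)*ρ = -(ρ/z) := by ring
    linarith
  have hsum : |∑ j ∈ Finset.range n, (φ ((lsv z)^[j+1] x) - φ 0)| ≤ H * A^ρ * ((n:ℝ)^s / s) := by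
    refine (Finset.abs_sum_le_sum_abs _ _).trans ((Finset.sum_le_sum hterm).trans ?_)
    rw [← Finset.mul_sum, Finset.sum_range_reflect (fun i : ℕ => ((i:ℝ)+1)^(s-1)) n]
    exact mul_le_mul_of_nonneg_left (sum_rpow_le hs0 hs1.le n) (by positivity)
  rw [hn]
  have h5 : (n:ℝ)^s ≤ ((n+1:ℕ):ℝ)^s := Real.rpow_le_rpow (Nat.cast_nonneg _) (by push_cast; linarith) hs0.le
  have h6 : 1 ≤ ((n+1:ℕ):ℝ)^s := Real.one_le_rpow (by push_cast; have := Nat.cast_nonneg (α := ℝ) n; linarith) hs0.le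
  have h7 : H * A^ρ * ((n:ℝ)^s / s) ≤ H * A^ρ / s * ((n+1:ℕ):ℝ)^s := by
    rw [mul_div_assoc', div_mul_eq_mul_div]; gcongr
  have h8 : 2 * Cφ ≤ 2 * Cφ * ((n+1:ℕ):ℝ)^s := le_mul_of_one_le_right (by positivity) h6
  rw [add_mul]; linarith

lemma V_hold {m : ℕ} {x y : ℝ} (hx : ∀ i, (FF z)^[i] x ∈ Ioo (1/2:ℝ) 1) (hy : ∀ i, (FF z)^[i] y ∈ Ioo (1/2:ℝ) 1)
    (h : ∀ i < m+1, RR z ((FF z)^[i] x) = RR z ((FF z)^[i] y)) :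
    |bsum (lsv z) φ (RR z x) x - bsum (lsv z) φ (RR z y) y| ≤ H * ((1/2)^ρ)^m * RR z x := by
  have hx0 := hx 0
  have hy0 := hy 0
  have h0 := h 0 (by omega)
  simp only [Function.iterate_zero, id] at hx0 hy0 h0
  have hd : |FF z x - FF z y| ≤ (1/2)^m := code_dist hz m (fun i => by rw [← Function.iterate_succ_apply]; exact hx _)
      (fun i => by rw [← Function.iterate_succ_apply]; exact hy _) (fun i hi => by
        rw [← Function.iterate_succ_apply, ← Function.iterate_succ_apply]; exact h (i+1) (by omega))
  rw [← h0, bsum, bsum, ← Finset.sum_sub_distrib]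
  refine (Finset.abs_sum_le_sum_abs _ _).trans ?_
  have : ∀ j ∈ Finset.range (RR z x), |φ ((lsv z)^[j] x) - φ ((lsv z)^[j] y)| ≤ H * ((1/2)^ρ)^m := by
    intro j hj
    rw [Finset.mem_range] at hj
    refine (hhol _ (lsv_iter_mem hz ⟨by linarith [hx0.1], hx0.2.le⟩ j) _ (lsv_iter_mem hz ⟨by linarith [hy0.1], hy0.2.le⟩ j)).trans ?_
    refine mul_le_mul_of_nonneg_left ?_ hH.le
    rw [← Real.rpow_natCast, ← Real.rpow_mul (by norm_num), mul_comm ρ, Real.rpow_mul (by norm_num), Real.rpow_natCast]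
    refine Real.rpow_le_rpow (abs_nonneg _) ?_ hρ.le
    rcases Nat.eq_zero_or_pos j with rfl | hj1
    · have := exc_dist0 hz hx0 hy0 h0
      simp only [Function.iterate_zero, id]
      linarith [abs_nonneg (FF z x - FF z y)]
    · exact (exc_dist hz hx0 hy0 h0 hj1 hj.le).trans hd
  refine (Finset.sum_le_sum this).trans (le_of_eq ?_)
  simp; ring

lemma W_props (hz2 : 1/2 < z) (P : Measure ℝ) (hgood : ∀ᵐ x ∂P, ∀ i, (FF z)^[i] x ∈ Ioo (1/2:ℝ) 1) (r : ℝ) (W : ℝ → ℝ)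
    (hW : ∀ x, W x = bsum (lsv z) φ (RR z x) x - φ 0 * (RR z x - r)) :
    ∃ s C D η : ℝ, (1/z)/2 < s ∧ s < 1 ∧ 0 ≤ C ∧ 0 ≤ D ∧ 0 < η ∧ η < 1 ∧ (∀ᵐ x ∂P, |W x| ≤ C * (RR z x:ℝ)^s) ∧
      ∀ m : ℕ, 1 ≤ m → ∃ Wm : ℝ → ℝ, Dep (FF z) (RR z) m Wm ∧ (∀ x, |Wm x| ≤ C * (RR z x:ℝ)^s) ∧
        ∀ᵐ x ∂P, |W x - Wm x| ≤ D * η^m * RR z x := by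
  have hz0 := hz.1
  have hα : (1/z)/2 < 1 := by rw [div_div, div_lt_one (by positivity)]; linarith
  obtain ⟨s, hs1, hs2, hs3⟩ : ∃ s, (1/z)/2 < s ∧ s < 1 ∧ 1 - s ≤ ρ/z := by
    have : 0 < ρ/z := by positivity
    refine ⟨max (((1/z)/2+1)/2) (1-ρ/z), lt_max_of_lt_left (by linarith), max_lt (by linarith) (by linarith), ?_⟩
    linarith [le_max_right (((1/z)/2+1)/2) (1-ρ/z)]
  have hs0 : 0 < s := lt_trans (by positivity) hs1
  obtain ⟨C, hC, hV⟩ := V_bound hz hCφ hφ hH hρ hhol hs0 hs2 hs3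
  have hWb : ∀ x ∈ Ioo (1/2:ℝ) 1, |W x| ≤ (C + Cφ * |r|) * (RR z x:ℝ)^s := by
    intro x hx
    have h1 := hV x hx
    have h6 : 1 ≤ (RR z x:ℝ)^s := Real.one_le_rpow (by exact_mod_cast RR_pos hz hx) hs0.le
    have e : W x = (bsum (lsv z) φ (RR z x) x - φ 0 * RR z x) + φ 0 * r := by rw [hW]; ring
    rw [e]
    refine (abs_add_le _ _).trans ?_
    rw [abs_mul, add_mul]
    have h3 : |φ 0| * |r| ≤ Cφ * |r| := mul_le_mul_of_nonneg_right (hφ 0) (abs_nonneg _)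
    have h4 : Cφ * |r| ≤ Cφ * |r| * (RR z x:ℝ)^s := le_mul_of_one_le_right (by positivity) h6
    linarith
  have hη0 : (0:ℝ) < (1/2)^ρ := by positivity
  refine ⟨s, C + Cφ * |r|, H / (1/2)^ρ, (1/2)^ρ, hs1, hs2, by positivity, by positivity, hη0,
    Real.rpow_lt_one (by norm_num) (by norm_num) hρ, ?_, fun m hm => ?_⟩
  · filter_upwards [hgood] with x hx using hWb x (hx 0)
  · classical
    let G : ℝ → Prop := fun y => ∀ i, (FF z)^[i] y ∈ Ioo (1/2:ℝ) 1
    let wm : (Fin m → ℕ) → ℝ := fun c => if h : ∃ y, G y ∧ code (FF z) (RR z) m y = c then W h.choose else 0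
    have hcode : ∀ x y, code (FF z) (RR z) m x = code (FF z) (RR z) m y → ∀ i < m, RR z ((FF z)^[i] x) = RR z ((FF z)^[i] y) :=
      fun x y h i hi => congrFun h ⟨i, hi⟩
    refine ⟨fun x => wm (code (FF z) (RR z) m x), ?_, ?_, ?_⟩
    · intro x y h
      have : code (FF z) (RR z) m x = code (FF z) (RR z) m y := by ext i; exact h i i.2
      simp only [this]
    · intro x
      simp only [wm]
      split_ifs with h
      · have hc := h.choose_spec
        have := hWb h.choose (hc.1 0)
        have e := hcode _ _ hc.2 0 (by omega)
        simp only [Function.iterate_zero, id] at e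
        rw [e] at this; exact this
      · rw [abs_zero]; positivity
    · filter_upwards [hgood] with x hx
      have h : ∃ y, G y ∧ code (FF z) (RR z) m y = code (FF z) (RR z) m x := ⟨x, hx, rfl⟩
      simp only [wm]
      rw [dif_pos h]
      have hc := h.choose_spec
      set y := h.choose
      obtain ⟨m', rfl⟩ := Nat.exists_eq_add_of_le' hm
      have e := hcode _ _ hc.2 0 (by omega)
      simp only [Function.iterate_zero, id] at e
      have h2 := V_hold hz hCφ hφ hH hρ hhol hx hc.1 (fun i hi => (hcode _ _ hc.2 i hi).symm)
      rw [hW, hW, e]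
      have e3 : H / (1/2)^ρ * ((1/2)^ρ)^(m'+1) = H * ((1/2:ℝ)^ρ)^m' := by rw [pow_succ]; field_simp
      rw [e3]
      rw [e] at h2
      refine le_trans (le_of_eq ?_) h2
      congr 1; ring
end
end LSVproof

open MeasureTheory Set NNReal Filter
namespace LSVproof
set_option linter.unusedSectionVars false
set_option linter.unusedVariables false
set_option linter.style.haveILetI false
open scoped ENNReal

section transfer
variable {Ω : Type*} [MeasurableSpace Ω] {T : Ω → Ω} {Y : Set Ω} (hT : Measurable T) (hY : MeasurableSet Y)
  {μ : Measure Ω} [IsProbabilityMeasure μ] (hmp : MeasurePreserving T μ μ)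
  (hrec : ∀ᵐ x ∂μ, ∃ n, 1 ≤ n ∧ T^[n] x ∈ Y)

section a
include hT hY hmp hrec
lemma map_ind_eq : μ.map (ind T Y) = ((μ.restrict Y).withDensity (fun x => ((ret T Y x : ℝ≥0) : ℝ≥0∞))).map (ind T Y) := by
  have hF := measurable_ind hT hY
  have hRm : Measurable (fun x => ((ret T Y x : ℝ≥0) : ℝ≥0∞)) := (measurable_from_nat (f := fun n : ℕ => ((n:ℝ≥0):ℝ≥0∞))).comp (measurable_ret hT hY)
  ext B hB
  rw [Measure.map_apply hF hB, Measure.map_apply hF hB, map_ind hT hY hmp hrec B hB, withDensity_apply _ (hF hB),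
    ← lintegral_indicator (hF hB)]
  congr 1
  ext x
  by_cases h : ind T Y x ∈ B
  · simp [h]
  · simp [h]

lemma int_ind (g : Ω → ℂ) (hg : Measurable g) :
    ∫ x, g (ind T Y x) ∂μ = ∫ x in Y, (ret T Y x : ℂ) * g (ind T Y x) ∂μ := by
  have hF := measurable_ind hT hY
  have hRm : Measurable (fun x => (ret T Y x : ℝ≥0)) := (measurable_from_nat (f := fun n : ℕ => (n:ℝ≥0))).comp (measurable_ret hT hY)
  rw [← integral_map hF.aemeasurable hg.aestronglyMeasurable, map_ind_eq hT hY hmp hrec,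
    integral_map hF.aemeasurable hg.aestronglyMeasurable,
    integral_withDensity_eq_integral_smul hRm]
  congr 1
end a

lemma bsum_shift {φ : Ω → ℝ} {Cφ : ℝ} (hφ : ∀ x, |φ x| ≤ Cφ) (n : ℕ) (x : Ω) :
    |bsum T φ n x - bsum T φ n (ind T Y x)| ≤ 2 * Cφ * ret T Y x := by
  have h1 := bsum_add (F := T) φ n (ret T Y x) x
  have h2 := bsum_add (F := T) φ (ret T Y x) n x
  rw [add_comm n, h2] at h1
  have e : bsum T φ n x - bsum T φ n (ind T Y x) = bsum T φ (ret T Y x) x - bsum T φ (ret T Y x) (T^[n] x) := by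
    show bsum T φ n x - bsum T φ n (T^[ret T Y x] x) = _
    linarith
  rw [e]
  refine (abs_sub _ _).trans ?_
  linarith [bsum_bd (T := T) hφ (ret T Y x) x, bsum_bd (T := T) hφ (ret T Y x) (T^[n] x)]

variable {P : Measure Ω} [IsProbabilityMeasure P] (hP : μ.restrict Y = μ Y • P) (hF : MeasurePreserving (ind T Y) P P)
  {K θ : ℝ} (hK : 0 ≤ K) (hθ0 : 0 < θ) (hθ1 : θ < 1)
  (hmix : ∀ (m : ℕ) (c : ℕ → ℕ) (j : ℕ) (B : Set Ω), MeasurableSet B →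
      |P.real (acyl (ind T Y) (ret T Y) m c ∩ (ind T Y)^[m+j] ⁻¹' B) - P.real (acyl (ind T Y) (ret T Y) m c) * P.real B|
        ≤ K * θ ^ j * (P.real (acyl (ind T Y) (ret T Y) m c) * P.real B))
  (hRintg : Integrable (fun x => (ret T Y x:ℝ)) P) {r : ℝ} (hr : r = ∫ x, (ret T Y x:ℝ) ∂P) (hYr : μ.real Y * r = 1)

section b
include hT hY hF hK hθ0 hmix hRintg hr
/-- weighted integrals over the base -/
lemma R_weight (g : Ω → ℝ) (hg : Measurable g) (hgi : Integrable g P) (hg0 : ∀ x, 0 ≤ g x) :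
    Integrable (fun x => (ret T Y x:ℝ) * g (ind T Y x)) P ∧
    ∫ x, (ret T Y x:ℝ) * g (ind T Y x) ∂P ≤ (1 + 3 * K) * r * ∫ x, g x ∂P := by
  obtain ⟨h1, h2⟩ := MIXr hF (measurable_ret hT hY) hK hθ0 hmix 1 0 (fun x => (ret T Y x:ℝ)) g
    (fun x y hxy => congrArg _ (Dep.R1 x y hxy)) hRintg hgi hg
  simp only [add_zero, Function.iterate_one, pow_zero, mul_one] at h1 h2
  refine ⟨h1, ?_⟩
  have e1 : ∫ x, |(ret T Y x:ℝ)| ∂P = r := by rw [hr]; simp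
  have e2 : ∫ x, |g x| ∂P = ∫ x, g x ∂P := by congr 1; ext x; exact abs_of_nonneg (hg0 x)
  rw [e1, e2, ← hr] at h2
  have := (abs_le.1 h2).2
  linarith
end b

section c
include hT hY hmp hrec hP hF hK hθ0 hmix hRintg hr hYr
lemma int_ind' (g : Ω → ℂ) (hg : Measurable g) :
    ∫ x, g (ind T Y x) ∂μ = (μ.real Y : ℂ) * ∫ x, (ret T Y x : ℂ) * g (ind T Y x) ∂P := by
  rw [int_ind hT hY hmp hrec g hg, hP, integral_smul_measure]; simp [Measure.real]

lemma mu_ind (B : Set Ω) (hB : MeasurableSet B) : μ.real (ind T Y ⁻¹' B) ≤ (1 + 3 * K) * P.real B := by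
  have hFm := measurable_ind hT hY
  have h := int_ind' hT hY hmp hrec hP hF hK hθ0 hmix hRintg hr hYr (fun x => ((B.indicator (fun _ => (1:ℝ)) x : ℝ) : ℂ))
    (Complex.measurable_ofReal.comp (measurable_const.indicator hB))
  have e1 : ∫ x, ((B.indicator (fun _ => (1:ℝ)) (ind T Y x) : ℝ) : ℂ) ∂μ = (μ.real (ind T Y ⁻¹' B) : ℂ) := by
    rw [integral_complex_ofReal]
    congr 1
    rw [← integral_indicator_one (hFm hB)]
    rfl
  have e2 : ∫ x, (ret T Y x : ℂ) * ((B.indicator (fun _ => (1:ℝ)) (ind T Y x) : ℝ) : ℂ) ∂P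
      = ((∫ x, (ret T Y x : ℝ) * (B.indicator (fun _ => (1:ℝ)) (ind T Y x)) ∂P : ℝ) : ℂ) := by
    rw [← integral_complex_ofReal]
    congr 1; ext x; push_cast; rfl
  rw [e1, e2] at h
  have h' : μ.real (ind T Y ⁻¹' B) = μ.real Y * ∫ x, (ret T Y x : ℝ) * (B.indicator (fun _ => (1:ℝ)) (ind T Y x)) ∂P := by
    exact_mod_cast h
  have h2 := (R_weight hT hY hF hK hθ0 hmix hRintg hr (B.indicator (fun _ => (1:ℝ))) (measurable_const.indicator hB)
    ((integrable_const 1).indicator hB) (fun x => indicator_nonneg (fun _ _ => zero_le_one) x)).2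
  have e3 : ∫ x, B.indicator (fun _ => (1:ℝ)) x ∂P = P.real B := integral_indicator_one hB
  rw [e3] at h2
  rw [h']
  calc _ ≤ μ.real Y * ((1 + 3 * K) * r * P.real B) := mul_le_mul_of_nonneg_left h2 measureReal_nonneg
    _ = (μ.real Y * r) * ((1 + 3 * K) * P.real B) := by ring
    _ = _ := by rw [hYr, one_mul]

lemma mu_R_tail {α C0 : ℝ} (hα1 : 1 < α) (hC0 : 0 ≤ C0) (htail : ∀ y > 0, P.real {x | y < (ret T Y x : ℝ)} ≤ C0 * y ^ (-α)) (y : ℝ) (hy : 0 < y) :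
    μ.real {x | y < (ret T Y x:ℝ)} ≤ α * C0 / (α - 1) * y ^ (1 - α) := by
  have h1 := tail_ret hT hY hmp hrec ⌊y⌋₊
  have hRm : Measurable (fun x => (ret T Y x:ℝ)) := measurable_from_nat.comp (measurable_ret hT hY)
  have h2 := moment_high (P := P) (fun x => (ret T Y x:ℝ)) hRm (fun x => Nat.cast_nonneg _) α C0 1 y hC0 one_pos hα1 hy htail
  have e : {x | y < (ret T Y x:ℝ)} = {x | ⌊y⌋₊ < ret T Y x} := by
    ext x; simp only [Set.mem_ofPred_eq]; rw [Nat.floor_lt hy.le]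
  have hle : μ {x | y < (ret T Y x:ℝ)} ≤ ENNReal.ofReal (α * C0 / (α - 1) * y ^ (1 - α)) := by
    rw [e]
    refine h1.trans (le_trans ?_ h2)
    rw [hP, lintegral_smul_measure, smul_eq_mul]
    refine (mul_le_mul_left (prob_le_one (μ := μ) (s := Y)) _).trans ?_
    rw [one_mul]
    refine lintegral_mono fun x => ?_
    by_cases h : y < (ret T Y x:ℝ)
    · have h' : ⌊y⌋₊ < ret T Y x := (Nat.floor_lt hy.le).2 h
      simp [h', not_le.2 h]
    · have h' : ¬ ⌊y⌋₊ < ret T Y x := fun h3 => h ((Nat.floor_lt hy.le).1 h3)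
      simp [h']
  exact ENNReal.toReal_le_of_le_ofReal (by have : 0 < α - 1 := by linarith
                                           positivity) hle

lemma MU_tail {α C0 C1 Cφ : ℝ} {φ : Ω → ℝ} (hφm : Measurable φ) (hCφ : 0 < Cφ) (hφ : ∀ x, |φ x| ≤ Cφ)
    (hα1 : 1 < α) (hC0 : 0 ≤ C0) (hC1 : 0 < C1) (htail : ∀ y > 0, P.real {x | y < (ret T Y x : ℝ)} ≤ C0 * y ^ (-α))
    (hTP : ∀ (n : ℕ) (y : ℝ), 0 < y → P.real {x | y < |bsum T φ n x|} ≤ C1 * n * y^(-α)) :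
    ∃ C : ℝ, ∀ n : ℕ, 1 ≤ n → ∀ x : ℝ, 0 < x → μ {ω | x < |(n:ℝ)^(-(1/α)) * bsum T φ n ω|} ≤ ENNReal.ofReal (C * x^(-α)) := by
  have hα0 : 0 < α := by linarith
  set C2 := α * C0 / (α - 1) with hC2
  have hC20 : 0 ≤ C2 := by
    have : 0 < α - 1 := by linarith
    positivity
  set A := (1+3*K) * C1 * 2^α with hA
  set B := C2 * (4*Cφ)^(α-1) * Cφ with hB
  have hA0 : 0 ≤ A := by positivity
  have hB0 : 0 ≤ B := by positivity
  refine ⟨A + B, fun n hn x hx => ?_⟩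
  have hn0 : (0:ℝ) < n := by exact_mod_cast hn
  set y := x * (n:ℝ)^(1/α) with hy
  have hy0 : 0 < y := by positivity
  have hset : {ω | x < |(n:ℝ)^(-(1/α)) * bsum T φ n ω|} = {ω | y < |bsum T φ n ω|} := by
    ext ω
    simp only [Set.mem_ofPred_eq]
    rw [abs_mul, abs_of_pos (by positivity), Real.rpow_neg hn0.le, inv_mul_eq_div, lt_div_iff₀ (by positivity)]
  rw [hset]
  have hya : (n:ℝ) * y^(-α) = x^(-α) := by
    rw [hy, Real.mul_rpow hx.le (by positivity), ← Real.rpow_mul hn0.le]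
    have : 1/α * -α = -1 := by field_simp
    rw [this, Real.rpow_neg_one]; field_simp
  have hfin := measure_ne_top μ {ω | y < |bsum T φ n ω|}
  rw [← ENNReal.ofReal_toReal hfin]
  apply ENNReal.ofReal_le_ofReal
  change μ.real _ ≤ _
  rcases lt_or_ge (Cφ * n) y with h | h
  · have : {ω | y < |bsum T φ n ω|} = ∅ := by
      ext ω; simp only [Set.mem_ofPred_eq, mem_empty_iff_false, iff_false, not_lt]
      exact (bsum_bd hφ n ω).trans h.le
    rw [this, measureReal_empty]; positivity
  · have hsub : {ω | y < |bsum T φ n ω|} ⊆ ind T Y ⁻¹' {ω | y/2 < |bsum T φ n ω|} ∪ {ω | y/(4*Cφ) < (ret T Y ω:ℝ)} := by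
      intro ω hω
      by_contra hcon
      simp only [mem_union, mem_preimage, Set.mem_ofPred_eq, not_or, not_lt] at hcon hω
      obtain ⟨ha, hb⟩ := hcon
      rw [le_div_iff₀ (by positivity)] at hb
      have h3 := bsum_shift (T := T) (Y := Y) hφ n ω
      have h4 := abs_sub_abs_le_abs_sub (bsum T φ n ω) (bsum T φ n (ind T Y ω))
      linarith
    refine (measureReal_mono hsub (measure_ne_top _ _)).trans ((measureReal_union_le _ _).trans ?_)
    have hm : MeasurableSet {ω | y/2 < |bsum T φ n ω|} := measurableSet_lt measurable_const (bsum_meas hT φ hφm n).abs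
    have h5 := mu_ind hT hY hmp hrec hP hF hK hθ0 hmix hRintg hr hYr _ hm
    have h6 := hTP n (y/2) (by positivity)
    have h7 := mu_R_tail hT hY hmp hrec hP hF hK hθ0 hmix hRintg hr hYr hα1 hC0 htail (y/(4*Cφ)) (by positivity)
    rw [add_mul]
    refine add_le_add (h5.trans ?_) (h7.trans ?_)
    · refine (mul_le_mul_of_nonneg_left h6 (by positivity)).trans (le_of_eq ?_)
      rw [Real.div_rpow hy0.le (by norm_num), Real.rpow_neg (by norm_num : (0:ℝ) ≤ 2), ← hya, hA]
      field_simp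
    · rw [← hC2, Real.div_rpow hy0.le (by positivity), hB, ← hya]
      have e1 : y^(1-α) = y * y^(-α) := by rw [sub_eq_add_neg, Real.rpow_add hy0, Real.rpow_one]
      have e2 : (4*Cφ)^(1-α) = ((4*Cφ)^(α-1))⁻¹ := by rw [← Real.rpow_neg (by positivity)]; congr 1; ring
      rw [e1, e2, div_inv_eq_mul]
      have h8 : y * y^(-α) ≤ Cφ * n * y^(-α) := mul_le_mul_of_nonneg_right h (by positivity)
      calc C2 * (y * y^(-α) * (4*Cφ)^(α-1)) ≤ C2 * (Cφ * n * y^(-α) * (4*Cφ)^(α-1)) := by gcongr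
        _ = _ := by ring
end c
end transfer
end LSVproof

open MeasureTheory Set NNReal Filter
namespace LSVproof
set_option linter.unusedSectionVars false
set_option linter.unusedVariables false
set_option linter.style.haveILetI false
open scoped ENNReal

lemma exp_diff (a b : ℝ) : ‖Complex.exp (Complex.I * a) - Complex.exp (Complex.I * b)‖ ≤ min 2 |a - b| := by
  have e : Complex.exp (Complex.I * a) - Complex.exp (Complex.I * b) = Complex.exp (Complex.I * b) * (Complex.exp (Complex.I * (a - b : ℝ)) - 1) := by
    rw [mul_sub, ← Complex.exp_add, mul_one]; congr 2; push_cast; ring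
  rw [e, norm_mul, mul_comm Complex.I (b:ℂ), Complex.norm_exp_ofReal_mul_I, one_mul]
  exact exp_sub_one_norm _

/-- bounded continuous functional of a sequence tending to zero in probability -/
lemma min_tendsto {Ω : Type*} [MeasurableSpace Ω] {P : Measure Ω} [IsProbabilityMeasure P] (D : ℕ → Ω → ℝ) (hD : ∀ n, Measurable (D n)) (a : ℝ)
    (t : ℝ) (ht : 0 < t)
    (h : ∀ δ > 0, Tendsto (fun n : ℕ => P.real {x | δ * (n:ℝ)^a < |D n x|}) atTop (nhds 0)) :
    Tendsto (fun n : ℕ => ∫ x, min 2 |t * (n:ℝ)^(-a) * D n x| ∂P) atTop (nhds 0) := by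
  rw [Metric.tendsto_atTop]
  intro ε hε
  have h1 := (h (ε/(2*t)) (by positivity)).eventually (gt_mem_nhds (show (0:ℝ) < ε/8 by positivity))
  obtain ⟨N, hN⟩ := eventually_atTop.1 h1
  refine ⟨max N 1, fun n hn => ?_⟩
  have hn1 : 1 ≤ n := le_trans (le_max_right _ _) hn
  have hP := hN n (le_trans (le_max_left _ _) hn)
  have hn0 : (0:ℝ) < n := by exact_mod_cast hn1
  set A := {x | ε/(2*t) * (n:ℝ)^a < |D n x|} with hA
  have hAm : MeasurableSet A := measurableSet_lt measurable_const (hD n).abs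
  have hle : ∀ x, min 2 |t * (n:ℝ)^(-a) * D n x| ≤ A.indicator (fun _ => (2:ℝ)) x + ε/2 := by
    intro x
    by_cases hx : x ∈ A
    · rw [indicator_of_mem hx]; linarith [min_le_left 2 |t * (n:ℝ)^(-a) * D n x|]
    · rw [indicator_of_notMem hx, zero_add]
      refine (min_le_right _ _).trans ?_
      simp only [hA, Set.mem_ofPred_eq, not_lt] at hx
      rw [abs_mul, abs_of_pos (by positivity)]
      calc t * (n:ℝ)^(-a) * |D n x| ≤ t * (n:ℝ)^(-a) * (ε/(2*t) * (n:ℝ)^a) := by gcongr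
        _ = ε/2 := by rw [Real.rpow_neg hn0.le]; field_simp
  have hi1 : Integrable (fun x => A.indicator (fun _ => (2:ℝ)) x) P := (integrable_const 2).indicator hAm
  have hi2 : Integrable (fun x : Ω => (ε/2:ℝ)) P := integrable_const _
  have h2 : ∫ x, min 2 |t * (n:ℝ)^(-a) * D n x| ∂P ≤ ∫ x, (A.indicator (fun _ => (2:ℝ)) x + ε/2) ∂P := by
    refine integral_mono_of_nonneg (Eventually.of_forall fun x => le_min (by norm_num) (abs_nonneg _)) (hi1.add hi2) (Eventually.of_forall hle)
  rw [integral_add hi1 hi2, integral_indicator_const _ hAm] at h2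
  simp only [smul_eq_mul, integral_const, probReal_univ, one_mul] at h2
  have h3 : 0 ≤ ∫ x, min 2 |t * (n:ℝ)^(-a) * D n x| ∂P := integral_nonneg fun x => le_min (by norm_num) (abs_nonneg _)
  rw [Real.dist_eq, sub_zero, abs_of_nonneg h3]
  linarith

section transfer
variable {Ω : Type*} [MeasurableSpace Ω] {T : Ω → Ω} {Y : Set Ω} (hT : Measurable T) (hY : MeasurableSet Y)
  {μ : Measure Ω} [IsProbabilityMeasure μ] (hmp : MeasurePreserving T μ μ)
  (hrec : ∀ᵐ x ∂μ, ∃ n, 1 ≤ n ∧ T^[n] x ∈ Y)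
variable {P : Measure Ω} [IsProbabilityMeasure P] (hP : μ.restrict Y = μ Y • P) (hF : MeasurePreserving (ind T Y) P P)
  {K θ : ℝ} (hK : 0 ≤ K) (hθ0 : 0 < θ) (hθ1 : θ < 1)
  (hmix : ∀ (m : ℕ) (c : ℕ → ℕ) (j : ℕ) (B : Set Ω), MeasurableSet B →
      |P.real (acyl (ind T Y) (ret T Y) m c ∩ (ind T Y)^[m+j] ⁻¹' B) - P.real (acyl (ind T Y) (ret T Y) m c) * P.real B|
        ≤ K * θ ^ j * (P.real (acyl (ind T Y) (ret T Y) m c) * P.real B))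
  (hRintg : Integrable (fun x => (ret T Y x:ℝ)) P) {r : ℝ} (hr : r = ∫ x, (ret T Y x:ℝ) ∂P) (hYr : μ.real Y * r = 1)
include hT hY hmp hrec hP hF hK hθ0 hmix hRintg hr hYr

set_option maxHeartbeats 2000000 in
lemma MU_char {α Cφ φ0 : ℝ} {φ : Ω → ℝ} (hφm : Measurable φ) (hCφ : 0 < Cφ) (hφ : ∀ x, |φ x| ≤ Cφ)
    (hα1 : 1 < α) (k : ℕ → ℕ)
    (hk : ∀ δ > 0, Tendsto (fun n : ℕ => P.real {x | δ * (n:ℝ)^(1/α) < |bsum T φ n x - φ0 * bsum (ind T Y) (fun x => (ret T Y x:ℝ) - r) (k n) x|}) atTop (nhds 0))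
    (t : ℝ) (ht : 0 < t) (w : ℂ)
    (hw : Tendsto (fun n : ℕ => ∫ x, (ret T Y x : ℂ) * Complex.exp (Complex.I * (((t * φ0) * (n:ℝ)^(-(1/α))) * bsum (ind T Y) (fun x => (ret T Y x:ℝ) - r) (k n) (ind T Y x) : ℝ)) ∂P) atTop
        (nhds (r * w))) :
    Tendsto (fun n : ℕ => ∫ x, Complex.exp (Complex.I * ((t * (n:ℝ)^(-(1/α))) * bsum T φ n x : ℝ)) ∂μ) atTop (nhds w) := by
  have hα0 : 0 < α := by linarith
  have hFm := measurable_ind hT hY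
  have hRm : Measurable (fun x => (ret T Y x:ℝ)) := measurable_from_nat.comp (measurable_ret hT hY)
  have hRc : Measurable (fun x => (ret T Y x:ℂ)) := (measurable_from_nat (f := fun n : ℕ => (n:ℂ))).comp (measurable_ret hT hY)
  have hbm : ∀ n, Measurable (bsum T φ n) := fun n => bsum_meas hT φ hφm n
  have hSm : ∀ n, Measurable (bsum (ind T Y) (fun x => (ret T Y x:ℝ) - r) (k n)) := fun n => bsum_meas hFm _ (hRm.sub_const r) _
  set s : ℕ → ℝ := fun n => t * (n:ℝ)^(-(1/α)) with hs
  have hs0 : Tendsto s atTop (nhds 0) := by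
    have : Tendsto (fun n : ℕ => (n:ℝ)^(-(1/α))) atTop (nhds 0) :=
      (tendsto_rpow_neg_atTop (by positivity)).comp tendsto_natCast_atTop_atTop
    have h2 := this.const_mul t
    rw [mul_zero] at h2
    exact h2
  set G : ℕ → Ω → ℂ := fun n x => Complex.exp (Complex.I * ((s n * bsum T φ n x : ℝ):ℂ)) with hG
  set E : ℕ → Ω → ℂ := fun n x => Complex.exp (Complex.I * ((s n * (φ0 * bsum (ind T Y) (fun x => (ret T Y x:ℝ) - r) (k n) x) : ℝ):ℂ)) with hE
  have hcm : Measurable (fun u : ℝ => Complex.exp (Complex.I * (u:ℂ))) := by fun_prop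
  have hGm : ∀ n, Measurable (G n) := fun n => hcm.comp ((hbm n).const_mul _)
  have hEm : ∀ n, Measurable (E n) := fun n => hcm.comp (((hSm n).const_mul _).const_mul _)
  have hn1 : ∀ u : ℝ, ‖Complex.exp (Complex.I * (u:ℂ))‖ = 1 := fun u => by rw [mul_comm, Complex.norm_exp_ofReal_mul_I]
  have hGi : ∀ n, Integrable (G n) μ := fun n => Integrable.of_bound (hGm n).aestronglyMeasurable 1 (Eventually.of_forall fun x => (hn1 _).le)
  have hGFi : ∀ n, Integrable (fun x => G n (ind T Y x)) μ := fun n =>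
    Integrable.of_bound ((hGm n).comp hFm).aestronglyMeasurable 1 (Eventually.of_forall fun x => (hn1 _).le)
  -- step 1
  have d1 : Tendsto (fun n => ∫ x, (G n x - G n (ind T Y x)) ∂μ) atTop (nhds 0) := by
    have := tendsto_integral_of_dominated_convergence (μ := μ) (F := fun n x => G n x - G n (ind T Y x)) (f := fun _ => (0:ℂ)) (fun _ => (2:ℝ))
      (fun n => ((hGm n).sub ((hGm n).comp hFm)).aestronglyMeasurable) (integrable_const _)
      (fun n => Eventually.of_forall fun x => (exp_diff _ _).trans (min_le_left _ _)) (Eventually.of_forall fun x => by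
        refine squeeze_zero_norm (a := fun n => |s n| * (2 * Cφ * ret T Y x)) (fun n => ?_) ?_
        · refine (exp_diff _ _).trans ((min_le_right _ _).trans ?_)
          rw [← mul_sub, abs_mul]
          exact mul_le_mul_of_nonneg_left (bsum_shift hφ n x) (abs_nonneg _)
        · have := hs0.abs.mul_const (2 * Cφ * ret T Y x)
          simpa using this)
    simpa using this
  -- step 2
  have hRi : Integrable (fun x => (ret T Y x:ℂ)) P := by
    have := hRintg.ofReal (𝕜 := ℂ)
    simpa using this
  have iG : ∀ n, Integrable (fun x => (ret T Y x:ℂ) * G n (ind T Y x)) P := fun n =>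
    hRi.mul_bdd (c := 1) ((hGm n).comp hFm).aestronglyMeasurable (Eventually.of_forall fun x => (hn1 _).le)
  have iE : ∀ n, Integrable (fun x => (ret T Y x:ℂ) * E n (ind T Y x)) P := fun n =>
    hRi.mul_bdd (c := 1) ((hEm n).comp hFm).aestronglyMeasurable (Eventually.of_forall fun x => (hn1 _).le)
  set D : ℕ → Ω → ℝ := fun n x => bsum T φ n x - φ0 * bsum (ind T Y) (fun x => (ret T Y x:ℝ) - r) (k n) x with hD
  have hDm : ∀ n, Measurable (D n) := fun n => (hbm n).sub ((hSm n).const_mul _)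
  have hg := min_tendsto (P := P) D hDm (1/α) t ht hk
  have d2 : Tendsto (fun n => (∫ x, (ret T Y x:ℂ) * G n (ind T Y x) ∂P) - ∫ x, (ret T Y x:ℂ) * E n (ind T Y x) ∂P) atTop (nhds 0) := by
    refine squeeze_zero_norm (a := fun n => (1 + 3 * K) * r * ∫ x, min 2 |s n * D n x| ∂P) (fun n => ?_) ?_
    · rw [← integral_sub (iG n) (iE n)]
      have hgm : Measurable (fun x => min 2 |s n * D n x|) := measurable_const.min ((hDm n).const_mul _).abs
      obtain ⟨w1, w2⟩ := R_weight hT hY hF hK hθ0 hmix hRintg hr (fun x => min 2 |s n * D n x|) hgm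
        (Integrable.of_bound hgm.aestronglyMeasurable 2 (Eventually.of_forall fun x => by
          rw [Real.norm_eq_abs, abs_of_nonneg (le_min (by norm_num) (abs_nonneg _))]; exact min_le_left _ _))
        (fun x => le_min (by norm_num) (abs_nonneg _))
      refine (norm_integral_le_of_norm_le w1 (Eventually.of_forall fun x => ?_)).trans w2
      rw [← mul_sub, norm_mul, Complex.norm_natCast]
      refine mul_le_mul_of_nonneg_left ?_ (Nat.cast_nonneg _)
      refine (exp_diff _ _).trans (le_of_eq ?_)
      rw [← mul_sub]
    · have h2 := hg.const_mul ((1 + 3 * K) * r)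
      rw [mul_zero] at h2
      exact h2
  have hw' : Tendsto (fun n => ∫ x, (ret T Y x:ℂ) * E n (ind T Y x) ∂P) atTop (nhds (r * w)) := by
    refine hw.congr fun n => ?_
    congr 1; ext x
    simp only [hE, hs]
    congr 3
    rw [Complex.ofReal_inj]; ring
  have d3 : Tendsto (fun n => (∫ x, (G n x - G n (ind T Y x)) ∂μ) + (μ.real Y:ℂ) * (((∫ x, (ret T Y x:ℂ) * G n (ind T Y x) ∂P) - ∫ x, (ret T Y x:ℂ) * E n (ind T Y x) ∂P)
      + ∫ x, (ret T Y x:ℂ) * E n (ind T Y x) ∂P)) atTop (nhds (0 + (μ.real Y:ℂ) * (0 + r * w))) :=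
    d1.add ((d2.add hw').const_mul _)
  have e0 : (0:ℂ) + (μ.real Y:ℂ) * (0 + r * w) = w := by
    rw [zero_add, zero_add, ← mul_assoc, ← Complex.ofReal_mul, hYr]; simp
  rw [e0] at d3
  refine d3.congr fun n => ?_
  rw [integral_sub (hGi n) (hGFi n), int_ind' hT hY hmp hrec hP hF hK hθ0 hmix hRintg hr hYr (G n) (hGm n)]
  ring
end transfer
end LSVproof

open MeasureTheory Set NNReal Filter
namespace LSVproof
set_option linter.unusedSectionVars false
set_option linter.unusedVariables false
set_option linter.style.haveILetI false
open scoped ENNReal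

set_option maxHeartbeats 4000000 in
lemma MAIN {z : ℝ} (hz' : z ∈ Ioo (1/2:ℝ) 1) (μ : Measure ℝ) [IsProbabilityMeasure μ] (hsupp : μ (Icc 0 1)ᶜ = 0) (hac : μ ≪ volume)
    (hinv : MeasurePreserving (lsv z) μ μ) (φ : ℝ → ℝ) (hφm : Measurable φ) {Cφ H ρ : ℝ} (hCφ : 0 < Cφ) (hφ : ∀ x, |φ x| ≤ Cφ) (hH : 0 < H) (hρ : 0 < ρ)
    (hhol : ∀ x ∈ Icc (0:ℝ) 1, ∀ y ∈ Icc (0:ℝ) 1, |φ x - φ y| ≤ H * |x - y|^ρ)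
    (hmean : ∫ x, φ x ∂μ = 0) (h0 : 0 < φ 0) (q : ℝ) (hq : 0 < q) (hqα : q < 1/z) :
    ∃ c > 0, Tendsto (fun n : ℕ => ∫ x, |(n:ℝ)^(-z) * bsum (lsv z) φ n x|^q ∂μ) atTop (nhds c) := by
  have hz : z ∈ Ioo (0:ℝ) 1 := ⟨by linarith [hz'.1], hz'.2⟩
  have hz0 := hz.1
  have hα1 : 1 < 1/z := by rw [lt_div_iff₀ hz0]; linarith [hz.2]
  have hα2 : 1/z < 2 := by rw [div_lt_iff₀ hz0]; linarith [hz'.1]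
  set Y : Set ℝ := Ici (1/2) with hYdef
  have hT := measurable_lsv z
  have hY : MeasurableSet Y := measurableSet_Ici
  have hpt : ∀ a : ℝ, μ {a} = 0 := fun a => hac (by simp)
  have hrec : ∀ᵐ x ∂μ, ∃ n, 1 ≤ n ∧ (lsv z)^[n] x ∈ Y := by
    have h1 : ∀ᵐ x ∂μ, x ∈ Icc (0:ℝ) 1 := hsupp
    have h2 : ∀ᵐ x ∂μ, x ≠ 0 := by rw [ae_iff]; simpa using hpt 0
    have h3 : ∀ᵐ x ∂μ, x ≠ 1/2 := by rw [ae_iff]; simpa using hpt (1/2)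
    filter_upwards [h1, h2, h3] with x a b c
    exact exists_return0 hz ⟨lt_of_le_of_ne a.1 b.symm, a.2⟩ c
  have hμY : μ Y ≠ 0 := by
    intro h
    have := lint_ret hT hY hinv hrec
    rw [Measure.restrict_eq_zero.2 h] at this
    simp at this
  have hμYt : μ Y ≠ ⊤ := measure_ne_top _ _
  set P : Measure ℝ := (μ Y)⁻¹ • μ.restrict Y with hPdef
  have hP : μ.restrict Y = μ Y • P := by rw [hPdef, smul_smul, ENNReal.mul_inv_cancel hμY hμYt, one_smul]
  haveI : IsProbabilityMeasure P := ⟨by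
    rw [hPdef, Measure.smul_apply, Measure.restrict_apply_univ, smul_eq_mul, ENNReal.inv_mul_cancel hμY hμYt]⟩
  have hPac : P ≪ lamY := by
    refine Measure.AbsolutelyContinuous.mk fun s hs h => ?_
    have h1 : μ (s ∩ Ioo (1/2) 1) = 0 := by
      refine hac ?_
      rw [lamY, Measure.restrict_apply hs] at h; exact h
    have h2 : μ (s ∩ Y) = 0 := by
      have hsub : s ∩ Y ⊆ (s ∩ Ioo (1/2) 1) ∪ ({1/2} ∪ ({1} ∪ (Icc 0 1)ᶜ)) := by
        rintro x ⟨hx1, hx2⟩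
        have hx2 : 1/2 ≤ x := hx2
        by_cases ha : x = 1/2
        · right; left; exact ha
        by_cases hb : x = 1
        · right; right; left; exact hb
        rcases lt_or_ge x 1 with hc | hc
        · left; exact ⟨hx1, lt_of_le_of_ne hx2 (Ne.symm ha), hc⟩
        · right; right; right
          intro hd; exact hb (le_antisymm hd.2 hc)
      refine measure_mono_null hsub ?_
      rw [measure_union_null_iff, measure_union_null_iff, measure_union_null_iff]
      exact ⟨h1, hpt _, hpt _, hsupp⟩
    rw [hPdef, Measure.smul_apply, Measure.restrict_apply hs, h2]; simp
  have hF : MeasurePreserving (FF z) P P := (ind_mp hT hY hinv hrec).smul_measure _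
  have hbase : ∀ᵐ x ∂P, x ∈ Ioo (1/2:ℝ) 1 := hPac.ae_le (ae_restrict_mem measurableSet_Ioo)
  have hgood : ∀ᵐ x ∂P, ∀ i, (FF z)^[i] x ∈ Ioo (1/2:ℝ) 1 :=
    ae_all_iff.2 fun i => (hF.iterate i).quasiMeasurePreserving.ae hbase
  have hR := meas_RR z
  have hRm : Measurable (fun x => (RR z x:ℝ)) := measurable_from_nat.comp hR
  have hR1 : ∀ᵐ x ∂P, 1 ≤ RR z x := by filter_upwards [hbase] with x hx using RR_pos hz hx
  obtain ⟨K, hK0, hmix0⟩ := cyl_mix hz hPac hF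
  have hK := hK0.le
  have hmix : ∀ (m : ℕ) (c : ℕ → ℕ) (j : ℕ) (B : Set ℝ), MeasurableSet B →
      |P.real (acyl (FF z) (RR z) m c ∩ (FF z)^[m+j] ⁻¹' B) - P.real (acyl (FF z) (RR z) m c) * P.real B|
        ≤ K * thz z ^ j * (P.real (acyl (FF z) (RR z) m c) * P.real B) := hmix0
  have hθ0 := (thz_mem hz).1
  have hθ1 := (thz_mem hz).2
  obtain ⟨c, hc, hct⟩ := tail_RR hz (P_cone hz hPac hF)
  obtain ⟨C0, hC0, htail⟩ := tail_bound P (RR z) (1/z) c (by linarith) hct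
  have hintY := int_ret hT hY hinv hrec
  have hRintg : Integrable (fun x => (RR z x:ℝ)) P := hintY.1.smul_measure (ENNReal.inv_ne_top.2 hμY)
  set r := ∫ x, (RR z x:ℝ) ∂P with hr
  have hscale : ∀ f : ℝ → ℝ, ∫ x in Y, f x ∂μ = μ.real Y * ∫ x, f x ∂P := fun f => by
    rw [hP, integral_smul_measure]; rfl
  have hYr : μ.real Y * r = 1 := by rw [hr, ← hscale]; exact hintY.2
  have hYpos : μ.real Y ≠ 0 := fun h => by rw [h, zero_mul] at hYr; exact zero_ne_one hYr
  have hr1 := r_ge hF hR hK hθ0 hθ1 hmix hα1 hα2 hC0.le htail hRintg hr hR1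
  -- the induced observable
  set V : ℝ → ℝ := fun x => bsum (lsv z) φ (RR z x) x with hV
  have hVm : Measurable V := measurable_sum_ret hT hY φ hφm
  have hVi : Integrable V P := by
    refine Integrable.mono' (hRintg.const_mul Cφ) hVm.aestronglyMeasurable (Eventually.of_forall fun x => ?_)
    exact bsum_bd hφ _ x
  have hV0 : ∫ x, V x ∂P = 0 := by
    have h1 : ∫ x in Y, V x ∂μ = ∫ x, φ x ∂μ := mean_V hT hY hinv hrec φ hφm Cφ hφ
    rw [hmean, hscale] at h1
    exact (mul_eq_zero.1 h1).resolve_left hYpos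
  set W : ℝ → ℝ := fun x => bsum (lsv z) φ (RR z x) x - φ 0 * (RR z x - r) with hWdef
  have hW : ∀ x, W x = bsum (lsv z) φ (RR z x) x - φ 0 * (RR z x - r) := fun x => rfl
  have hi1 : Integrable (fun x => φ 0 * ((RR z x:ℝ) - r)) P := (hRintg.sub (integrable_const r)).const_mul _
  have hWm : Measurable W := hVm.sub ((hRm.sub_const r).const_mul _)
  have hWi : Integrable W P := hVi.sub hi1
  have hW0 : ∫ x, W x ∂P = 0 := by
    have e1 : ∫ x, W x ∂P = ∫ x, V x ∂P - ∫ x, φ 0 * ((RR z x:ℝ) - r) ∂P := integral_sub hVi hi1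
    have e2 : ∫ x, ((RR z x:ℝ) - r) ∂P = 0 := by
      rw [integral_sub hRintg (integrable_const r), ← hr]; simp
    rw [e1, hV0, integral_const_mul, e2]; simp
  obtain ⟨s, C, D, η, hs, hs1, hC, hD, hη0, hη1, -, hWW⟩ := W_props hz hCφ hφ hH hρ hhol hz'.1 P hgood r W hW
  obtain ⟨CR, hCR, hRt⟩ := R_tail hF hR hK hθ0 hθ1 hmix hα1 hα2 hC0.le htail hRintg hr hR1
  have hWs := W_small hF hR hK hθ0 hθ1 hmix hα1 hα2 hC0.le htail hRintg hr hR1 hWm hWi hW0 hs hs1 hC hD hη0 hη1 hWW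
  have hFT : ∀ x, FF z x = (lsv z)^[RR z x] x := fun x => rfl
  obtain ⟨C1, hC1, hTP⟩ := T_P hF hT hFT hφm hCφ hφ (hφ 0) hα1 hα2 hr1 hW hCR hRt hWs
  obtain ⟨k, hk1, hk2⟩ := INPROB hF hT hFT hφm hCφ hφ (hφ 0) hα1 hα2 hr1 hW hCR hRt hWs
  obtain ⟨Cμ, hμt⟩ := MU_tail hT hY hinv hrec hP hF hK hθ0 hmix hRintg hr hYr hφm hCφ hφ hα1 hC0.le hC1 htail hTP
  obtain ⟨ψ, hψ, hCF⟩ := CF hF hR hK hθ0 hθ1 hmix hRintg (1/z) c r hα1 hα2 hc hr hct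
  have hr0 : 0 < r := by linarith
  have hzz : 1/(1/z) = z := by simp
  have hbm : ∀ n, Measurable (bsum (lsv z) φ n) := fun n => bsum_meas hT φ hφm n
  have hchar : ∀ t > 0, Tendsto (fun n : ℕ => ∫ x, Complex.exp (Complex.I * ((t * (n:ℝ)^(-z)) * bsum (lsv z) φ n x : ℝ)) ∂μ) atTop
      (nhds (Complex.exp (((1/r:ℝ):ℂ) * (((t * φ 0)^(1/z) : ℝ):ℂ) * ψ))) := by
    intro t ht
    have h1 := hCF (t * φ 0) (1/r) k (by positivity) (by positivity) hk1
    have h2 := MU_char hT hY hinv hrec hP hF hK hθ0 hmix hRintg hr hYr hφm hCφ hφ hα1 k hk2 t ht _ h1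
    rw [hzz] at h2
    exact h2
  set w : ℝ → ℂ := fun t => ((1/r:ℝ):ℂ) * (((t * φ 0)^(1/z) : ℝ):ℂ) * ψ with hw
  refine moment_limit μ (fun n x => (n:ℝ)^(-z) * bsum (lsv z) φ n x) (fun n => ((hbm n).const_mul _).aemeasurable) (1/z) q Cμ hq hqα hα2 ?_
    (fun t => (Complex.exp (w t)).re) ?_ ?_
  · filter_upwards [eventually_ge_atTop 1] with n hn x hx
    have := hμt n hn x hx
    rw [hzz] at this; exact this
  · intro t ht
    have h1 := (Complex.continuous_re.tendsto _).comp (hchar t ht)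
    refine h1.congr fun n => ?_
    simp only [Function.comp]
    have hi : Integrable (fun x => Complex.exp (Complex.I * ((t * (n:ℝ)^(-z)) * bsum (lsv z) φ n x : ℝ))) μ := by
      refine Integrable.of_bound (C := 1) ?_ (Eventually.of_forall fun x => ?_)
      · have hcm : Measurable (fun u : ℝ => Complex.exp (Complex.I * (u:ℂ))) := by fun_prop
        exact (hcm.comp ((hbm n).const_mul _)).aestronglyMeasurable
      · rw [mul_comm, Complex.norm_exp_ofReal_mul_I]
    have h2 : (∫ x, Complex.exp (Complex.I * ((t * (n:ℝ)^(-z)) * bsum (lsv z) φ n x : ℝ)) ∂μ).re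
        = ∫ x, (Complex.exp (Complex.I * ((t * (n:ℝ)^(-z)) * bsum (lsv z) φ n x : ℝ))).re ∂μ := (integral_re hi).symm
    rw [h2]
    congr 1; ext x
    rw [mul_comm Complex.I, Complex.exp_ofReal_mul_I_re, mul_assoc]
  · have hcont : Tendsto (fun t : ℝ => ‖w t‖) (nhdsWithin 0 (Ioi 0)) (nhds 0) := by
      have h1 : Continuous (fun t : ℝ => ‖w t‖) := by
        have : Continuous (fun t : ℝ => (t * φ 0)^(1/z)) := (continuous_id.mul continuous_const).rpow_const (fun x => Or.inr (by positivity))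
        simp only [hw]
        fun_prop
      have h2 := (h1.tendsto 0).mono_left (nhdsWithin_le_nhds (s := Ioi (0:ℝ)))
      have h3 : ‖w 0‖ = 0 := by
        simp only [hw, zero_mul]
        rw [Real.zero_rpow (by positivity)]; simp
      rwa [h3] at h2
    have hev := hcont.eventually (gt_mem_nhds (show (0:ℝ) < 6 by norm_num))
    rw [eventually_nhdsWithin_iff, Metric.eventually_nhds_iff] at hev
    obtain ⟨ε, hε, hev⟩ := hev
    refine ⟨ε, hε, fun t ht hts => ?_⟩
    refine re_exp_lt_one (w t) ?_ (hev (by rw [Real.dist_eq, sub_zero, abs_of_pos ht]; exact hts) ht) ?_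
    · simp only [hw]
      have : (0:ℝ) < (t * φ 0)^(1/z) := by positivity
      refine mul_ne_zero (mul_ne_zero ?_ ?_) hψ
      · exact_mod_cast (by positivity : (0:ℝ) < 1/r).ne'
      · exact_mod_cast this.ne'
    · refine le_of_tendsto (hchar t ht).norm (Eventually.of_forall fun n => ?_)
      refine (norm_integral_le_of_norm_le (integrable_const (1:ℝ)) (Eventually.of_forall fun x => ?_)).trans (by simp)
      rw [mul_comm, Complex.norm_exp_ofReal_mul_I]
end LSVproof

open MeasureTheory Set NNReal Filter
namespace LSVproof

lemma final_aux {z : ℝ} (hz : z ∈ Set.Ioo (1 / 2 : ℝ) 1)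
    (μ : Measure ℝ) [IsProbabilityMeasure μ] (hμsupp : μ (Set.Icc (0 : ℝ) 1)ᶜ = 0)
    (hμac : μ ≪ volume) (hμinv : MeasurePreserving (lsv z) μ μ)
    (φ : ℝ → ℝ) (hφ : ∃ C r : ℝ≥0, 0 < r ∧ r ≤ 1 ∧ HolderOnWith C r φ (Set.Icc (0 : ℝ) 1))
    (hmean : ∫ x, φ x ∂μ = 0) (ε : ℝ) (hε : |ε| = 1) (h0 : 0 < ε * φ 0)
    (q : ℝ) (hq : 0 < q) (hqα : q < 1 / z) :
    ∃ c : ℝ, 0 < c ∧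
      Tendsto (fun n : ℕ => (∫ x, |lsvBirkhoff z φ n x| ^ q ∂μ) / (n : ℝ) ^ (q / (1 / z)))
        atTop (nhds c) := by
  obtain ⟨C, r, hr0, hr1, hH⟩ := hφ
  have hz0 : z ∈ Ioo (0:ℝ) 1 := ⟨by linarith [hz.1], hz.2⟩
  set cl : ℝ → ℝ := fun x => max 0 (min 1 x) with hcl
  have hclc : Continuous cl := by simp only [hcl]; fun_prop
  have hclm : ∀ x, cl x ∈ Icc (0:ℝ) 1 := fun x =>
    ⟨le_max_left _ _, max_le zero_le_one (min_le_left _ _)⟩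
  have hclid : ∀ x ∈ Icc (0:ℝ) 1, cl x = x := by
    intro x hx
    simp only [hcl]
    rw [min_eq_right hx.2, max_eq_right hx.1]
  have hpc : Continuous (fun x => φ (cl x)) := (hH.continuousOn hr0).comp_continuous hclc hclm
  have hdist : ∀ x ∈ Icc (0:ℝ) 1, ∀ y ∈ Icc (0:ℝ) 1, |φ x - φ y| ≤ C * |x - y| ^ (r:ℝ) := by
    intro x hx y hy
    have := hH.dist_le hx hy
    simpa [Real.dist_eq] using this
  have hr0' : (0:ℝ) < r := by exact_mod_cast hr0
  have hae : ∀ᵐ x ∂μ, x ∈ Icc (0:ℝ) 1 := by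
    rw [ae_iff]; exact hμsupp
  have hC0 : (0:ℝ) ≤ C := C.2
  obtain ⟨c, hc, ht⟩ := MAIN hz μ hμsupp hμac hμinv (fun x => ε * φ (cl x))
    (by exact (continuous_const.mul hpc).measurable)
    (Cφ := |φ 0| + C + 1) (H := C + 1) (ρ := r) (by positivity)
    (by
      intro x
      rw [abs_mul, hε, one_mul]
      have h1 := hdist _ (hclm x) 0 ⟨le_refl _, zero_le_one⟩
      have h2 : |cl x - 0| ^ (r:ℝ) ≤ 1 := by
        apply Real.rpow_le_one (abs_nonneg _) _ hr0'.le
        rw [sub_zero, abs_of_nonneg (hclm x).1]; exact (hclm x).2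
      have h3 : |φ (cl x)| ≤ |φ (cl x) - φ 0| + |φ 0| := by
        have := abs_add_le (φ (cl x) - φ 0) (φ 0)
        simpa using this
      nlinarith)
    (by positivity) hr0'
    (by
      intro x hx y hy
      simp only [hclid x hx, hclid y hy]
      rw [← mul_sub, abs_mul, hε, one_mul]
      refine (hdist x hx y hy).trans ?_
      have : 0 ≤ |x - y| ^ (r:ℝ) := by positivity
      nlinarith)
    (by
      rw [integral_const_mul]
      have : ∫ x, φ (cl x) ∂μ = ∫ x, φ x ∂μ := by
        apply integral_congr_ae
        filter_upwards [hae] with x hx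
        rw [hclid x hx]
      rw [this, hmean, mul_zero])
    (by simpa [hclid 0 ⟨le_refl _, zero_le_one⟩] using h0) q hq hqα
  refine ⟨c, hc, ht.congr' ?_⟩
  filter_upwards [eventually_ge_atTop 1] with n hn
  have hn' : (0:ℝ) < n := by exact_mod_cast hn
  rw [← integral_div]
  apply integral_congr_ae
  filter_upwards [hae] with x hx
  have hb : bsum (lsv z) (fun x => ε * φ (cl x)) n x = ε * lsvBirkhoff z φ n x := by
    simp only [bsum, lsvBirkhoff, Finset.mul_sum]
    apply Finset.sum_congr rfl
    intro i _
    rw [hclid _ (lsv_iter_mem hz0 hx i)]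
  rw [hb, abs_mul, abs_mul, hε, one_mul, Real.mul_rpow (abs_nonneg _) (abs_nonneg _),
    abs_of_pos (Real.rpow_pos_of_pos hn' _), ← Real.rpow_mul hn'.le, div_eq_mul_inv _ ((n:ℝ)^_),
    ← Real.rpow_neg hn'.le, mul_comm]
  congr 2
  simp [div_eq_mul_inv]; ring

end LSVproof

/-- For `z ∈ (1/2, 1)`, `α = 1/z`, `μ` the unique absolutely continuous
`f_z`-invariant Borel probability measure on `[0,1]`, and `φ` Hölder with mean zero and
`φ(0) ≠ 0`, the moments of order `0 < q < α` satisfy `∫ |Φ_n|^q dμ / n^{q/α} → c` for some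
constant `c > 0`. -/
theorem lsv_low_moment_scaling
    (z : ℝ) (hz : z ∈ Set.Ioo (1 / 2 : ℝ) 1)
    (μ : Measure ℝ) (hμprob : IsProbabilityMeasure μ) (hμsupp : μ (Set.Icc (0 : ℝ) 1)ᶜ = 0)
    (hμac : μ ≪ volume) (hμinv : MeasurePreserving (lsv z) μ μ)
    (φ : ℝ → ℝ) (hφ : ∃ C r : ℝ≥0, 0 < r ∧ r ≤ 1 ∧ HolderOnWith C r φ (Set.Icc (0 : ℝ) 1))
    (hmean : ∫ x, φ x ∂μ = 0) (h0 : φ 0 ≠ 0)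
    (q : ℝ) (hq : 0 < q) (hqα : q < 1 / z) :
    ∃ c : ℝ, 0 < c ∧
      Tendsto (fun n : ℕ => (∫ x, |lsvBirkhoff z φ n x| ^ q ∂μ) / (n : ℝ) ^ (q / (1 / z)))
        atTop (nhds c) := by

  haveI := hμprob
  rcases lt_or_gt_of_ne h0 with h | h
  · exact LSVproof.final_aux hz μ hμsupp hμac hμinv φ hφ hmean (-1) (by simp) (by linarith) q hq hqα
  · exact LSVproof.final_aux hz μ hμsupp hμac hμinv φ hφ hmean 1 (by simp) (by linarith) q hq hqα
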